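/- arXiv:1309.1970 — 2 statements merged into one kernel-verified Lean document; each statement's English description precedes it below -/
import Mathlib

section
/- Assume m ≥ 2, n ≥ 2, U ⊆ ℝ^m open and connected, H(u) = H0 + u1·H1 + ⋯ + um·Hm with H0,…,Hm Hermitian n×n complex matrices, that the spectrum of H(·) is conically connected, and that the trace of H(u) is nonzero for some u ∈ U. Then the lifted control system i·ġ(t) = H(u(t))·g(t) on the unitary group U(n) is exactly controllable: for every g0 ∈ U(n), its reachable set from g0 is all of U(n). -/
open scoped BigOperators

/-- The control-affine Hamiltonian `H(u) = H0 + u 1 • H1 + ⋯ + u m • Hm`. -/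
noncomputable def controlHam {n m : ℕ} (H0 : Matrix (Fin n) (Fin n) ℂ)
    (Hc : Fin m → Matrix (Fin n) (Fin n) ℂ) (u : EuclideanSpace ℝ (Fin m)) :
    Matrix (Fin n) (Fin n) ℂ :=
  H0 + ∑ i, (u i : ℂ) • Hc i

/-- `lam u 0 ≤ ⋯ ≤ lam u (n-1)` are the eigenvalues of `H(u)`, repeated according to
their multiplicities, for every `u ∈ U`:  `lam u` is monotone and the characteristic
polynomial of `H(u)` is `∏ j, (X - lam u j)`. -/
def IsOrderedSpectrum {n m : ℕ} (H0 : Matrix (Fin n) (Fin n) ℂ)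
    (Hc : Fin m → Matrix (Fin n) (Fin n) ℂ) (U : Set (EuclideanSpace ℝ (Fin m)))
    (lam : EuclideanSpace ℝ (Fin m) → Fin n → ℝ) : Prop :=
  ∀ u ∈ U, Monotone (lam u) ∧
    (controlHam H0 Hc u).charpoly = ∏ j, (Polynomial.X - Polynomial.C ((lam u j : ℂ)))

/-- The eigenvalue `lam ubar l` is a simple eigenvalue. -/
def SimpleEigAt {n m : ℕ} (lam : EuclideanSpace ℝ (Fin m) → Fin n → ℝ)
    (ubar : EuclideanSpace ℝ (Fin m)) (l : Fin n) : Prop :=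
  ∀ l' : Fin n, lam ubar l' = lam ubar l → l' = l

/-- `ubar ∈ U` is a conical intersection between the (consecutive) eigenvalues
`lam · j` and `lam · k`:  they coincide at `ubar`, the common value is an eigenvalue of
multiplicity two, and the gap opens at least linearly in every direction. -/
def ConicalAt {n m : ℕ} (U : Set (EuclideanSpace ℝ (Fin m)))
    (lam : EuclideanSpace ℝ (Fin m) → Fin n → ℝ) (j k : Fin n)
    (ubar : EuclideanSpace ℝ (Fin m)) : Prop :=
  ubar ∈ U ∧ lam ubar j = lam ubar k ∧
  (∀ l : Fin n, lam ubar l = lam ubar j ↔ (l = j ∨ l = k)) ∧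
  ∃ c > (0 : ℝ), ∀ v : EuclideanSpace ℝ (Fin m), ‖v‖ = 1 →
    ∃ ε > (0 : ℝ), ∀ t : ℝ, 0 < t → t < ε →
      lam (ubar + t • v) k - lam (ubar + t • v) j > c * t

/-- The spectrum is conically connected: every eigenvalue intersection is conical, and
every pair of subsequent eigenvalues admits a conical intersection at which all the
other eigenvalues are simple. -/
def ConicallyConnected {n m : ℕ} (U : Set (EuclideanSpace ℝ (Fin m)))
    (lam : EuclideanSpace ℝ (Fin m) → Fin n → ℝ) : Prop :=
  (∀ ubar ∈ U, ∀ j k : Fin n, (j : ℕ) + 1 = (k : ℕ) → lam ubar j = lam ubar k →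
    ConicalAt U lam j k ubar) ∧
  (∀ j k : Fin n, (j : ℕ) + 1 = (k : ℕ) → ∃ ubar : EuclideanSpace ℝ (Fin m),
    ConicalAt U lam j k ubar ∧ ∀ l : Fin n, l ≠ j → l ≠ k → SimpleEigAt lam ubar l)

attribute [local instance] Matrix.normedAddCommGroup Matrix.normedSpace

open MeasureTheory in
/-- A control `u : [0,T] → U` which is measurable and (essentially) bounded. -/
def IsAdmissibleControl {m : ℕ} (U : Set (EuclideanSpace ℝ (Fin m))) (T : ℝ)
    (u : ℝ → EuclideanSpace ℝ (Fin m)) : Prop :=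
  AEStronglyMeasurable u (volume.restrict (Set.Icc 0 T)) ∧
  (∀ t ∈ Set.Icc 0 T, u t ∈ U) ∧ ∃ C : ℝ, ∀ t ∈ Set.Icc 0 T, ‖u t‖ ≤ C

/-- An admissible trajectory of the lifted system `i·ġ(t) = H(u(t))·g(t)` on the
unitary group: an absolutely continuous curve in `U(n)` solving the equation almost
everywhere on `[0,T]`, encoded in integral form. -/
def IsLiftedTrajectory {n m : ℕ}
    (Hmat : EuclideanSpace ℝ (Fin m) → Matrix (Fin n) (Fin n) ℂ) (T : ℝ)
    (u : ℝ → EuclideanSpace ℝ (Fin m)) (g : ℝ → Matrix (Fin n) (Fin n) ℂ) : Prop :=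
  (∀ t ∈ Set.Icc 0 T, g t ∈ Matrix.unitaryGroup (Fin n) ℂ) ∧
  @IntervalIntegrable (Matrix (Fin n) (Fin n) ℂ)
    Matrix.normedAddCommGroup.toPseudoMetricSpace.toUniformSpace.toTopologicalSpace
    NormedAddCommGroup.toENormedAddCommMonoid.toENormedAddMonoid
    (fun s => (-Complex.I) • (Hmat (u s) * g s))
    MeasureTheory.volume 0 T ∧
  ∀ t ∈ Set.Icc 0 T, g t = g 0 + ∫ s in (0:ℝ)..t, (-Complex.I) • (Hmat (u s) * g s)

/-- The reachable set from `g0` of the lifted system on the unitary group. -/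
def liftedReachable {n m : ℕ} (U : Set (EuclideanSpace ℝ (Fin m)))
    (Hmat : EuclideanSpace ℝ (Fin m) → Matrix (Fin n) (Fin n) ℂ)
    (g0 : Matrix (Fin n) (Fin n) ℂ) : Set (Matrix (Fin n) (Fin n) ℂ) :=
  {g1 | ∃ T : ℝ, 0 ≤ T ∧ ∃ u g, IsAdmissibleControl U T u ∧
    IsLiftedTrajectory Hmat T u g ∧ g 0 = g0 ∧ g T = g1}

/-- An admissible trajectory of the system `i·ψ̇(t) = H(u(t))·ψ(t)` on the unit sphere
of `ℂ^n`: an absolutely continuous curve in the sphere solving the equation almost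
everywhere on `[0,T]`, encoded in integral form. -/
def IsSphereTrajectory {n m : ℕ}
    (Hmat : EuclideanSpace ℝ (Fin m) → Matrix (Fin n) (Fin n) ℂ) (T : ℝ)
    (u : ℝ → EuclideanSpace ℝ (Fin m)) (ψ : ℝ → EuclideanSpace ℂ (Fin n)) : Prop :=
  (∀ t ∈ Set.Icc 0 T, ψ t ∈ Metric.sphere (0 : EuclideanSpace ℂ (Fin n)) 1) ∧
  IntervalIntegrable (fun s => (-Complex.I) • Matrix.toEuclideanLin (Hmat (u s)) (ψ s))
    MeasureTheory.volume 0 T ∧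
  ∀ t ∈ Set.Icc 0 T,
    ψ t = ψ 0 + ∫ s in (0:ℝ)..t, (-Complex.I) • Matrix.toEuclideanLin (Hmat (u s)) (ψ s)

/-- The reachable set from `ψ0` of the system on the unit sphere of `ℂ^n`. -/
def sphereReachable {n m : ℕ} (U : Set (EuclideanSpace ℝ (Fin m)))
    (Hmat : EuclideanSpace ℝ (Fin m) → Matrix (Fin n) (Fin n) ℂ)
    (ψ0 : EuclideanSpace ℂ (Fin n)) : Set (EuclideanSpace ℂ (Fin n)) :=
  {ψ1 | ∃ T : ℝ, 0 ≤ T ∧ ∃ u ψ, IsAdmissibleControl U T u ∧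
    IsSphereTrajectory Hmat T u ψ ∧ ψ 0 = ψ0 ∧ ψ T = ψ1}

/-- The unitary flow `exp(-i t G)`. -/
noncomputable def qflow {n : ℕ} (G : Matrix (Fin n) (Fin n) ℂ) (t : ℝ) :
    Matrix (Fin n) (Fin n) ℂ :=
  NormedSpace.exp (t • ((-Complex.I) • G))

section
open scoped Matrix.Norms.L2Operator
theorem qflow_hasStrictDerivAt {n : ℕ} (G : Matrix (Fin n) (Fin n) ℂ) (t : ℝ) :
    HasStrictDerivAt (qflow G) (((-Complex.I) • G) * qflow G t) t := by
  exact hasStrictDerivAt_exp_smul_const' (𝕂 := ℝ) (𝔸 := Matrix (Fin n) (Fin n) ℂ)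
    ((-Complex.I) • G) t
end

theorem qflow_hasDerivAt {n : ℕ} (G : Matrix (Fin n) (Fin n) ℂ) (t : ℝ) :
    HasDerivAt (qflow G) (((-Complex.I) • G) * qflow G t) t :=
  (qflow_hasStrictDerivAt G t).hasDerivAt

theorem qflow_zero {n : ℕ} (G : Matrix (Fin n) (Fin n) ℂ) : qflow G 0 = 1 := by
  simp [qflow]

theorem qflow_add {n : ℕ} (G : Matrix (Fin n) (Fin n) ℂ) (s t : ℝ) :
    qflow G (s + t) = qflow G s * qflow G t := by
  unfold qflow
  rw [add_smul, Matrix.exp_add_of_commute]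
  exact ((Commute.refl _).smul_left _).smul_right _

theorem qflow_star {n : ℕ} {G : Matrix (Fin n) (Fin n) ℂ} (hG : G.IsHermitian) (t : ℝ) :
    star (qflow G t) = qflow G (-t) := by
  unfold qflow
  rw [Matrix.star_eq_conjTranspose, ← Matrix.exp_conjTranspose, Matrix.conjTranspose_smul,
    Matrix.conjTranspose_smul, hG.eq]
  simp

theorem qflow_mem {n : ℕ} {G : Matrix (Fin n) (Fin n) ℂ} (hG : G.IsHermitian) (t : ℝ) :
    qflow G t ∈ Matrix.unitaryGroup (Fin n) ℂ := by
  rw [Matrix.mem_unitaryGroup_iff, qflow_star hG, ← qflow_add]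
  simp [qflow_zero]

theorem qflow_conj {n : ℕ} {G V : Matrix (Fin n) (Fin n) ℂ}
    (hV : V ∈ Matrix.unitaryGroup (Fin n) ℂ) (t : ℝ) :
    qflow (V * G * star V) t = V * qflow G t * star V := by
  have h1 : V * star V = 1 := Matrix.mem_unitaryGroup_iff.1 hV
  have hi : V⁻¹ = star V := Matrix.inv_eq_right_inv h1
  have hu : IsUnit V := IsUnit.of_mul_eq_one _ h1
  unfold qflow
  rw [← hi, ← Matrix.exp_conj _ _ hu]
  congr 1
  simp

theorem qflow_smul {n : ℕ} (G : Matrix (Fin n) (Fin n) ℂ) (s t : ℝ) :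
    qflow (s • G) t = qflow G (t * s) := by
  unfold qflow
  rw [smul_comm (-Complex.I) s G, smul_smul]

theorem qflow_continuous {n : ℕ} (G : Matrix (Fin n) (Fin n) ℂ) : Continuous (qflow G) :=
  continuous_iff_continuousAt.2 fun t => (qflow_hasDerivAt G t).continuousAt

theorem unitary_isCompact (n : ℕ) :
    IsCompact (Matrix.unitaryGroup (Fin n) ℂ : Set (Matrix (Fin n) (Fin n) ℂ)) := by
  refine Metric.isCompact_of_isClosed_isBounded ?_ ?_
  · have : (Matrix.unitaryGroup (Fin n) ℂ : Set (Matrix (Fin n) (Fin n) ℂ)) =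
        {A | A * star A = 1} := by
      ext A; simp [Matrix.mem_unitaryGroup_iff]
    rw [this]
    exact isClosed_eq (by fun_prop) continuous_const
  · rw [isBounded_iff_forall_norm_le]
    exact ⟨1, fun A hA => entrywise_sup_norm_bound_of_unitary hA⟩

instance unitary_compactSpace (n : ℕ) : CompactSpace (Matrix.unitaryGroup (Fin n) ℂ) :=
  isCompact_iff_compactSpace.1 (unitary_isCompact n)

/-- Interval integrability for matrix valued functions, with explicit instances. -/
abbrev MatIntervalIntegrable {n : ℕ} (f : ℝ → Matrix (Fin n) (Fin n) ℂ) (a b : ℝ) : Prop :=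
  @IntervalIntegrable (Matrix (Fin n) (Fin n) ℂ)
    Matrix.normedAddCommGroup.toPseudoMetricSpace.toUniformSpace.toTopologicalSpace
    NormedAddCommGroup.toENormedAddCommMonoid.toENormedAddMonoid f MeasureTheory.volume a b

/-! ### reachability by piecewise constant controls -/

theorem reach_self {n m : ℕ} (U : Set (EuclideanSpace ℝ (Fin m))) (hU : U.Nonempty)
    (Hmat : EuclideanSpace ℝ (Fin m) → Matrix (Fin n) (Fin n) ℂ)
    {g0 : Matrix (Fin n) (Fin n) ℂ} (hg0 : g0 ∈ Matrix.unitaryGroup (Fin n) ℂ) :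
    g0 ∈ liftedReachable U Hmat g0 := by
  obtain ⟨u, hu⟩ := hU
  refine ⟨0, le_rfl, fun _ => u, fun _ => g0, ⟨?_, fun _ _ => hu, ‖u‖, fun _ _ => le_rfl⟩,
    ⟨fun _ _ => hg0, ?_, ?_⟩, rfl, rfl⟩
  · exact MeasureTheory.aestronglyMeasurable_const
  · exact IntervalIntegrable.refl
  · intro t ht
    have : t = 0 := le_antisymm ht.2 ht.1
    subst this
    simp

theorem reach_step {n m : ℕ} (U : Set (EuclideanSpace ℝ (Fin m)))
    (Hmat : EuclideanSpace ℝ (Fin m) → Matrix (Fin n) (Fin n) ℂ)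
    {g0 g1 : Matrix (Fin n) (Fin n) ℂ} (hg1 : g1 ∈ liftedReachable U Hmat g0)
    {v : EuclideanSpace ℝ (Fin m)} (hv : v ∈ U) (hH : (Hmat v).IsHermitian)
    {τ : ℝ} (hτ : 0 ≤ τ) :
    qflow (Hmat v) τ * g1 ∈ liftedReachable U Hmat g0 := by
  obtain ⟨T, hT, u, g, ⟨hum, huU, C, huC⟩, ⟨hgU, hgi, hge⟩, hg0, hgT⟩ := hg1
  have hg1U : g1 ∈ Matrix.unitaryGroup (Fin n) ℂ := hgT ▸ hgU T ⟨hT, le_rfl⟩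
  set u' : ℝ → EuclideanSpace ℝ (Fin m) := fun s => if s ≤ T then u s else v with hu'
  set g' : ℝ → Matrix (Fin n) (Fin n) ℂ :=
    fun s => if s ≤ T then g s else qflow (Hmat v) (s - T) * g1 with hg'
  set k : ℝ → Matrix (Fin n) (Fin n) ℂ := fun s => qflow (Hmat v) (s - T) * g1 with hk
  have hkT : k T = g1 := by simp [hk, qflow_zero]
  have hkd : ∀ s, HasDerivAt k ((-Complex.I) • (Hmat v * k s)) s := by
    intro s
    have h1 : HasDerivAt (fun s => qflow (Hmat v) (s - T))
        (((-Complex.I) • Hmat v) * qflow (Hmat v) (s - T)) s := by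
      exact (qflow_hasDerivAt (Hmat v) (s - T)).comp_sub_const s T
    have h2 : HasDerivAt k ((((-Complex.I) • Hmat v) * qflow (Hmat v) (s - T)) * g1) s := by
      have := ((LinearMap.mulRight ℝ g1).toContinuousLinearMap).hasFDerivAt.comp_hasDerivAt s h1
      exact this
    convert h2 using 1
    simp [hk, Matrix.mul_assoc]
  have hkc : Continuous k := continuous_iff_continuousAt.2 fun s => (hkd s).continuousAt
  have hfc : Continuous (fun s => (-Complex.I) • (Hmat v * k s)) := by
    have h1 : Continuous (fun s => Hmat v * k s) := continuous_const.matrix_mul hkc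
    exact Continuous.const_smul h1 (-Complex.I)
  set f' : ℝ → Matrix (Fin n) (Fin n) ℂ := fun s => (-Complex.I) • (Hmat (u' s) * g' s) with hf'
  have hfe1 : ∀ t ∈ Set.Icc 0 T, ∀ s ∈ Set.uIoc 0 t, f' s = (-Complex.I) • (Hmat (u s) * g s) := by
    intro t ht s hs
    rw [Set.uIoc_of_le ht.1] at hs
    have : s ≤ T := hs.2.trans ht.2
    simp [hf', hu', hg', this]
  have hfe2 : ∀ t, T ≤ t → ∀ s ∈ Set.uIoc T t, f' s = (-Complex.I) • (Hmat v * k s) := by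
    intro t ht s hs
    rw [Set.uIoc_of_le ht] at hs
    have : ¬ s ≤ T := not_le.2 hs.1
    simp [hf', hu', hg', this, hk]
  have hi1 : MatIntervalIntegrable f' 0 T :=
    hgi.congr fun s hs => (hfe1 T ⟨hT, le_rfl⟩ s hs).symm
  have hi2 : ∀ t, T ≤ t → MatIntervalIntegrable f' T t := fun t ht =>
    (hfc.intervalIntegrable T t).congr fun s hs => (hfe2 t ht s hs).symm
  have hg'0 : g' 0 = g 0 := by simp [hg', hT]
  refine ⟨T + τ, by positivity, u', g', ⟨?_, ?_, max C ‖v‖, ?_⟩, ⟨?_, ?_, ?_⟩, ?_, ?_⟩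
  · have : u' = Set.piecewise (Set.Iic T) u (fun _ => v) := by
      ext s : 1
      simp [hu', Set.piecewise]
    rw [this]
    refine MeasureTheory.AEStronglyMeasurable.piecewise measurableSet_Iic ?_ MeasureTheory.aestronglyMeasurable_const
    rw [MeasureTheory.Measure.restrict_restrict measurableSet_Iic]
    refine hum.mono_measure (MeasureTheory.Measure.restrict_mono ?_ le_rfl)
    exact fun s hs => ⟨hs.2.1, hs.1⟩
  · intro t ht
    by_cases h : t ≤ T
    · simpa [hu', h] using huU t ⟨ht.1, h⟩
    · simpa [hu', h] using hv
  · intro t ht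
    by_cases h : t ≤ T
    · simpa [hu', h] using Or.inl (huC t ⟨ht.1, h⟩)
    · simp [hu', h]
  · intro t ht
    by_cases h : t ≤ T
    · simpa [hg', h] using hgU t ⟨ht.1, h⟩
    · simpa [hg', h] using mul_mem (qflow_mem hH (t - T)) hg1U
  · exact hi1.trans (hi2 _ (by linarith))
  · intro t ht
    by_cases h : t ≤ T
    · have h1 : g' t = g t := by simp [hg', h]
      rw [h1, hg'0, hge t ⟨ht.1, h⟩]
      congr 1
      refine intervalIntegral.integral_congr_ae (Filter.Eventually.of_forall fun s hs => ?_)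
      exact (hfe1 t ⟨ht.1, h⟩ s hs).symm
    · have h1 : g' t = k t := by simp [hg', h, hk]
      have ht' : T ≤ t := (not_le.1 h).le
      rw [h1, hg'0, ← intervalIntegral.integral_add_adjacent_intervals hi1 (hi2 t ht')]
      have e1 : (∫ s in (0:ℝ)..T, f' s) = g1 - g 0 := by
        rw [← hgT, hge T ⟨hT, le_rfl⟩, add_sub_cancel_left]
        exact intervalIntegral.integral_congr_ae (Filter.Eventually.of_forall fun s hs => hfe1 T ⟨hT, le_rfl⟩ s hs)
      have e2 : (∫ s in T..t, f' s) = k t - k T := by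
        rw [← intervalIntegral.integral_eq_sub_of_hasDerivAt (fun s _ => hkd s) (hfc.intervalIntegrable T t)]
        exact intervalIntegral.integral_congr_ae (Filter.Eventually.of_forall fun s hs => hfe2 t ht' s hs)
      rw [e1, e2, hkT]
      abel
  · rw [hg'0, hg0]
  · by_cases h : τ = 0
    · subst h
      simp [hg', hgT, qflow_zero]
    · have : ¬ T + τ ≤ T := by
        have := lt_of_le_of_ne hτ (Ne.symm h)
        linarith
      simp [hg', this]

/-! ### diagonalisation -/

/-- `V` is unitary and diagonalises `A` with eigenvalues `a`. -/
def DiagBy {n : ℕ} (V A : Matrix (Fin n) (Fin n) ℂ) (a : Fin n → ℝ) : Prop :=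
  V ∈ Matrix.unitaryGroup (Fin n) ℂ ∧ star V * A * V = Matrix.diagonal (fun k => ((a k : ℝ) : ℂ))

theorem uni_mul_star {n : ℕ} {V : Matrix (Fin n) (Fin n) ℂ}
    (hV : V ∈ Matrix.unitaryGroup (Fin n) ℂ) : V * star V = 1 := Matrix.mem_unitaryGroup_iff.1 hV

theorem uni_star_mul {n : ℕ} {V : Matrix (Fin n) (Fin n) ℂ}
    (hV : V ∈ Matrix.unitaryGroup (Fin n) ℂ) : star V * V = 1 := Matrix.mem_unitaryGroup_iff'.1 hV

theorem uni_star_mem {n : ℕ} {V : Matrix (Fin n) (Fin n) ℂ}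
    (hV : V ∈ Matrix.unitaryGroup (Fin n) ℂ) : star V ∈ Matrix.unitaryGroup (Fin n) ℂ := by
  rw [Matrix.mem_unitaryGroup_iff, star_star]; exact uni_star_mul hV

theorem star_conj_conj {n : ℕ} {V : Matrix (Fin n) (Fin n) ℂ}
    (hV : V ∈ Matrix.unitaryGroup (Fin n) ℂ) (A : Matrix (Fin n) (Fin n) ℂ) :
    star V * (V * A * star V) * V = A := by
  have h := uni_star_mul hV
  calc star V * (V * A * star V) * V = (star V * V) * A * (star V * V) := by
        simp only [Matrix.mul_assoc]
    _ = A := by rw [h, Matrix.one_mul, Matrix.mul_one]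

theorem conj_star_conj {n : ℕ} {V : Matrix (Fin n) (Fin n) ℂ}
    (hV : V ∈ Matrix.unitaryGroup (Fin n) ℂ) (A : Matrix (Fin n) (Fin n) ℂ) :
    V * (star V * A * V) * star V = A := by
  have := star_conj_conj (uni_star_mem hV) A
  rwa [star_star] at this

theorem conj_mul_conj {n : ℕ} {V : Matrix (Fin n) (Fin n) ℂ}
    (hV : V ∈ Matrix.unitaryGroup (Fin n) ℂ) (A B : Matrix (Fin n) (Fin n) ℂ) :
    (star V * A * V) * (star V * B * V) = star V * (A * B) * V := by
  have h := uni_mul_star hV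
  calc (star V * A * V) * (star V * B * V) = star V * A * (V * star V) * B * V := by
        simp only [Matrix.mul_assoc]
    _ = _ := by rw [h, Matrix.mul_one]; simp only [Matrix.mul_assoc]

theorem trace_conj {n : ℕ} {V : Matrix (Fin n) (Fin n) ℂ}
    (hV : V ∈ Matrix.unitaryGroup (Fin n) ℂ) (A : Matrix (Fin n) (Fin n) ℂ) :
    (star V * A * V).trace = A.trace := by
  rw [Matrix.trace_mul_comm, ← Matrix.mul_assoc, uni_mul_star hV, Matrix.one_mul]

theorem DiagBy.eq {n : ℕ} {V A : Matrix (Fin n) (Fin n) ℂ} {a : Fin n → ℝ} (h : DiagBy V A a) :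
    A = V * Matrix.diagonal (fun k => ((a k : ℝ) : ℂ)) * star V := by
  rw [← h.2, conj_star_conj h.1]

theorem DiagBy.charpoly {n : ℕ} {V A : Matrix (Fin n) (Fin n) ℂ} {a : Fin n → ℝ}
    (h : DiagBy V A a) :
    A.charpoly = ∏ j, (Polynomial.X - Polynomial.C ((a j : ℂ))) := by
  rw [h.eq, Matrix.charpoly_mul_comm, ← Matrix.mul_assoc, uni_star_mul h.1, Matrix.one_mul,
    Matrix.charpoly_diagonal]

theorem DiagBy.perm {n : ℕ} {V A : Matrix (Fin n) (Fin n) ℂ} {a : Fin n → ℝ}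
    (h : DiagBy V A a) (σ : Equiv.Perm (Fin n)) :
    DiagBy (V.submatrix id σ) A (a ∘ σ) := by
  have hs : star (V.submatrix id σ) = (star V).submatrix σ id := by
    ext i j; simp [Matrix.star_apply]
  constructor
  · have h2 : (star V).submatrix σ id * V.submatrix id σ = (star V * V).submatrix σ σ := by
      ext i j; simp [Matrix.mul_apply]
    rw [Matrix.mem_unitaryGroup_iff', hs, h2, uni_star_mul h.1]
    simp
  · rw [hs]
    have h1 : (star V).submatrix σ id * A = (star V * A).submatrix σ id := by
      ext i j; simp [Matrix.mul_apply]
    have h2 : (star V * A).submatrix σ id * V.submatrix id σ = (star V * A * V).submatrix σ σ := by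
      ext i j; simp [Matrix.mul_apply]
    rw [h1, h2, h.2, Matrix.submatrix_diagonal_equiv]
    rfl

theorem DiagBy.conj {n : ℕ} {V A g : Matrix (Fin n) (Fin n) ℂ} {a : Fin n → ℝ}
    (h : DiagBy V (g * A * star g) a) (hg : g ∈ Matrix.unitaryGroup (Fin n) ℂ) :
    DiagBy (star g * V) A a := by
  refine ⟨mul_mem (uni_star_mem hg) h.1, ?_⟩
  rw [← h.2, star_mul, star_star]
  simp only [Matrix.mul_assoc]

theorem sorted_unique {n : ℕ} {a b : Fin n → ℝ} (ha : Monotone a) (hb : Monotone b)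
    (h : (∏ j, (Polynomial.X - Polynomial.C ((a j : ℂ)))) =
      ∏ j, (Polynomial.X - Polynomial.C ((b j : ℂ)))) : a = b := by
  have h1 : Multiset.map (fun j => (a j : ℂ)) Finset.univ.val =
      Multiset.map (fun j => (b j : ℂ)) Finset.univ.val := by
    have := congrArg Polynomial.roots h
    have key : ∀ c : Fin n → ℝ, (∏ j, (Polynomial.X - Polynomial.C ((c j : ℂ)))).roots =
        Multiset.map (fun j => (c j : ℂ)) Finset.univ.val := by
      intro c
      have := Polynomial.roots_multiset_prod_X_sub_C
        (Multiset.map (fun j => (c j : ℂ)) (Finset.univ : Finset (Fin n)).val)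
      rw [Multiset.map_map] at this
      exact this
    rwa [key, key] at this
  have h2 : Multiset.map a Finset.univ.val = Multiset.map b Finset.univ.val := by
    have := congrArg (Multiset.map Complex.re) h1
    simpa [Multiset.map_map, Function.comp_def] using this
  have h3 : (List.ofFn a).Perm (List.ofFn b) := by
    rw [← Multiset.coe_eq_coe]
    simpa [Fin.univ_val_map] using h2
  exact List.ofFn_injective (h3.eq_of_pairwise (fun _ _ _ _ h h' => le_antisymm h h')
    (List.pairwise_ofFn.2 fun i j hij => ha hij.le) (List.pairwise_ofFn.2 fun i j hij => hb hij.le))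

theorem exists_diagBy_eig {n : ℕ} {A : Matrix (Fin n) (Fin n) ℂ} (hA : A.IsHermitian) :
    ∃ V a, DiagBy V A a ∧ Monotone a := by
  have h : DiagBy (hA.eigenvectorUnitary : Matrix (Fin n) (Fin n) ℂ) A hA.eigenvalues := by
    refine ⟨hA.eigenvectorUnitary.2, ?_⟩
    have := hA.conjStarAlgAut_star_eigenvectorUnitary
    simpa [Unitary.conjStarAlgAut_apply, Function.comp_def] using this
  exact ⟨_, _, h.perm (Tuple.sort hA.eigenvalues), Tuple.monotone_sort _⟩

theorem exists_diagBy {n : ℕ} {A : Matrix (Fin n) (Fin n) ℂ} (hA : A.IsHermitian)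
    {a : Fin n → ℝ} (ha : Monotone a)
    (h : A.charpoly = ∏ j, (Polynomial.X - Polynomial.C ((a j : ℂ)))) : ∃ V, DiagBy V A a := by
  obtain ⟨V, b, hV, hb⟩ := exists_diagBy_eig hA
  have : b = a := sorted_unique hb ha (hV.charpoly ▸ h)
  exact ⟨V, this ▸ hV⟩

/-! ### the maximisation lemma -/

section
open scoped Matrix.Norms.L2Operator

theorem trace_flow_deriv {n : ℕ} (G A B : Matrix (Fin n) (Fin n) ℂ) :
    HasDerivAt (fun t : ℝ => (qflow G t * A * qflow G (-t) * B).trace.re)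
      (((-Complex.I) • (G * (A * B - B * A))).trace.re) 0 := by
  have h1 := qflow_hasDerivAt G 0
  have h2 : HasDerivAt (fun t : ℝ => qflow G (-t)) (-(((-Complex.I) • G) * qflow G (-0))) 0 := by
    have := (qflow_hasDerivAt G (-0)).scomp (0:ℝ) (hasDerivAt_neg (0:ℝ))
    simpa [Function.comp_def] using this
  have h3 := ((h1.mul_const A).mul h2).mul_const B
  have h4 := (LinearMap.toContinuousLinearMap
    ((Complex.reLm).comp ((Matrix.traceLinearMap (Fin n) ℂ ℂ).restrictScalars ℝ))).hasFDerivAt.comp_hasDerivAt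
      (0:ℝ) h3
  have h5 : ∀ X : Matrix (Fin n) (Fin n) ℂ, (LinearMap.toContinuousLinearMap
    ((Complex.reLm).comp ((Matrix.traceLinearMap (Fin n) ℂ ℂ).restrictScalars ℝ))) X
     = X.trace.re := fun X => rfl
  have h6 := h4.congr_deriv (h5 _)
  refine h6.congr_deriv ?_
  symm
  simp only [qflow_zero, neg_zero, Matrix.mul_one, Matrix.one_mul]
  have : ((-Complex.I • G * A + A * -(-Complex.I • G)) * B).trace = (-Complex.I • (G * (A * B - B * A))).trace := by
    simp only [neg_smul, neg_mul, mul_neg, neg_neg, Matrix.smul_mul, Matrix.mul_smul, Matrix.add_mul,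
      Matrix.neg_mul, Matrix.trace_add, Matrix.trace_neg, Matrix.trace_smul, Matrix.mul_sub, Matrix.trace_sub]
    have : (A * G * B).trace = (G * (B * A)).trace := by
      rw [Matrix.trace_mul_cycle, Matrix.trace_mul_comm]
    rw [this, Matrix.mul_assoc]
    simp only [smul_eq_mul]; ring
  rw [this]

end

open scoped ComplexOrder in
theorem trace_star_mul_self_zero {n : ℕ} {M : Matrix (Fin n) (Fin n) ℂ}
    (h : (Matrix.conjTranspose M * M).trace = 0) : M = 0 :=
  Matrix.trace_conjTranspose_mul_self_eq_zero_iff.1 h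

theorem flow_max_comm {n : ℕ} {K : Set (Matrix (Fin n) (Fin n) ℂ)} (hK : IsCompact K)
    (hne : K.Nonempty) (S : Set (Matrix (Fin n) (Fin n) ℂ)) (hS : ∀ G ∈ S, G.IsHermitian)
    (hflow : ∀ G ∈ S, ∀ k ∈ K, ∀ t, qflow G t * k ∈ K)
    {A B : Matrix (Fin n) (Fin n) ℂ} (hA : A.IsHermitian) (hB : B.IsHermitian)
    (hspan : ∀ k ∈ K, (k * A * star k) * B - B * (k * A * star k) ∈ Submodule.span ℂ S) :
    ∃ g ∈ K, (∀ k ∈ K, (k * A * star k * B).trace.re ≤ (g * A * star g * B).trace.re) ∧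
      (g * A * star g) * B = B * (g * A * star g) := by
  have hc : Continuous (fun k : Matrix (Fin n) (Fin n) ℂ => (k * A * star k * B).trace.re) := by
    have h0 : Continuous (fun k : Matrix (Fin n) (Fin n) ℂ => star k) :=
      continuous_id.matrix_conjTranspose
    have h1 : Continuous (fun k : Matrix (Fin n) (Fin n) ℂ => k * A * star k * B) :=
      ((continuous_id.matrix_mul continuous_const).matrix_mul h0).matrix_mul continuous_const
    exact Complex.continuous_re.comp h1.matrix_trace
  obtain ⟨g, hg, hmax⟩ := hK.exists_isMaxOn hne hc.continuousOn
  refine ⟨g, hg, fun k hk => hmax hk, ?_⟩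
  set A' := g * A * star g with hA'
  have hA'h : A'.IsHermitian := by
    rw [hA']; exact Matrix.isHermitian_mul_mul_conjTranspose g hA
  set M := A' * B - B * A' with hM
  have hMs : Matrix.conjTranspose M = -M := by
    rw [hM, Matrix.conjTranspose_sub, Matrix.conjTranspose_mul A' B, Matrix.conjTranspose_mul B A', hA'h.eq, hB.eq]
    abel
  have hz : ∀ G ∈ S, (G * M).trace = 0 := by
    intro G hG
    have hd := trace_flow_deriv G A' B
    have hmx : IsLocalMax (fun t : ℝ => (qflow G t * A' * qflow G (-t) * B).trace.re) 0 := by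
      refine Filter.Eventually.of_forall fun t => ?_
      have := hmax (hflow G hG g hg t)
      simp only [Set.mem_ofPred_eq, star_mul, qflow_star (hS G hG)] at this
      simp only [neg_zero, qflow_zero, Matrix.one_mul, Matrix.mul_one]
      convert this using 4
      simp only [hA', Matrix.mul_assoc]
    have h0 := hmx.hasDerivAt_eq_zero hd
    rw [← hM, Matrix.trace_smul] at h0
    have him : (G * M).trace.im = 0 := by simpa using h0
    have hre : star (G * M).trace = - (G * M).trace := by
      rw [← Matrix.trace_conjTranspose, Matrix.conjTranspose_mul, hMs, (hS G hG).eq, Matrix.neg_mul,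
        Matrix.trace_neg, Matrix.trace_mul_comm]
    have hre' := congrArg Complex.re hre
    simp only [Complex.star_def, Complex.conj_re, Complex.neg_re] at hre'
    exact Complex.ext (by simp; linarith) (by simpa using him)
  have hz2 : ∀ X ∈ Submodule.span ℂ S, (X * M).trace = 0 := by
    intro X hX
    induction hX using Submodule.span_induction with
    | mem x h => exact hz x h
    | zero => simp
    | add x y _ _ hx hy => rw [Matrix.add_mul, Matrix.trace_add, hx, hy, add_zero]
    | smul c x _ hx => rw [Matrix.smul_mul, Matrix.trace_smul, hx, smul_zero]
  have h1 := hz2 M (hspan g hg)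
  have h2 : (Matrix.conjTranspose M * M).trace = 0 := by
    rw [hMs, Matrix.neg_mul, Matrix.trace_neg, h1, neg_zero]
  have h3 := trace_star_mul_self_zero h2
  exact sub_eq_zero.1 h3

theorem comm_qflow {n : ℕ} {G D : Matrix (Fin n) (Fin n) ℂ} (h : G * D = D * G) (t : ℝ) :
    qflow G t * D = D * qflow G t := by
  have h1 : Commute D (t • ((-Complex.I) • G)) :=
    ((show Commute D G from h.symm).smul_right _).smul_right _
  exact (Commute.exp_right h1).symm

theorem comm_diag_entry {n : ℕ} {A : Matrix (Fin n) (Fin n) ℂ} {d : Fin n → ℂ}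
    (h : A * Matrix.diagonal d = Matrix.diagonal d * A) (i j : Fin n) (hij : d i ≠ d j) :
    A i j = 0 := by
  have := congrFun (congrFun h i) j
  rw [Matrix.mul_diagonal, Matrix.diagonal_mul] at this
  have h2 : (d i - d j) * A i j = 0 := by rw [sub_mul, ← this]; ring
  exact (mul_eq_zero.1 h2).resolve_left (sub_ne_zero.2 hij)

theorem joint_diag {n : ℕ} {A B : Matrix (Fin n) (Fin n) ℂ} (hA : A.IsHermitian)
    (hB : B.IsHermitian) (hAB : A * B = B * A) :
    ∃ V a b, DiagBy V A a ∧ DiagBy V B b ∧ Monotone (fun k => toLex (b k, a k)) := by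
  obtain ⟨V0, b, hV0, -⟩ := exists_diagBy_eig hB
  set D : Matrix (Fin n) (Fin n) ℂ := Matrix.diagonal (fun k => ((b k : ℝ) : ℂ)) with hD
  set N : Matrix (Fin n) (Fin n) ℂ := Matrix.diagonal (fun k => (((k : ℕ) : ℝ) : ℂ)) with hN
  have hDh : D.IsHermitian := by
    rw [hD, Matrix.isHermitian_diagonal_iff]; intro i; simp [IsSelfAdjoint]
  have hNh : N.IsHermitian := by
    rw [hN, Matrix.isHermitian_diagonal_iff]; intro i; simp [IsSelfAdjoint]
  have hND : N * D = D * N := by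
    rw [hN, hD, Matrix.diagonal_mul_diagonal, Matrix.diagonal_mul_diagonal]
    congr 1; ext i; ring
  let K : Set (Matrix (Fin n) (Fin n) ℂ) :=
    {W | W ∈ Matrix.unitaryGroup (Fin n) ℂ ∧ W * B * star W = D}
  let S : Set (Matrix (Fin n) (Fin n) ℂ) := {G | G.IsHermitian ∧ G * D = D * G}
  have hKc : IsCompact K := by
    refine (unitary_isCompact n).of_isClosed_subset ?_ (fun W h => h.1)
    have h0 : Continuous (fun k : Matrix (Fin n) (Fin n) ℂ => star k) :=
      continuous_id.matrix_conjTranspose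
    have h1 : Continuous (fun k : Matrix (Fin n) (Fin n) ℂ => k * B * star k) :=
      ((continuous_id.matrix_mul continuous_const).matrix_mul h0)
    exact (unitary_isCompact n).isClosed.inter (isClosed_eq h1 continuous_const)
  have hne : K.Nonempty := ⟨star V0, uni_star_mem hV0.1, by rw [star_star]; exact hV0.2⟩
  have hflow : ∀ G ∈ S, ∀ k ∈ K, ∀ t, qflow G t * k ∈ K := by
    rintro G ⟨hG, hGD⟩ k ⟨hk, hkB⟩ t
    refine ⟨mul_mem (qflow_mem hG t) hk, ?_⟩
    calc qflow G t * k * B * star (qflow G t * k)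
        = qflow G t * (k * B * star k) * star (qflow G t) := by
          rw [star_mul]; simp only [Matrix.mul_assoc]
      _ = D := by
          rw [hkB, comm_qflow hGD, Matrix.mul_assoc, uni_mul_star (qflow_mem hG t), Matrix.mul_one]
  have hspan : ∀ k ∈ K, (k * A * star k) * N - N * (k * A * star k) ∈ Submodule.span ℂ S := by
    rintro k ⟨hk, hkB⟩
    set A' := k * A * star k with hA'
    have hA'h : A'.IsHermitian := Matrix.isHermitian_mul_mul_conjTranspose k hA
    have hAD : A' * D = D * A' := by
      have e1 := conj_mul_conj (uni_star_mem hk) A B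
      have e2 := conj_mul_conj (uni_star_mem hk) B A
      rw [star_star] at e1 e2
      rw [hA', ← hkB, e1, e2, hAB]
    set C := A' * N - N * A' with hC
    have hCs : Complex.I • C ∈ S := by
      constructor
      · unfold Matrix.IsHermitian
        rw [Matrix.conjTranspose_smul, hC, Matrix.conjTranspose_sub, Matrix.conjTranspose_mul A' N,
          Matrix.conjTranspose_mul N A', hA'h.eq, hNh.eq]
        simp only [Complex.star_def, Complex.conj_I, neg_smul, smul_sub]
        abel
      · rw [Matrix.smul_mul, Matrix.mul_smul]
        congr 1
        rw [hC, Matrix.sub_mul, Matrix.mul_sub, Matrix.mul_assoc, hND, ← Matrix.mul_assoc, hAD,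
          Matrix.mul_assoc N, hAD, ← Matrix.mul_assoc N, hND]
        simp only [Matrix.mul_assoc]
    have : C = (-Complex.I) • (Complex.I • C) := by
      rw [smul_smul]; simp
    rw [this]
    exact Submodule.smul_mem _ _ (Submodule.subset_span hCs)
  obtain ⟨g, ⟨hg, hgB⟩, -, hcomm⟩ := flow_max_comm hKc hne S (fun G h => h.1) hflow hA hNh hspan
  set A' := g * A * star g with hA'
  have hA'h : A'.IsHermitian := Matrix.isHermitian_mul_mul_conjTranspose g hA
  have hdiag : A' = Matrix.diagonal (fun k => (((A' k k).re : ℝ) : ℂ)) := by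
    ext i j
    by_cases hij : i = j
    · subst hij
      rw [Matrix.diagonal_apply_eq]
      have := hA'h.apply i i
      exact (Complex.conj_eq_iff_re.1 this).symm
    · rw [Matrix.diagonal_apply_ne _ hij]
      refine comm_diag_entry hcomm i j ?_
      intro h
      apply hij
      have : ((i : ℕ) : ℝ) = ((j : ℕ) : ℝ) := Complex.ofReal_injective h
      exact Fin.ext (by exact_mod_cast this)
  have dA : DiagBy (star g) A (fun k => (A' k k).re) :=
    ⟨uni_star_mem hg, by rw [star_star]; exact hdiag⟩
  have dB : DiagBy (star g) B b := ⟨uni_star_mem hg, by rw [star_star]; exact hgB⟩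
  let f : Fin n → ℝ ×ₗ ℝ := fun k => toLex (b k, (A' k k).re)
  refine ⟨_, _, _, dA.perm (Tuple.sort f), dB.perm (Tuple.sort f), ?_⟩
  exact Tuple.monotone_sort f

theorem DiagBy.trace_mul {n : ℕ} {V A B : Matrix (Fin n) (Fin n) ℂ} {a b : Fin n → ℝ}
    (hA : DiagBy V A a) (hB : DiagBy V B b) : (A * B).trace.re = ∑ k, a k * b k := by
  rw [← trace_conj hA.1, ← conj_mul_conj hA.1, hA.2, hB.2, Matrix.diagonal_mul_diagonal,
    Matrix.trace_diagonal, Complex.re_sum]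
  simp

/-- squared Frobenius distance of Hermitian matrices -/
theorem trace_sub_sq {n : ℕ} (A B : Matrix (Fin n) (Fin n) ℂ) :
    ((A - B) * (A - B)).trace.re = (A * A).trace.re + (B * B).trace.re - 2 * (A * B).trace.re := by
  rw [Matrix.sub_mul, Matrix.mul_sub, Matrix.mul_sub, Matrix.trace_sub, Matrix.trace_sub,
    Matrix.trace_sub, Matrix.trace_mul_comm B A]
  simp only [Complex.sub_re]; ring

theorem trace_conj_sq {n : ℕ} {g : Matrix (Fin n) (Fin n) ℂ}
    (hg : g ∈ Matrix.unitaryGroup (Fin n) ℂ) (A : Matrix (Fin n) (Fin n) ℂ) :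
    ((g * A * star g) * (g * A * star g)).trace.re = (A * A).trace.re := by
  have e1 := conj_mul_conj (uni_star_mem hg) A A
  have e2 := trace_conj (uni_star_mem hg) (A * A)
  rw [star_star] at e1 e2
  rw [e1, e2]

theorem near_aux {n : ℕ} {K : Set (Matrix (Fin n) (Fin n) ℂ)} (hK : IsCompact K)
    (hKU : ∀ k ∈ K, k ∈ Matrix.unitaryGroup (Fin n) ℂ)
    (h1 : 1 ∈ K) (S : Set (Matrix (Fin n) (Fin n) ℂ)) (hS : ∀ G ∈ S, G.IsHermitian)
    (hflow : ∀ G ∈ S, ∀ k ∈ K, ∀ t, qflow G t * k ∈ K)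
    {A B : Matrix (Fin n) (Fin n) ℂ} (hA : A.IsHermitian) (hB : B.IsHermitian)
    (hspan : ∀ k ∈ K, (k * A * star k) * B - B * (k * A * star k) ∈ Submodule.span ℂ S) :
    ∃ g ∈ K, ∃ V a b, DiagBy V (g * A * star g) a ∧ DiagBy V B b ∧
      Monotone (fun k => toLex (b k, a k)) ∧ (A * B).trace.re ≤ ∑ k, a k * b k ∧
      ∑ k, (a k - b k) ^ 2 ≤ ((A - B) * (A - B)).trace.re := by
  obtain ⟨g, hg, hmax, hcomm⟩ := flow_max_comm hK ⟨1, h1⟩ S hS hflow hA hB hspan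
  have hA'h : (g * A * star g).IsHermitian := Matrix.isHermitian_mul_mul_conjTranspose g hA
  obtain ⟨V, a, b, dA, dB, hmono⟩ := joint_diag hA'h hB hcomm
  have hle : (A * B).trace.re ≤ ∑ k, a k * b k := by
    rw [← dA.trace_mul dB]
    simpa using hmax 1 h1
  refine ⟨g, hg, V, a, b, dA, dB, hmono, hle, ?_⟩
  rw [trace_sub_sq, ← trace_conj_sq (hKU g hg) A, dA.trace_mul dA, dB.trace_mul dB]
  have : ∑ k, (a k - b k) ^ 2 = ∑ k, a k * a k + ∑ k, b k * b k - 2 * ∑ k, a k * b k := by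
    rw [Finset.mul_sum, ← Finset.sum_add_distrib, ← Finset.sum_sub_distrib]
    exact Finset.sum_congr rfl fun k _ => by ring
  rw [this]; linarith

theorem lex_fst_mono {n : ℕ} {a b : Fin n → ℝ} (h : Monotone (fun k => toLex (b k, a k))) :
    Monotone b := by
  intro i j hij
  have := h hij
  rcases (Prod.Lex.toLex_le_toLex).1 this with h | h
  · exact h.le
  · exact h.1.le

/-- Hoffman-Wielandt inequality. -/
theorem hoffman_wielandt {n : ℕ} {A B VA VB : Matrix (Fin n) (Fin n) ℂ} (hA : A.IsHermitian)
    (hB : B.IsHermitian) {a b : Fin n → ℝ} (dA : DiagBy VA A a) (dB : DiagBy VB B b)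
    (ha : Monotone a) (hb : Monotone b) :
    ∑ k, (a k - b k) ^ 2 ≤ ((A - B) * (A - B)).trace.re := by
  obtain ⟨g, hg, V, a', b', dA', dB', hmono, hle, -⟩ := near_aux (unitary_isCompact n)
    (fun k h => h) (one_mem _) {G | G.IsHermitian} (fun G h => h)
    (fun G hG k hk t => mul_mem (qflow_mem hG t) hk) hA hB (by
      intro k hk
      set A' := k * A * star k with hA'
      have hA'h : A'.IsHermitian := Matrix.isHermitian_mul_mul_conjTranspose k hA
      set C := A' * B - B * A' with hC
      have : C = (-Complex.I) • (Complex.I • C) := by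
        rw [smul_smul]; simp
      rw [this]
      refine Submodule.smul_mem _ _ (Submodule.subset_span ?_)
      show (Complex.I • C).IsHermitian
      unfold Matrix.IsHermitian
      rw [Matrix.conjTranspose_smul, hC, Matrix.conjTranspose_sub, Matrix.conjTranspose_mul A' B,
          Matrix.conjTranspose_mul B A', hA'h.eq, hB.eq]
      simp only [Complex.star_def, Complex.conj_I, neg_smul, smul_sub]
      abel)
  have hbb : b' = b := sorted_unique (lex_fst_mono hmono) hb (dB'.charpoly ▸ dB.charpoly)
  have dA2 := dA'.conj hg
  have haa : a' ∘ Tuple.sort a' = a :=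
    sorted_unique (Tuple.monotone_sort a') ha
      ((dA2.perm (Tuple.sort a')).charpoly ▸ dA.charpoly)
  have hre : ∑ k, a' k * b' k ≤ ∑ k, a k * b k := by
    have hv : Monovary a b := ha.monovary hb
    have := hv.sum_comp_perm_mul_le_sum_mul (σ := (Tuple.sort a')⁻¹)
    refine le_trans (le_of_eq ?_) this
    refine Finset.sum_congr rfl fun k _ => ?_
    rw [← haa, hbb]; simp
  rw [trace_sub_sq, dA.trace_mul dA, dB.trace_mul dB]
  have : ∑ k, (a k - b k) ^ 2 = ∑ k, a k * a k + ∑ k, b k * b k - 2 * ∑ k, a k * b k := by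
    rw [Finset.mul_sum, ← Finset.sum_add_distrib, ← Finset.sum_sub_distrib]
    exact Finset.sum_congr rfl fun k _ => by ring
  rw [this]; linarith

theorem near_diag {n : ℕ} {K : Set (Matrix (Fin n) (Fin n) ℂ)} (hK : IsCompact K)
    (hKU : ∀ k ∈ K, k ∈ Matrix.unitaryGroup (Fin n) ℂ)
    (h1 : 1 ∈ K) (S : Set (Matrix (Fin n) (Fin n) ℂ)) (hS : ∀ G ∈ S, G.IsHermitian)
    (hflow : ∀ G ∈ S, ∀ k ∈ K, ∀ t, qflow G t * k ∈ K)
    {A B : Matrix (Fin n) (Fin n) ℂ} (hA : A.IsHermitian) (hB : B.IsHermitian)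
    (hspan : ∀ k ∈ K, (k * A * star k) * B - B * (k * A * star k) ∈ Submodule.span ℂ S)
    {VA VB : Matrix (Fin n) (Fin n) ℂ}
    {a b : Fin n → ℝ} (dA : DiagBy VA A a) (dB : DiagBy VB B b)
    (ha : Monotone a) (hb : Monotone b)
    (hgap : ∀ k l, b k < b l → 4 * ((A - B) * (A - B)).trace.re < (b l - b k) ^ 2) :
    ∃ g ∈ K, ∃ V, DiagBy V (g * A * star g) a ∧ DiagBy V B b := by
  obtain ⟨g, hg, V, a', b', dA', dB', hmono, -, hle⟩ := near_aux hK hKU h1 S hS hflow hA hB hspan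
  have hbb : b' = b := sorted_unique (lex_fst_mono hmono) hb (dB'.charpoly ▸ dB.charpoly)
  subst hbb
  have hent : ∀ k, (a' k - b' k) ^ 2 ≤ ((A - B) * (A - B)).trace.re := fun k =>
    le_trans (Finset.single_le_sum (f := fun k => (a' k - b' k) ^ 2)
      (fun i _ => sq_nonneg _) (Finset.mem_univ k)) hle
  have ham : Monotone a' := by
    intro i j hij
    rcases (Prod.Lex.toLex_le_toLex).1 (hmono hij) with h | h
    · have h2 := hgap i j h
      have e1 := hent i
      have e2 := hent j
      simp only at h
      have q1 : |a' i - b' i| < (b' j - b' i) / 2 := by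
        apply abs_lt_of_sq_lt_sq _ (by linarith)
        nlinarith
      have q2 : |a' j - b' j| < (b' j - b' i) / 2 := by
        apply abs_lt_of_sq_lt_sq _ (by linarith)
        nlinarith
      rw [abs_lt] at q1 q2
      linarith
    · exact h.2
  have haa : a' = a := sorted_unique ham ha ((dA'.conj (hKU g hg)).charpoly ▸ dA.charpoly)
  subst haa
  have hres := And.intro dA' dB'
  exact ⟨g, hg, V, hres⟩

/-! ### the semigroup, its closure and the associated linear space -/

/-- The semigroup generated by the forward flows. -/
def semi {n : ℕ} (F : Set (Matrix (Fin n) (Fin n) ℂ)) : Submonoid (Matrix (Fin n) (Fin n) ℂ) :=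
  Submonoid.closure {M | ∃ G ∈ F, ∃ t : ℝ, 0 ≤ t ∧ M = qflow G t}

/-- Conjugated generators. -/
def cgens {n : ℕ} (F : Set (Matrix (Fin n) (Fin n) ℂ)) : Set (Matrix (Fin n) (Fin n) ℂ) :=
  {X | ∃ k ∈ semi F, ∃ G ∈ F, X = k * G * star k}

theorem semi_unitary {n : ℕ} {F : Set (Matrix (Fin n) (Fin n) ℂ)} (hF : ∀ G ∈ F, G.IsHermitian) :
    semi F ≤ Matrix.unitaryGroup (Fin n) ℂ := by
  unfold semi
  rw [Submonoid.closure_le]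
  rintro M ⟨G, hG, t, -, rfl⟩
  exact qflow_mem (hF G hG) t

/-- The closure of the semigroup. -/
def Kset {n : ℕ} (F : Set (Matrix (Fin n) (Fin n) ℂ)) : Set (Matrix (Fin n) (Fin n) ℂ) :=
  closure (semi F : Set (Matrix (Fin n) (Fin n) ℂ))

theorem Kset_unitary {n : ℕ} {F : Set (Matrix (Fin n) (Fin n) ℂ)} (hF : ∀ G ∈ F, G.IsHermitian) :
    ∀ k ∈ Kset F, k ∈ Matrix.unitaryGroup (Fin n) ℂ := by
  intro k hk
  exact closure_minimal (s := (semi F : Set (Matrix (Fin n) (Fin n) ℂ)))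
    (t := (Matrix.unitaryGroup (Fin n) ℂ : Set (Matrix (Fin n) (Fin n) ℂ)))
    (semi_unitary hF) (unitary_isCompact n).isClosed hk

theorem Kset_compact {n : ℕ} {F : Set (Matrix (Fin n) (Fin n) ℂ)} (hF : ∀ G ∈ F, G.IsHermitian) :
    IsCompact (Kset F) :=
  (unitary_isCompact n).of_isClosed_subset isClosed_closure (Kset_unitary hF)

theorem semi_subset_Kset {n : ℕ} {F : Set (Matrix (Fin n) (Fin n) ℂ)}
    {k : Matrix (Fin n) (Fin n) ℂ} (hk : k ∈ semi F) : k ∈ Kset F := subset_closure hk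

theorem Kset_mul {n : ℕ} {F : Set (Matrix (Fin n) (Fin n) ℂ)} {k l : Matrix (Fin n) (Fin n) ℂ}
    (hk : k ∈ Kset F) (hl : l ∈ Kset F) : k * l ∈ Kset F :=
  map_mem_closure₂ (f := fun a b : Matrix (Fin n) (Fin n) ℂ => a * b)
    (continuous_fst.matrix_mul continuous_snd) hk hl (fun _ ha _ hb => mul_mem ha hb)

theorem Kset_star {n : ℕ} {F : Set (Matrix (Fin n) (Fin n) ℂ)} (hF : ∀ G ∈ F, G.IsHermitian)
    {k : Matrix (Fin n) (Fin n) ℂ} (hk : k ∈ Kset F) : star k ∈ Kset F := by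
  let T : Submonoid (Matrix.unitaryGroup (Fin n) ℂ) := (semi F).comap
    (Matrix.unitaryGroup (Fin n) ℂ).subtype
  have hT : Submonoid.closure (T : Set (Matrix.unitaryGroup (Fin n) ℂ)) = T :=
    Submonoid.closure_eq T
  have hcl := closure_submonoidClosure_eq_closure_subgroupClosure
    (T : Set (Matrix.unitaryGroup (Fin n) ℂ))
  rw [hT] at hcl
  have himg : (Subtype.val '' (T : Set (Matrix.unitaryGroup (Fin n) ℂ))) =
      (semi F : Set (Matrix (Fin n) (Fin n) ℂ)) := by
    ext x
    constructor
    · rintro ⟨y, hy, rfl⟩; exact hy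
    · intro hx; exact ⟨⟨x, semi_unitary hF hx⟩, hx, rfl⟩
  have hemb : Topology.IsClosedEmbedding
      (Subtype.val : Matrix.unitaryGroup (Fin n) ℂ → Matrix (Fin n) (Fin n) ℂ) :=
    (unitary_isCompact n).isClosed.isClosedEmbedding_subtypeVal
  have hK : Kset F = Subtype.val '' closure (T : Set (Matrix.unitaryGroup (Fin n) ℂ)) := by
    unfold Kset
    rw [← himg, hemb.closure_image_eq]
  rw [hK] at hk ⊢
  obtain ⟨y, hy, rfl⟩ := hk
  refine ⟨y⁻¹, ?_, rfl⟩
  rw [hcl] at hy ⊢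
  exact (Subgroup.closure (T : Set (Matrix.unitaryGroup (Fin n) ℂ))).topologicalClosure.inv_mem hy

theorem Kset_qflow {n : ℕ} {F : Set (Matrix (Fin n) (Fin n) ℂ)} (hF : ∀ G ∈ F, G.IsHermitian)
    {G : Matrix (Fin n) (Fin n) ℂ} (hG : G ∈ F) (t : ℝ) : qflow G t ∈ Kset F := by
  rcases le_total 0 t with h | h
  · exact semi_subset_Kset (Submonoid.subset_closure ⟨G, hG, t, h, rfl⟩)
  · have := Kset_star hF (semi_subset_Kset
      (Submonoid.subset_closure ⟨G, hG, -t, neg_nonneg.2 h, rfl⟩))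
    rwa [qflow_star (hF G hG), neg_neg] at this

theorem cgens_herm {n : ℕ} {F : Set (Matrix (Fin n) (Fin n) ℂ)} (hF : ∀ G ∈ F, G.IsHermitian) :
    ∀ X ∈ cgens F, X.IsHermitian := by
  rintro X ⟨k, -, G, hG, rfl⟩
  exact Matrix.isHermitian_mul_mul_conjTranspose k (hF G hG)

theorem cgens_flow {n : ℕ} {F : Set (Matrix (Fin n) (Fin n) ℂ)} (hF : ∀ G ∈ F, G.IsHermitian) :
    ∀ X ∈ cgens F, ∀ t, qflow X t ∈ Kset F := by
  rintro X ⟨k, hk, G, hG, rfl⟩ t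
  rw [qflow_conj (semi_unitary hF hk)]
  exact Kset_mul (Kset_mul (semi_subset_Kset hk) (Kset_qflow hF hG t))
    (Kset_star hF (semi_subset_Kset hk))

/-- The complex linear span of conjugated generators. -/
def Lsp {n : ℕ} (F : Set (Matrix (Fin n) (Fin n) ℂ)) : Submodule ℂ (Matrix (Fin n) (Fin n) ℂ) :=
  Submodule.span ℂ (cgens F)

theorem Lsp_closed {n : ℕ} (F : Set (Matrix (Fin n) (Fin n) ℂ)) :
    IsClosed (Lsp F : Set (Matrix (Fin n) (Fin n) ℂ)) := Submodule.closed_of_finiteDimensional _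

theorem mem_Lsp {n : ℕ} {F : Set (Matrix (Fin n) (Fin n) ℂ)} {G : Matrix (Fin n) (Fin n) ℂ}
    (hG : G ∈ F) : G ∈ Lsp F :=
  Submodule.subset_span ⟨1, one_mem _, G, hG, by simp⟩

theorem Lsp_conj_semi {n : ℕ} {F : Set (Matrix (Fin n) (Fin n) ℂ)}
    {k X : Matrix (Fin n) (Fin n) ℂ} (hk : k ∈ semi F) (hX : X ∈ Lsp F) :
    k * X * star k ∈ Lsp F := by
  unfold Lsp at hX
  induction hX using Submodule.span_induction with
  | mem x h =>
    obtain ⟨l, hl, G, hG, rfl⟩ := h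
    refine Submodule.subset_span ⟨k * l, mul_mem hk hl, G, hG, ?_⟩
    rw [star_mul]; simp only [Matrix.mul_assoc]
  | zero => simp
  | add x y _ _ hx hy =>
    rw [Matrix.mul_add, Matrix.add_mul]; exact add_mem hx hy
  | smul a x _ hx =>
    rw [Matrix.mul_smul, Matrix.smul_mul]; exact Submodule.smul_mem _ _ hx

theorem Lsp_conj {n : ℕ} {F : Set (Matrix (Fin n) (Fin n) ℂ)}
    {k X : Matrix (Fin n) (Fin n) ℂ} (hk : k ∈ Kset F) (hX : X ∈ Lsp F) :
    k * X * star k ∈ Lsp F := by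
  have hc : IsClosed {k : Matrix (Fin n) (Fin n) ℂ | k * X * star k ∈ Lsp F} :=
    (Lsp_closed F).preimage
      ((continuous_id.matrix_mul continuous_const).matrix_mul continuous_id.matrix_conjTranspose)
  exact closure_minimal (s := (semi F : Set (Matrix (Fin n) (Fin n) ℂ)))
    (fun l hl => Lsp_conj_semi hl hX) hc hk

theorem Lsp_star {n : ℕ} {F : Set (Matrix (Fin n) (Fin n) ℂ)} (hF : ∀ G ∈ F, G.IsHermitian)
    {X : Matrix (Fin n) (Fin n) ℂ} (hX : X ∈ Lsp F) : star X ∈ Lsp F := by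
  unfold Lsp at hX
  induction hX using Submodule.span_induction with
  | mem x h =>
    have : star x = x := cgens_herm hF x h
    rw [this]
    exact Submodule.subset_span h
  | zero => simp
  | add x y _ _ hx hy => rw [star_add]; exact add_mem hx hy
  | smul a x _ hx => rw [star_smul]; exact Submodule.smul_mem _ _ hx

theorem hasDerivAt_mem_submodule {n : ℕ} {W : Submodule ℂ (Matrix (Fin n) (Fin n) ℂ)}
    {f : ℝ → Matrix (Fin n) (Fin n) ℂ} {f' : Matrix (Fin n) (Fin n) ℂ} {x : ℝ}
    (hf : HasDerivAt f f' x) (hW : ∀ᶠ t in nhds x, f t ∈ W) : f' ∈ W := by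
  have hcl : IsClosed (W : Set (Matrix (Fin n) (Fin n) ℂ)) :=
    Submodule.closed_of_finiteDimensional _
  have hs := hasDerivAt_iff_tendsto_slope.1 hf
  refine hcl.mem_of_tendsto hs ?_
  filter_upwards [hW.filter_mono nhdsWithin_le_nhds] with t ht
  rw [slope_def_module]
  have : ((t - x)⁻¹ • (f t - f x) : Matrix (Fin n) (Fin n) ℂ) =
      (((t - x)⁻¹ : ℝ) : ℂ) • (f t - f x) := by
    ext i j; simp
  rw [this]
  exact Submodule.smul_mem _ _ (sub_mem ht hW.self_of_nhds)

section
open scoped Matrix.Norms.L2Operator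
theorem qflow_conj_hasDerivAt {n : ℕ} (G Y : Matrix (Fin n) (Fin n) ℂ) :
    HasDerivAt (fun t => qflow G t * Y * qflow G (-t))
      ((-Complex.I) • (G * Y - Y * G)) 0 := by
  have h1 := qflow_hasDerivAt G 0
  have h2 : HasDerivAt (fun t : ℝ => qflow G (-t)) (-(((-Complex.I) • G) * qflow G (-0))) 0 := by
    have := (qflow_hasDerivAt G (-0)).scomp (0:ℝ) (hasDerivAt_neg (0:ℝ))
    simpa [Function.comp_def] using this
  refine ((h1.mul_const Y).mul h2).congr_deriv ?_
  simp only [qflow_zero, neg_zero, Matrix.mul_one, Matrix.one_mul]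
  simp only [neg_smul, Matrix.neg_mul, Matrix.mul_neg, neg_neg, Matrix.smul_mul, Matrix.mul_smul,
    smul_sub]
  abel
end

theorem Lsp_bracket {n : ℕ} {F : Set (Matrix (Fin n) (Fin n) ℂ)} (hF : ∀ G ∈ F, G.IsHermitian)
    {X Y : Matrix (Fin n) (Fin n) ℂ} (hX : X ∈ Lsp F) (hY : Y ∈ Lsp F) :
    X * Y - Y * X ∈ Lsp F := by
  unfold Lsp at hX
  induction hX using Submodule.span_induction with
  | mem x h =>
    have h1 := hasDerivAt_mem_submodule (W := Lsp F) (qflow_conj_hasDerivAt x Y)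
      (Filter.Eventually.of_forall fun t => by
        have := Lsp_conj (cgens_flow hF x h t) hY
        rwa [qflow_star (cgens_herm hF x h)] at this)
    have h2 := Submodule.smul_mem _ Complex.I h1
    rw [smul_smul] at h2
    simpa using h2
  | zero => simp
  | add x y _ _ hx hy =>
    have : (x + y) * Y - Y * (x + y) = (x * Y - Y * x) + (y * Y - Y * y) := by noncomm_ring
    rw [this]; exact add_mem hx hy
  | smul a x _ hx =>
    rw [Matrix.mul_smul, Matrix.smul_mul, ← smul_sub]; exact Submodule.smul_mem _ _ hx

/-- Simultaneous diagonalisation of nearby members of the family up to conjugation in `Kset`. -/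
theorem near_diag_F {n : ℕ} {F : Set (Matrix (Fin n) (Fin n) ℂ)} (hF : ∀ G ∈ F, G.IsHermitian)
    {A B : Matrix (Fin n) (Fin n) ℂ} (hA : A ∈ F) (hB : B ∈ F)
    {VA VB : Matrix (Fin n) (Fin n) ℂ}
    {a b : Fin n → ℝ} (dA : DiagBy VA A a) (dB : DiagBy VB B b)
    (ha : Monotone a) (hb : Monotone b)
    (hgap : ∀ k l, b k < b l → 4 * ((A - B) * (A - B)).trace.re < (b l - b k) ^ 2) :
    ∃ g ∈ Kset F, ∃ V, DiagBy V (g * A * star g) a ∧ DiagBy V B b :=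
  near_diag (Kset_compact hF) (Kset_unitary hF) (semi_subset_Kset (one_mem _)) (cgens F)
    (cgens_herm hF) (fun G hG _ hk t => Kset_mul (cgens_flow hF G hG t) hk) (hF A hA) (hF B hB)
    (fun _ hk => Lsp_bracket hF (Lsp_conj hk (mem_Lsp hA)) (mem_Lsp hB)) dA dB ha hb hgap

/-! ### a topological constancy lemma -/

theorem punctured_ball_preconnected {E : Type*} [NormedAddCommGroup E] [NormedSpace ℝ E]
    (h : 1 < Module.rank ℝ E) (x : E) (r : ℝ) :
    IsPreconnected (Metric.ball x r \ {x}) := by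
  have h1 : IsPreconnected (Metric.sphere (0 : E) 1 ×ˢ Set.Ioo 0 r) :=
    (isPreconnected_sphere h 0 1).prod isPreconnected_Ioo
  have h2 := h1.image (fun p : E × ℝ => x + p.2 • p.1) (by fun_prop)
  convert h2 using 1
  ext y
  constructor
  · rintro ⟨hy, hyx⟩
    have hne : y - x ≠ 0 := sub_ne_zero.2 hyx
    have hpos : 0 < ‖y - x‖ := norm_pos_iff.2 hne
    refine ⟨(‖y - x‖⁻¹ • (y - x), ‖y - x‖), ⟨?_, hpos, ?_⟩, ?_⟩
    · simp [norm_smul, hpos.ne']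
    · simpa [dist_eq_norm] using hy
    · simp [smul_smul, hpos.ne']
  · rintro ⟨⟨v, t⟩, ⟨hv, ht0, htr⟩, rfl⟩
    simp only [mem_sphere_iff_norm, sub_zero] at hv
    simp only at ht0 htr
    constructor
    · simp [dist_eq_norm, norm_smul, hv, abs_of_pos ht0, htr]
    · simp only [Set.mem_singleton_iff, add_eq_left, smul_eq_zero, not_or]
      refine ⟨ht0.ne', ?_⟩
      rintro rfl; simp at hv

theorem const_of_isolated {E : Type*} [NormedAddCommGroup E] [NormedSpace ℝ E]
    (h : 1 < Module.rank ℝ E) {U : Set E} (hU : IsPreconnected U) {Good P : E → Prop}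
    (hGU : ∀ u, Good u → u ∈ U)
    (hiso : ∀ u ∈ U, ∀ᶠ v in nhdsWithin u {u}ᶜ, Good v)
    (hloc : ∀ u, Good u → ∀ᶠ v in nhds u, (P v ↔ P u)) :
    ∀ u v, Good u → Good v → P u → P v := by
  have : Nontrivial E := (rank_pos_iff_nontrivial (R := ℝ)).1 (zero_lt_one.trans h)
  have hne : ∀ u : E, (nhdsWithin u {u}ᶜ).NeBot := fun u => Module.punctured_nhds_neBot ℝ E u
  set R : E → Prop := fun u => ∀ᶠ v in nhdsWithin u {u}ᶜ, P v with hR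
  have hPR : ∀ u, Good u → (P u ↔ R u) := by
    intro u hu
    have h1 := (hloc u hu).filter_mono (nhdsWithin_le_nhds (s := {u}ᶜ))
    constructor
    · intro hp
      filter_upwards [h1] with v hv using hv.2 hp
    · intro hr
      obtain ⟨v, hv1, hv2⟩ := (h1.and hr).exists
      exact hv1.1 hv2
  have key : ∀ u ∈ U, ∀ᶠ v in nhds u, (R u ↔ R v) := by
    intro u hu
    have h1 := hiso u hu
    rw [eventually_nhdsWithin_iff, Metric.eventually_nhds_iff_ball] at h1
    obtain ⟨r, hr, hG⟩ := h1
    set D := Metric.ball u r \ {u} with hD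
    have hDo : IsOpen D := Metric.isOpen_ball.sdiff isClosed_singleton
    have hDG : ∀ v ∈ D, Good v := fun v hv => hG v hv.1 hv.2
    have hDpre : IsPreconnected D := punctured_ball_preconnected h u r
    have hDc : ∀ v ∈ D, ∀ w ∈ D, (P v ↔ P w) := by
      intro v hv w hw
      refine hDpre.induction₂ (fun a b => (P a ↔ P b)) ?_ ?_ ?_ hv hw
      · intro x hx
        filter_upwards [(hloc x (hDG x hx)).filter_mono nhdsWithin_le_nhds] with y hy using hy.symm
      · intro a b c _ _ _ h1 h2; exact h1.trans h2
      · intro a b _ _ h1; exact h1.symm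
    have hDu : ∀ᶠ v in nhdsWithin u {u}ᶜ, v ∈ D := by
      rw [eventually_nhdsWithin_iff]
      filter_upwards [Metric.ball_mem_nhds u hr] with v hv hv' using ⟨hv, hv'⟩
    filter_upwards [Metric.ball_mem_nhds u hr] with v hv
    by_cases hvu : v = u
    · rw [hvu]
    · have hvD : v ∈ D := ⟨hv, hvu⟩
      rw [← hPR v (hDG v hvD)]
      constructor
      · intro hRu
        obtain ⟨w, hw1, hw2⟩ := (hDu.and hRu).exists
        exact (hDc w hw1 v hvD).1 hw2
      · intro hp
        filter_upwards [hDu] with w hw using (hDc v hvD w hw).1 hp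
  intro u v hu hv hp
  have := hU.induction₂ (fun a b => (R a ↔ R b))
    (fun x hx => (key x hx).filter_mono nhdsWithin_le_nhds)
    (fun a b c _ _ _ h1 h2 => h1.trans h2) (fun a b _ _ h1 => h1.symm) (hGU u hu) (hGU v hv)
  exact (hPR v hv).2 (this.1 ((hPR u hu).1 hp))

/-! ### Lipschitz continuity of the eigenvalues -/

/-- The linear part of the Hamiltonian. -/
noncomputable def linHam {n m : ℕ} (Hc : Fin m → Matrix (Fin n) (Fin n) ℂ)
    (w : EuclideanSpace ℝ (Fin m)) : Matrix (Fin n) (Fin n) ℂ := ∑ i, (w i : ℂ) • Hc i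

theorem controlHam_sub {n m : ℕ} (H0 : Matrix (Fin n) (Fin n) ℂ)
    (Hc : Fin m → Matrix (Fin n) (Fin n) ℂ) (u v : EuclideanSpace ℝ (Fin m)) :
    controlHam H0 Hc u - controlHam H0 Hc v = linHam Hc (u - v) := by
  unfold controlHam linHam
  rw [add_sub_add_left_eq_sub, ← Finset.sum_sub_distrib]
  refine Finset.sum_congr rfl fun i _ => ?_
  rw [← sub_smul]; simp

theorem controlHam_add {n m : ℕ} (H0 : Matrix (Fin n) (Fin n) ℂ)
    (Hc : Fin m → Matrix (Fin n) (Fin n) ℂ) (u w : EuclideanSpace ℝ (Fin m)) (t : ℝ) :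
    controlHam H0 Hc (u + t • w) = controlHam H0 Hc u + (t : ℂ) • linHam Hc w := by
  unfold controlHam linHam
  rw [add_assoc, Finset.smul_sum, ← Finset.sum_add_distrib]
  congr 1
  refine Finset.sum_congr rfl fun i _ => ?_
  rw [smul_smul, ← add_smul]; simp

theorem linHam_herm {n m : ℕ} {Hc : Fin m → Matrix (Fin n) (Fin n) ℂ}
    (hHc : ∀ i, (Hc i).IsHermitian) (w : EuclideanSpace ℝ (Fin m)) :
    (linHam Hc w).IsHermitian := by
  unfold linHam Matrix.IsHermitian
  rw [Matrix.conjTranspose_sum]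
  refine Finset.sum_congr rfl fun i _ => ?_
  rw [Matrix.conjTranspose_smul, (hHc i).eq]; simp

theorem controlHam_herm {n m : ℕ} {H0 : Matrix (Fin n) (Fin n) ℂ} (hH0 : H0.IsHermitian)
    {Hc : Fin m → Matrix (Fin n) (Fin n) ℂ}
    (hHc : ∀ i, (Hc i).IsHermitian) (w : EuclideanSpace ℝ (Fin m)) :
    (controlHam H0 Hc w).IsHermitian := hH0.add (linHam_herm hHc w)

theorem linHam_bound {n m : ℕ} (Hc : Fin m → Matrix (Fin n) (Fin n) ℂ) :
    ∃ C : ℝ, 0 < C ∧ ∀ w, ((linHam Hc w) * (linHam Hc w)).trace.re ≤ (C * ‖w‖) ^ 2 := by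
  set S : ℝ := ∑ i, ∑ j, ‖(Hc i * Hc j).trace‖ with hS
  have hS0 : 0 ≤ S := Finset.sum_nonneg fun i _ => Finset.sum_nonneg fun j _ => norm_nonneg _
  refine ⟨Real.sqrt (S + 1), Real.sqrt_pos.2 (by linarith), fun w => ?_⟩
  rw [mul_pow, Real.sq_sqrt (by linarith)]
  refine (Complex.re_le_norm _).trans ?_
  have h1 : ((linHam Hc w) * (linHam Hc w)).trace =
      ∑ i, ∑ j, ((w i : ℂ) * (w j : ℂ)) * (Hc i * Hc j).trace := by
    unfold linHam
    rw [Finset.sum_mul_sum, Matrix.trace_sum]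
    refine Finset.sum_congr rfl fun i _ => ?_
    rw [Matrix.trace_sum]
    refine Finset.sum_congr rfl fun j _ => ?_
    rw [Matrix.smul_mul, Matrix.mul_smul, smul_smul, Matrix.trace_smul, smul_eq_mul]
  have h2 : ‖((linHam Hc w) * (linHam Hc w)).trace‖ ≤ S * ‖w‖ ^ 2 := by
    rw [h1, hS, Finset.sum_mul]
    refine (norm_sum_le _ _).trans (Finset.sum_le_sum fun i _ => ?_)
    rw [Finset.sum_mul]
    refine (norm_sum_le _ _).trans (Finset.sum_le_sum fun j _ => ?_)
    rw [norm_mul, norm_mul, mul_comm]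
    refine mul_le_mul_of_nonneg_left ?_ (norm_nonneg _)
    rw [sq]
    refine mul_le_mul ?_ ?_ (norm_nonneg _) (norm_nonneg _)
    · simpa using PiLp.norm_apply_le w i
    · simpa using PiLp.norm_apply_le w j
  nlinarith [sq_nonneg ‖w‖]

/-- Data of the theorem bundled as a proposition. -/
structure Setup {n m : ℕ} (U : Set (EuclideanSpace ℝ (Fin m)))
    (H0 : Matrix (Fin n) (Fin n) ℂ) (Hc : Fin m → Matrix (Fin n) (Fin n) ℂ)
    (lam : EuclideanSpace ℝ (Fin m) → Fin n → ℝ) (C : ℝ) : Prop where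
  opn : IsOpen U
  conn : IsConnected U
  h0 : H0.IsHermitian
  hc : ∀ i, (Hc i).IsHermitian
  spec : IsOrderedSpectrum H0 Hc U lam
  cc : ConicallyConnected U lam
  cpos : 0 < C
  bound : ∀ w, ((linHam Hc w) * (linHam Hc w)).trace.re ≤ (C * ‖w‖) ^ 2

theorem Setup.diag {n m : ℕ} {U : Set (EuclideanSpace ℝ (Fin m))}
    {H0 : Matrix (Fin n) (Fin n) ℂ} {Hc : Fin m → Matrix (Fin n) (Fin n) ℂ}
    {lam : EuclideanSpace ℝ (Fin m) → Fin n → ℝ} {C : ℝ} (S : Setup U H0 Hc lam C)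
    {u : EuclideanSpace ℝ (Fin m)} (hu : u ∈ U) : ∃ V, DiagBy V (controlHam H0 Hc u) (lam u) :=
  exists_diagBy (controlHam_herm S.h0 S.hc u) (S.spec u hu).1 (S.spec u hu).2

theorem Setup.lip {n m : ℕ} {U : Set (EuclideanSpace ℝ (Fin m))}
    {H0 : Matrix (Fin n) (Fin n) ℂ} {Hc : Fin m → Matrix (Fin n) (Fin n) ℂ}
    {lam : EuclideanSpace ℝ (Fin m) → Fin n → ℝ} {C : ℝ} (S : Setup U H0 Hc lam C)
    {u v : EuclideanSpace ℝ (Fin m)} (hu : u ∈ U) (hv : v ∈ U) (k : Fin n) :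
    |lam u k - lam v k| ≤ C * ‖u - v‖ := by
  obtain ⟨V, dV⟩ := S.diag hu
  obtain ⟨W, dW⟩ := S.diag hv
  have h1 := hoffman_wielandt (controlHam_herm S.h0 S.hc u) (controlHam_herm S.h0 S.hc v)
    dV dW (S.spec u hu).1 (S.spec v hv).1
  rw [controlHam_sub] at h1
  have h2 := (Finset.single_le_sum (f := fun k => (lam u k - lam v k) ^ 2)
      (fun i _ => sq_nonneg _) (Finset.mem_univ k)).trans (h1.trans (S.bound (u - v)))
  exact abs_le_of_sq_le_sq h2 (mul_nonneg S.cpos.le (norm_nonneg _))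

/-- `u ∈ U` has simple spectrum. -/
def GoodPt {n m : ℕ} (U : Set (EuclideanSpace ℝ (Fin m)))
    (lam : EuclideanSpace ℝ (Fin m) → Fin n → ℝ) (u : EuclideanSpace ℝ (Fin m)) : Prop :=
  u ∈ U ∧ ∀ j k : Fin n, (j : ℕ) + 1 = (k : ℕ) → lam u j < lam u k

theorem GoodPt.strictMono {n m : ℕ} {U : Set (EuclideanSpace ℝ (Fin m))}
    {lam : EuclideanSpace ℝ (Fin m) → Fin n → ℝ} {u : EuclideanSpace ℝ (Fin m)}
    (h : GoodPt U lam u) : StrictMono (lam u) := by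
  cases n with
  | zero => intro a; exact a.elim0
  | succ n =>
    rw [Fin.strictMono_iff_lt_succ]
    intro i
    exact h.2 _ _ (by simp)

theorem Setup.iso {n m : ℕ} {U : Set (EuclideanSpace ℝ (Fin m))}
    {H0 : Matrix (Fin n) (Fin n) ℂ} {Hc : Fin m → Matrix (Fin n) (Fin n) ℂ}
    {lam : EuclideanSpace ℝ (Fin m) → Fin n → ℝ} {C : ℝ} (S : Setup U H0 Hc lam C)
    {u : EuclideanSpace ℝ (Fin m)} (hu : u ∈ U) :
    ∀ᶠ v in nhdsWithin u {u}ᶜ, GoodPt U lam v := by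
  have hUe : ∀ᶠ v in nhdsWithin u {u}ᶜ, v ∈ U :=
    mem_nhdsWithin_of_mem_nhds (S.opn.mem_nhds hu)
  refine hUe.and ?_
  rw [Filter.eventually_all]; intro j
  rw [Filter.eventually_all]; intro k
  by_cases hjk : (j : ℕ) + 1 = (k : ℕ)
  swap
  · exact Filter.Eventually.of_forall fun v h => absurd h hjk
  obtain ⟨r, hr, hrU⟩ := Metric.isOpen_iff.1 S.opn u hu
  have hC := S.cpos
  have hle : lam u j ≤ lam u k := (S.spec u hu).1 (by rw [Fin.le_def]; omega)
  rcases hle.lt_or_eq with hlt | heq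
  · -- separated eigenvalues stay separated
    have hd : 0 < lam u k - lam u j := by linarith
    have : ∀ᶠ v in nhds u, v ∈ Metric.ball u (min r ((lam u k - lam u j) / (2 * C))) :=
      Metric.ball_mem_nhds u (lt_min hr (by positivity))
    filter_upwards [this.filter_mono nhdsWithin_le_nhds] with v hv _
    rw [mem_ball_iff_norm, lt_min_iff, lt_div_iff₀ (by positivity)] at hv
    have hvU : v ∈ U := hrU (by rw [mem_ball_iff_norm]; exact hv.1)
    have e1 := abs_le.1 (S.lip hvU hu j)
    have e2 := abs_le.1 (S.lip hvU hu k)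
    linarith [e1.2, e2.1, hv.2]
  · obtain ⟨-, -, -, c, hc, hcon⟩ := S.cc.1 u hu j k hjk heq
    have key : ∃ ε > (0:ℝ), ∀ v ∈ Metric.sphere (0 : EuclideanSpace ℝ (Fin m)) 1, ∀ t : ℝ,
        0 < t → t < ε → lam (u + t • v) j < lam (u + t • v) k := by
      refine (isCompact_sphere (0 : EuclideanSpace ℝ (Fin m)) 1).induction_on
        (p := fun s => ∃ ε > (0:ℝ), ∀ v ∈ s, ∀ t : ℝ,
          0 < t → t < ε → lam (u + t • v) j < lam (u + t • v) k) ?_ ?_ ?_ ?_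
      · exact ⟨1, one_pos, fun v hv => absurd hv (Set.notMem_empty _)⟩
      · rintro s t hst ⟨ε, hε, h⟩
        exact ⟨ε, hε, fun v hv => h v (hst hv)⟩
      · rintro s t ⟨ε, hε, h⟩ ⟨ε', hε', h'⟩
        refine ⟨min ε ε', lt_min hε hε', ?_⟩
        rintro v (hv | hv) τ h0 h1
        · exact h v hv τ h0 (h1.trans_le (min_le_left _ _))
        · exact h' v hv τ h0 (h1.trans_le (min_le_right _ _))
      · intro v hv
        have hv1 : ‖v‖ = 1 := by simpa using hv
        obtain ⟨ε, hε, hgap⟩ := hcon v hv1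
        refine ⟨Metric.ball v (c / (2 * C)) ∩ Metric.sphere 0 1, ?_, min ε r, lt_min hε hr, ?_⟩
        · exact Filter.inter_mem (mem_nhdsWithin_of_mem_nhds (Metric.ball_mem_nhds v (by positivity)))
            self_mem_nhdsWithin
        · rintro w ⟨hw, hws⟩ t ht0 ht
          have hw1 : ‖w‖ = 1 := by simpa using hws
          rw [lt_min_iff] at ht
          have hmem : ∀ x : EuclideanSpace ℝ (Fin m), ‖x‖ = 1 → u + t • x ∈ U := by
            intro x hx
            apply hrU
            rw [mem_ball_iff_norm, add_sub_cancel_left, norm_smul, hx, mul_one, Real.norm_eq_abs,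
              abs_of_pos ht0]
            exact ht.2
          have g := hgap t ht0 ht.1
          have e1 := abs_le.1 (S.lip (hmem w hw1) (hmem v hv1) j)
          have e2 := abs_le.1 (S.lip (hmem w hw1) (hmem v hv1) k)
          have e3 : ‖(u + t • w) - (u + t • v)‖ = t * ‖w - v‖ := by
            rw [add_sub_add_left_eq_sub, ← smul_sub, norm_smul, Real.norm_eq_abs, abs_of_pos ht0]
          rw [e3] at e1 e2
          rw [mem_ball_iff_norm, lt_div_iff₀ (by positivity)] at hw
          have e4 : t * (‖w - v‖ * (2 * C)) < t * c := mul_lt_mul_of_pos_left hw ht0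
          nlinarith [e1.2, e2.1]
    obtain ⟨ε, hε, hkey⟩ := key
    rw [eventually_nhdsWithin_iff]
    filter_upwards [Metric.ball_mem_nhds u hε] with v hv hvu _
    have hpos : 0 < ‖v - u‖ := norm_pos_iff.2 (sub_ne_zero.2 hvu)
    have := hkey (‖v - u‖⁻¹ • (v - u)) (by simp [norm_smul, hpos.ne']) ‖v - u‖ hpos
      (by simpa [dist_eq_norm] using hv)
    simpa [smul_smul, hpos.ne'] using this

/-! ### first order perturbation -/

theorem DiagBy.fwd {n : ℕ} {V A g : Matrix (Fin n) (Fin n) ℂ} {a : Fin n → ℝ}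
    (h : DiagBy V A a) (hg : g ∈ Matrix.unitaryGroup (Fin n) ℂ) :
    DiagBy (g * V) (g * A * star g) a := by
  refine ⟨mul_mem hg h.1, ?_⟩
  rw [← h.2, star_mul]
  calc star V * star g * (g * A * star g) * (g * V)
      = star V * (star g * (g * A * star g) * g) * V := by simp only [Matrix.mul_assoc]
    _ = _ := by rw [star_conj_conj hg]

theorem diagBy_diagonal {n : ℕ} (a : Fin n → ℝ) :
    DiagBy 1 (Matrix.diagonal (fun k => ((a k : ℝ) : ℂ))) a :=
  ⟨one_mem _, by simp⟩

theorem trace_sq_le_norm {n : ℕ} (M : Matrix (Fin n) (Fin n) ℂ) :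
    (M * M).trace.re ≤ (n * ‖M‖) ^ 2 := by
  refine (Complex.re_le_norm _).trans ?_
  simp only [Matrix.trace, Matrix.diag_apply, Matrix.mul_apply]
  refine (norm_sum_le _ _).trans ?_
  have : ∀ i ∈ (Finset.univ : Finset (Fin n)), ‖∑ j, M i j * M j i‖ ≤ n * ‖M‖ ^ 2 := by
    intro i _
    refine (norm_sum_le _ _).trans ?_
    have : ∀ j ∈ (Finset.univ : Finset (Fin n)), ‖M i j * M j i‖ ≤ ‖M‖ ^ 2 := by
      intro j _
      rw [norm_mul, sq]
      exact mul_le_mul (Matrix.norm_entry_le_entrywise_sup_norm M)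
        (Matrix.norm_entry_le_entrywise_sup_norm M) (norm_nonneg _) (norm_nonneg _)
    refine (Finset.sum_le_sum this).trans ?_
    simp
  refine (Finset.sum_le_sum this).trans ?_
  simp only [Finset.sum_const, Finset.card_univ, Fintype.card_fin, nsmul_eq_mul]
  apply le_of_eq; ring

/-- If the perturbation `M` is diagonal on the degenerate blocks of `diag d`, the eigenvalues of
`diag d + t M` follow those of `diag (d + t diag M)` up to `o(t)`. -/
theorem perturb_first_order {n : ℕ} {d μ : Fin n → ℝ} {M : Matrix (Fin n) (Fin n) ℂ}
    (hM : M.IsHermitian) (hd : ∀ p q, p ≠ q → d p = d q → M p q = 0)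
    (hμ : ∀ p, M p p = (μ p : ℂ)) (η : ℝ) (hη : 0 < η)
    (hmono : ∀ᶠ t : ℝ in nhdsWithin (0:ℝ) (Set.Ioi 0), Monotone (fun p => d p + t * μ p : Fin n → ℝ)) :
    ∀ᶠ t : ℝ in nhdsWithin (0:ℝ) (Set.Ioi 0), ∀ (W : Matrix (Fin n) (Fin n) ℂ) (a : Fin n → ℝ),
      Monotone a →
      DiagBy W (Matrix.diagonal (fun k => ((d k : ℝ) : ℂ)) + (t : ℂ) • M) a →
      ∀ p, |a p - (d p + t * μ p)| ≤ η * t := by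
  set D : Matrix (Fin n) (Fin n) ℂ := Matrix.diagonal (fun k => ((d k : ℝ) : ℂ)) with hD
  set Z : Matrix (Fin n) (Fin n) ℂ :=
    Matrix.of (fun p q => -Complex.I * M p q / ((d q : ℂ) - (d p : ℂ))) with hZ
  have hZh : Z.IsHermitian := by
    ext p q
    have h1 : star (M q p) = M p q := hM.apply p q
    simp only [Matrix.conjTranspose_apply, hZ, Matrix.of_apply]
    rw [star_div₀, star_mul', h1]
    simp only [star_sub, star_neg]
    have e1 : ∀ x : ℝ, star (x : ℂ) = (x : ℂ) := fun x => Complex.conj_ofReal x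
    have e2 : star Complex.I = -Complex.I := Complex.conj_I
    rw [e1, e1, e2, neg_neg, ← neg_sub (d q : ℂ) (d p : ℂ), div_neg, neg_mul, neg_div]
  set B : ℝ → Matrix (Fin n) (Fin n) ℂ :=
    fun t => Matrix.diagonal (fun k => ((d k + t * μ k : ℝ) : ℂ)) with hB
  set N : Matrix (Fin n) (Fin n) ℂ := Matrix.diagonal (fun k => ((μ k : ℝ) : ℂ)) with hN
  have hBN : ∀ t, B t = D + (t : ℝ) • N := by
    intro t
    ext p q
    by_cases hpq : p = q
    · subst hpq; simp [hB, hD, hN]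
    · simp [hB, hD, hN, hpq]
  set f : ℝ → Matrix (Fin n) (Fin n) ℂ :=
    fun t => qflow Z t * (D + (t : ℂ) • M) * qflow Z (-t) - B t with hf
  have hf0 : f 0 = 0 := by
    simp [hf, hBN, qflow_zero]
  have hfd : HasDerivAt f 0 0 := by
    have h1 := qflow_conj_hasDerivAt Z D
    have h2 := (hasDerivAt_id (0:ℝ)).smul (qflow_conj_hasDerivAt Z M)
    have h3 : HasDerivAt B N 0 := by
      have : B = fun t => D + t • N := funext hBN
      rw [this]
      have := ((hasDerivAt_id (0:ℝ)).smul_const N).const_add D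
      rw [one_smul] at this
      exact this
    have h4 := (h1.add h2).sub h3
    have hfe : f = fun t => (qflow Z t * D * qflow Z (-t) + t • (qflow Z t * M * qflow Z (-t))) - B t := by
      funext t
      simp only [hf, Matrix.mul_add, Matrix.add_mul, Matrix.mul_smul, Matrix.smul_mul]
      congr 2
    rw [hfe]
    refine h4.congr_deriv ?_
    simp only [id, qflow_zero, neg_zero, Matrix.mul_one, Matrix.one_mul, zero_smul, one_smul, zero_add]
    ext p q
    simp only [Matrix.sub_apply, Matrix.add_apply, Matrix.smul_apply, hD, hN, hZ,
      Matrix.mul_diagonal, Matrix.diagonal_mul, Matrix.of_apply, smul_eq_mul, Matrix.zero_apply]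
    by_cases hpq : p = q
    · subst hpq; simp [hμ]
    · rw [Matrix.diagonal_apply_ne _ hpq]
      by_cases hdd : d p = d q
      · simp [hd p q hpq hdd]
      · have hne : (d q : ℂ) - (d p : ℂ) ≠ 0 := by
          rw [sub_ne_zero]; exact_mod_cast (Ne.symm hdd)
        field_simp
        ring_nf
        rw [Complex.I_sq]; ring
  have hlit : ∀ᶠ t in nhds (0:ℝ), ‖f t‖ ≤ (η / (n + 1)) * ‖t‖ := by
    have := (hasDerivAt_iff_isLittleO.1 hfd).def (show 0 < η / ((n:ℝ) + 1) by positivity)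
    simpa [hf0] using this
  filter_upwards [hmono, hlit.filter_mono nhdsWithin_le_nhds, self_mem_nhdsWithin] with t hm hl ht
  intro W a ha hW p
  have ht0 : (0:ℝ) < t := ht
  have hAh : (D + (t : ℂ) • M).IsHermitian := by
    rw [hW.eq]
    refine Matrix.isHermitian_mul_mul_conjTranspose W ?_
    rw [Matrix.isHermitian_diagonal_iff]
    intro i; exact Complex.conj_ofReal _
  have hW' := hW.fwd (qflow_mem hZh t)
  rw [qflow_star hZh] at hW'
  have hh : (qflow Z t * (D + (t : ℂ) • M) * qflow Z (-t)).IsHermitian := by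
    rw [← qflow_star hZh]
    exact Matrix.isHermitian_mul_mul_conjTranspose _ hAh
  have hBh : (B t).IsHermitian := by
    rw [hB, Matrix.isHermitian_diagonal_iff]
    intro i; exact Complex.conj_ofReal _
  have hw := hoffman_wielandt hh hBh hW' (diagBy_diagonal _) ha hm
  have h1 := (Finset.single_le_sum (f := fun k => (a k - (d k + t * μ k)) ^ 2)
      (fun i _ => sq_nonneg _) (Finset.mem_univ p)).trans (hw.trans (trace_sq_le_norm (f t)))
  refine (abs_le_of_sq_le_sq h1 (by positivity)).trans ?_
  rw [Real.norm_eq_abs, abs_of_pos ht0] at hl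
  calc (n:ℝ) * ‖f t‖ ≤ n * ((η / (n + 1)) * t) := mul_le_mul_of_nonneg_left hl (by positivity)
    _ = (n / (n + 1)) * (η * t) := by ring
    _ ≤ 1 * (η * t) := by
        refine mul_le_mul_of_nonneg_right ?_ (by positivity)
        rw [div_le_one (by positivity)]; linarith
    _ = η * t := one_mul _

/-- The family of Hamiltonians. -/
noncomputable def famH {n m : ℕ} (U : Set (EuclideanSpace ℝ (Fin m)))
    (H0 : Matrix (Fin n) (Fin n) ℂ) (Hc : Fin m → Matrix (Fin n) (Fin n) ℂ) :
    Set (Matrix (Fin n) (Fin n) ℂ) := controlHam H0 Hc '' U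

theorem Setup.fam_herm {n m : ℕ} {U : Set (EuclideanSpace ℝ (Fin m))}
    {H0 : Matrix (Fin n) (Fin n) ℂ} {Hc : Fin m → Matrix (Fin n) (Fin n) ℂ}
    {lam : EuclideanSpace ℝ (Fin m) → Fin n → ℝ} {C : ℝ} (S : Setup U H0 Hc lam C) :
    ∀ G ∈ famH U H0 Hc, G.IsHermitian := by
  rintro G ⟨u, -, rfl⟩; exact controlHam_herm S.h0 S.hc u

theorem Setup.linHam_mem {n m : ℕ} {U : Set (EuclideanSpace ℝ (Fin m))}
    {H0 : Matrix (Fin n) (Fin n) ℂ} {Hc : Fin m → Matrix (Fin n) (Fin n) ℂ}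
    {lam : EuclideanSpace ℝ (Fin m) → Fin n → ℝ} {C : ℝ} (S : Setup U H0 Hc lam C)
    (w : EuclideanSpace ℝ (Fin m)) : linHam Hc w ∈ Lsp (famH U H0 Hc) := by
  obtain ⟨u, hu⟩ := S.conn.nonempty
  have hc : Continuous (fun t : ℝ => u + t • w) := by fun_prop
  have h1 : ∀ᶠ t : ℝ in nhds 0, u + t • w ∈ U :=
    hc.continuousAt.eventually_mem (S.opn.mem_nhds (by simpa using hu))
  obtain ⟨t, ht, ht0⟩ := ((h1.filter_mono (nhdsWithin_le_nhds (s := {0}ᶜ))).and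
    self_mem_nhdsWithin).exists
  have ht0' : t ≠ 0 := ht0
  have e1 : controlHam H0 Hc (u + t • w) ∈ Lsp (famH U H0 Hc) := mem_Lsp ⟨_, ht, rfl⟩
  have e2 : controlHam H0 Hc u ∈ Lsp (famH U H0 Hc) := mem_Lsp ⟨_, hu, rfl⟩
  have e3 := Submodule.smul_mem _ ((t : ℂ)⁻¹) (sub_mem e1 e2)
  rw [controlHam_add, add_sub_cancel_left, smul_smul, inv_mul_cancel₀ (by exact_mod_cast ht0'),
    one_smul] at e3
  exact e3

theorem Setup.near {n m : ℕ} {U : Set (EuclideanSpace ℝ (Fin m))}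
    {H0 : Matrix (Fin n) (Fin n) ℂ} {Hc : Fin m → Matrix (Fin n) (Fin n) ℂ}
    {lam : EuclideanSpace ℝ (Fin m) → Fin n → ℝ} {C : ℝ} (S : Setup U H0 Hc lam C)
    {u : EuclideanSpace ℝ (Fin m)} (hu : u ∈ U) :
    ∀ᶠ v in nhds u, ∃ g ∈ Kset (famH U H0 Hc), ∃ V,
      DiagBy V (g * controlHam H0 Hc v * star g) (lam v) ∧ DiagBy V (controlHam H0 Hc u) (lam u) := by
  have hC := S.cpos
  have h1 : ∀ᶠ v in nhds u, ∀ k l, lam u k < lam u l →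
      4 * (C * ‖v - u‖) ^ 2 < (lam u l - lam u k) ^ 2 := by
    rw [Filter.eventually_all]; intro k
    rw [Filter.eventually_all]; intro l
    by_cases hkl : lam u k < lam u l
    · have hd : 0 < lam u l - lam u k := by linarith
      have hc : Continuous (fun v => 4 * (C * ‖v - u‖) ^ 2) := by fun_prop
      have := hc.continuousAt.eventually_lt (continuousAt_const (y := (lam u l - lam u k) ^ 2))
        (x₀ := u) (by simp; positivity)
      filter_upwards [this] with v hv _ using hv
    · exact Filter.Eventually.of_forall fun v h => absurd h hkl
  filter_upwards [h1, S.opn.mem_nhds hu] with v hv hvU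
  obtain ⟨V, dV⟩ := S.diag hvU
  obtain ⟨W, dW⟩ := S.diag hu
  refine near_diag_F S.fam_herm ⟨v, hvU, rfl⟩ ⟨u, hu, rfl⟩ dV dW (S.spec v hvU).1
    (S.spec u hu).1 fun k l hkl => ?_
  rw [controlHam_sub]
  linarith [hv k l hkl, S.bound (v - u)]

/-- The `(j,k)` elementary matrix in the eigenbasis of `A` belongs to `L`. -/
def HasElem {n : ℕ} (L : Submodule ℂ (Matrix (Fin n) (Fin n) ℂ)) (j k : Fin n)
    (A : Matrix (Fin n) (Fin n) ℂ) (a : Fin n → ℝ) : Prop :=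
  ∃ V, DiagBy V A a ∧ V * Matrix.single j k 1 * star V ∈ L

theorem elem_unique {n : ℕ} {L : Submodule ℂ (Matrix (Fin n) (Fin n) ℂ)} {j k : Fin n}
    {A V W : Matrix (Fin n) (Fin n) ℂ} {a : Fin n → ℝ} (ha : Function.Injective a)
    (hV : DiagBy V A a) (hW : DiagBy W A a) (h : V * Matrix.single j k 1 * star V ∈ L) :
    W * Matrix.single j k 1 * star W ∈ L := by
  set T := star V * W with hT
  have hW' : W = V * T := by rw [hT, ← Matrix.mul_assoc, uni_mul_star hV.1, Matrix.one_mul]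
  have hcomm : T * Matrix.diagonal (fun k => ((a k : ℝ) : ℂ)) =
      Matrix.diagonal (fun k => ((a k : ℝ) : ℂ)) * T := by
    rw [hT]
    nth_rewrite 1 [← hW.2]
    rw [← hV.2]
    calc star V * W * (star W * A * W) = star V * (W * star W) * A * W := by
          simp only [Matrix.mul_assoc]
      _ = star V * A * (V * star V) * W := by
          rw [uni_mul_star hW.1, uni_mul_star hV.1]; simp
      _ = _ := by simp only [Matrix.mul_assoc]
  have hoff : ∀ p q, p ≠ q → T p q = 0 := fun p q hpq =>
    comm_diag_entry hcomm p q (by simpa using fun h => hpq (ha h))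
  have hTd : T = Matrix.diagonal (fun p => T p p) := by
    ext p q
    by_cases hpq : p = q
    · subst hpq; simp
    · rw [hoff p q hpq, Matrix.diagonal_apply_ne _ hpq]
  have key : T * Matrix.single j k 1 * star T = (T j j * star (T k k)) • Matrix.single j k 1 := by
    rw [hTd]
    ext p q
    rw [Matrix.star_eq_conjTranspose, Matrix.diagonal_conjTranspose, Matrix.mul_diagonal,
      Matrix.diagonal_mul, Matrix.smul_apply, Matrix.single_apply]
    simp only [Matrix.diagonal_apply_eq, Pi.star_apply, smul_eq_mul]
    split_ifs with h
    · obtain ⟨rfl, rfl⟩ := h; ring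
    · ring
  rw [hW', star_mul]
  have : V * T * Matrix.single j k 1 * (star T * star V) =
      (T j j * star (T k k)) • (V * Matrix.single j k 1 * star V) := by
    calc V * T * Matrix.single j k 1 * (star T * star V)
        = V * (T * Matrix.single j k 1 * star T) * star V := by simp only [Matrix.mul_assoc]
      _ = _ := by rw [key, Matrix.mul_smul, Matrix.smul_mul]
  rw [this]
  exact Submodule.smul_mem _ _ h

theorem Setup.elem_loc {n m : ℕ} {U : Set (EuclideanSpace ℝ (Fin m))}
    {H0 : Matrix (Fin n) (Fin n) ℂ} {Hc : Fin m → Matrix (Fin n) (Fin n) ℂ}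
    {lam : EuclideanSpace ℝ (Fin m) → Fin n → ℝ} {C : ℝ} (S : Setup U H0 Hc lam C) (j k : Fin n)
    {u : EuclideanSpace ℝ (Fin m)} (hu : GoodPt U lam u) :
    ∀ᶠ v in nhds u, (HasElem (Lsp (famH U H0 Hc)) j k (controlHam H0 Hc v) (lam v) ↔
      HasElem (Lsp (famH U H0 Hc)) j k (controlHam H0 Hc u) (lam u)) := by
  have h1 := S.iso hu.1
  rw [eventually_nhdsWithin_iff] at h1
  filter_upwards [h1, S.near hu.1] with v hv1 hv2
  have hv : GoodPt U lam v := by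
    by_cases h : v = u
    · rw [h]; exact hu
    · exact hv1 h
  obtain ⟨g, hg, W, dv, du⟩ := hv2
  have hgu := Kset_unitary S.fam_herm g hg
  have dv' := dv.conj hgu
  have e : ∀ X : Matrix (Fin n) (Fin n) ℂ, star g * W * X * star (star g * W) =
      star g * (W * X * star W) * star (star g) := by
    intro X; rw [star_mul]; simp only [Matrix.mul_assoc]
  constructor
  · rintro ⟨V, dV, hV⟩
    refine ⟨W, du, ?_⟩
    have h2 := Lsp_conj hg (elem_unique hv.strictMono.injective dV dv' hV)
    rwa [e, star_star, conj_star_conj hgu] at h2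
  · rintro ⟨V, dV, hV⟩
    refine ⟨star g * W, dv', ?_⟩
    rw [e]
    exact Lsp_conj (Kset_star S.fam_herm hg) (elem_unique hu.strictMono.injective dV du hV)

/-- Extraction of a single entry by iterated brackets with a diagonal matrix. -/
theorem extract_elem {n : ℕ} {L : Submodule ℂ (Matrix (Fin n) (Fin n) ℂ)}
    (hL : ∀ X ∈ L, ∀ Y ∈ L, X * Y - Y * X ∈ L) {A V X : Matrix (Fin n) (Fin n) ℂ}
    {a : Fin n → ℝ} (dV : DiagBy V A a) (hA : A ∈ L) (hX : X ∈ L) {j k : Fin n}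
    (hne : (star V * X * V) j k ≠ 0)
    (hsep : ∀ p q, (p, q) ≠ (j, k) → a p - a q ≠ a j - a k) :
    V * Matrix.single j k 1 * star V ∈ L := by
  have key : ∀ T : Finset (Fin n × Fin n),
      V * Matrix.of (fun p q => (star V * X * V) p q *
        ∏ r ∈ T, (((a p : ℂ) - a q) - ((a r.1 : ℂ) - a r.2))) * star V ∈ L := by
    intro T
    induction T using Finset.induction_on with
    | empty =>
      have : Matrix.of (fun p q => (star V * X * V) p q *
        ∏ r ∈ (∅ : Finset (Fin n × Fin n)), (((a p : ℂ) - a q) - ((a r.1 : ℂ) - a r.2))) =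
          star V * X * V := by
        ext p q; simp
      rw [this, conj_star_conj dV.1]; exact hX
    | insert r T hr ih =>
      set Y := Matrix.of (fun p q => (star V * X * V) p q *
        ∏ r ∈ T, (((a p : ℂ) - a q) - ((a r.1 : ℂ) - a r.2))) with hY
      have h1 := sub_mem (hL A hA _ ih) (Submodule.smul_mem L ((a r.1 : ℂ) - a r.2) ih)
      convert h1 using 1
      have e1 : A * (V * Y * star V) = V * (Matrix.diagonal (fun k => ((a k : ℝ) : ℂ)) * Y) * star V := by
        rw [dV.eq]
        calc V * Matrix.diagonal (fun k => ((a k : ℝ) : ℂ)) * star V * (V * Y * star V)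
            = V * Matrix.diagonal (fun k => ((a k : ℝ) : ℂ)) * (star V * V) * Y * star V := by
              simp only [Matrix.mul_assoc]
          _ = _ := by rw [uni_star_mul dV.1]; simp only [Matrix.mul_assoc, Matrix.mul_one, Matrix.one_mul]
      have e2 : (V * Y * star V) * A = V * (Y * Matrix.diagonal (fun k => ((a k : ℝ) : ℂ))) * star V := by
        rw [dV.eq]
        calc (V * Y * star V) * (V * Matrix.diagonal (fun k => ((a k : ℝ) : ℂ)) * star V)
            = V * Y * (star V * V) * Matrix.diagonal (fun k => ((a k : ℝ) : ℂ)) * star V := by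
              simp only [Matrix.mul_assoc]
          _ = _ := by rw [uni_star_mul dV.1]; simp only [Matrix.mul_assoc, Matrix.mul_one, Matrix.one_mul]
      rw [e1, e2, ← Matrix.sub_mul, ← Matrix.mul_sub]
      have e3 : ((a r.1 : ℂ) - a r.2) • (V * Y * star V) = V * (((a r.1 : ℂ) - a r.2) • Y) * star V := by
        rw [Matrix.mul_smul, Matrix.smul_mul]
      rw [e3, ← Matrix.sub_mul, ← Matrix.mul_sub]
      congr 2
      ext p q
      simp only [Matrix.of_apply, Matrix.sub_apply, Matrix.mul_diagonal, Matrix.diagonal_mul,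
        Matrix.smul_apply, smul_eq_mul, hY, Finset.prod_insert hr]
      ring
  have h1 := key (Finset.univ.erase (j, k))
  set c : ℂ := (star V * X * V) j k *
        ∏ r ∈ Finset.univ.erase (j, k), (((a j : ℂ) - a k) - ((a r.1 : ℂ) - a r.2)) with hc
  have hc0 : c ≠ 0 := by
    refine mul_ne_zero hne (Finset.prod_ne_zero_iff.2 fun r hr => ?_)
    rw [sub_ne_zero]
    have := hsep r.1 r.2 (Finset.ne_of_mem_erase hr)
    exact_mod_cast this.symm
  have h2 : Matrix.of (fun p q => (star V * X * V) p q *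
        ∏ r ∈ Finset.univ.erase (j, k), (((a p : ℂ) - a q) - ((a r.1 : ℂ) - a r.2))) =
      c • Matrix.single j k 1 := by
    ext p q
    rw [Matrix.of_apply, Matrix.smul_apply, Matrix.single_apply]
    split_ifs with h
    · obtain ⟨rfl, rfl⟩ := h; simp [hc]
    · have hm : (p, q) ∈ Finset.univ.erase (j, k) := by
        rw [Finset.mem_erase]
        refine ⟨fun h' => h ?_, Finset.mem_univ _⟩
        rw [Prod.mk.injEq] at h'
        exact ⟨h'.1.symm, h'.2.symm⟩
      rw [Finset.prod_eq_zero hm (by simp)]; simp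
  rw [h2, Matrix.mul_smul, Matrix.smul_mul] at h1
  have h3 := Submodule.smul_mem L c⁻¹ h1
  rwa [smul_smul, inv_mul_cancel₀ hc0, one_smul] at h3

/-- At a conical intersection some control Hamiltonian couples the two levels. -/
theorem Setup.coupling {n m : ℕ} (hm : 2 ≤ m) {U : Set (EuclideanSpace ℝ (Fin m))}
    {H0 : Matrix (Fin n) (Fin n) ℂ} {Hc : Fin m → Matrix (Fin n) (Fin n) ℂ}
    {lam : EuclideanSpace ℝ (Fin m) → Fin n → ℝ} {C : ℝ} (S : Setup U H0 Hc lam C)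
    {j k : Fin n} {u : EuclideanSpace ℝ (Fin m)} (hjk : (j : ℕ) + 1 = (k : ℕ))
    (hcon : ConicalAt U lam j k u)
    (hsim : ∀ l : Fin n, l ≠ j → l ≠ k → SimpleEigAt lam u l)
    {V : Matrix (Fin n) (Fin n) ℂ} (dV : DiagBy V (controlHam H0 Hc u) (lam u)) :
    ∃ w, (star V * linHam Hc w * V) j k ≠ 0 := by
  by_contra hcontra
  push Not at hcontra
  obtain ⟨hu, heq, hmult, c, hc, hgap⟩ := hcon
  have hherm : ∀ w, (star V * linHam Hc w * V).IsHermitian := fun w =>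
    Matrix.isHermitian_conjTranspose_mul_mul V (linHam_herm S.hc w)
  -- the difference of diagonal entries as a linear functional
  let φ : EuclideanSpace ℝ (Fin m) →ₗ[ℝ] ℝ :=
    { toFun := fun w => ((star V * linHam Hc w * V) j j).re - ((star V * linHam Hc w * V) k k).re
      map_add' := by
        intro x y
        have : linHam Hc (x + y) = linHam Hc x + linHam Hc y := by
          unfold linHam
          rw [← Finset.sum_add_distrib]
          refine Finset.sum_congr rfl fun i _ => ?_
          rw [← add_smul]; simp
        rw [this, Matrix.mul_add, Matrix.add_mul]
        simp only [Matrix.add_apply, Complex.add_re]; ring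
      map_smul' := by
        intro t x
        have : linHam Hc (t • x) = (t : ℂ) • linHam Hc x := by
          unfold linHam
          rw [Finset.smul_sum]
          refine Finset.sum_congr rfl fun i _ => ?_
          rw [smul_smul]; simp
        rw [this, Matrix.mul_smul, Matrix.smul_mul]
        simp only [Matrix.smul_apply, smul_eq_mul, Complex.re_ofReal_mul, RingHom.id_apply]; ring }
  have hker : LinearMap.ker φ ≠ ⊥ := LinearMap.ker_ne_bot_of_finrank_lt (by simp; omega)
  obtain ⟨w0, hw0, hw0ne⟩ := (Submodule.ne_bot_iff _).1 hker
  set w := ‖w0‖⁻¹ • w0 with hw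
  have hw1 : ‖w‖ = 1 := by simp [hw, norm_smul, norm_ne_zero_iff.2 hw0ne]
  have hφw : φ w = 0 := by rw [hw, map_smul, LinearMap.mem_ker.1 hw0, smul_zero]
  set M := star V * linHam Hc w * V with hM
  have hMjk : M j k = 0 := hcontra w
  have hMkj : M k j = 0 := by
    have h1 : star (M j k) = M k j := (hherm w).apply k j
    rw [← h1, hMjk, star_zero]
  have hjk' : j ≠ k := by intro h; rw [h] at hjk; omega
  have hMre : ∀ p, M p p = (((M p p).re : ℝ) : ℂ) := fun p =>
    (Complex.conj_eq_iff_re.1 ((hherm w).apply p p)).symm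
  have hjj : (M j j).re = (M k k).re := sub_eq_zero.1 hφw
  -- degenerate pairs
  have hdeg : ∀ p q, p ≠ q → lam u p = lam u q → (p = j ∧ q = k) ∨ (p = k ∧ q = j) := by
    intro p q hpq hl
    have hp : p = j ∨ p = k := by
      by_contra h; push Not at h
      exact hpq (hsim p h.1 h.2 q hl.symm).symm
    have hq : q = j ∨ q = k := by
      by_contra h; push Not at h
      exact hpq (hsim q h.1 h.2 p hl)
    rcases hp with rfl | rfl <;> rcases hq with rfl | rfl
    · exact absurd rfl hpq
    · exact Or.inl ⟨rfl, rfl⟩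
    · exact Or.inr ⟨rfl, rfl⟩
    · exact absurd rfl hpq
  have hmono := (S.spec u hu).1
  have hmon : ∀ᶠ t : ℝ in nhdsWithin (0:ℝ) (Set.Ioi 0),
      Monotone (fun p => lam u p + t * (M p p).re : Fin n → ℝ) := by
    have : ∀ᶠ t : ℝ in nhds (0:ℝ), ∀ p q : Fin n, p ≤ q →
        lam u p + t * (M p p).re ≤ lam u q + t * (M q q).re := by
      rw [Filter.eventually_all]; intro p
      rw [Filter.eventually_all]; intro q
      by_cases hpq : p ≤ q
      · by_cases hne : p = q
        · exact Filter.Eventually.of_forall fun t _ => by rw [hne]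
        rcases (hmono hpq).lt_or_eq with hlt | he
        · have := ContinuousAt.eventually_lt (f := fun t : ℝ => lam u p + t * (M p p).re)
            (g := fun t : ℝ => lam u q + t * (M q q).re) (x₀ := 0) (by fun_prop) (by fun_prop)
            (by simpa using hlt)
          filter_upwards [this] with t ht _ using ht.le
        · refine Filter.Eventually.of_forall fun t _ => ?_
          rcases hdeg p q hne he with ⟨rfl, rfl⟩ | ⟨rfl, rfl⟩
          · rw [he, hjj]
          · rw [he, hjj]
      · exact Filter.Eventually.of_forall fun t h => absurd h hpq
    filter_upwards [this.filter_mono nhdsWithin_le_nhds] with t ht p q hpq using ht p q hpq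
  have hper := perturb_first_order (hherm w) (d := lam u) (μ := fun p => (M p p).re)
    (by
      intro p q hpq hl
      rcases hdeg p q hpq hl with ⟨rfl, rfl⟩ | ⟨rfl, rfl⟩
      · exact hMjk
      · exact hMkj) hMre (c / 4) (by positivity) hmon
  obtain ⟨ε, hε, hg⟩ := hgap w hw1
  have hcont : Continuous (fun t : ℝ => u + t • w) := by fun_prop
  have hU : ∀ᶠ t : ℝ in nhds 0, u + t • w ∈ U :=
    hcont.continuousAt.eventually_mem (S.opn.mem_nhds (by simpa using hu))
  have hlt : ∀ᶠ t : ℝ in nhds 0, t < ε := eventually_lt_nhds hε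
  obtain ⟨t, ⟨⟨hp, htU⟩, htε⟩, ht0⟩ := (((hper.and (hU.filter_mono nhdsWithin_le_nhds)).and
    (hlt.filter_mono nhdsWithin_le_nhds)).and self_mem_nhdsWithin).exists
  have ht0' : 0 < t := ht0
  obtain ⟨W, dW⟩ := S.diag htU
  have dW' := dW.fwd (uni_star_mem dV.1)
  rw [star_star, controlHam_add, Matrix.mul_add, Matrix.add_mul, dV.2, Matrix.mul_smul,
    Matrix.smul_mul] at dW'
  have e := hp _ _ (S.spec _ htU).1 dW'
  have e1 := abs_le.1 (e j)
  have e2 := abs_le.1 (e k)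
  have e3 := hg t ht0' htε
  simp only [hjj, heq] at e1 e2
  nlinarith [mul_pos hc ht0', e1.1, e2.2]

/-- For consecutive levels the elementary matrix is obtained at some good point. -/
theorem Setup.elem_exists {n m : ℕ} (hm : 2 ≤ m) {U : Set (EuclideanSpace ℝ (Fin m))}
    {H0 : Matrix (Fin n) (Fin n) ℂ} {Hc : Fin m → Matrix (Fin n) (Fin n) ℂ}
    {lam : EuclideanSpace ℝ (Fin m) → Fin n → ℝ} {C : ℝ} (S : Setup U H0 Hc lam C)
    {j k : Fin n} (hjk : (j : ℕ) + 1 = (k : ℕ)) :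
    ∃ u, GoodPt U lam u ∧
      HasElem (Lsp (famH U H0 Hc)) j k (controlHam H0 Hc u) (lam u) := by
  obtain ⟨u, hcon, hsim⟩ := S.cc.2 j k hjk
  have hu := hcon.1
  have heq := hcon.2.1
  have hfin : 1 < Module.rank ℝ (EuclideanSpace ℝ (Fin m)) :=
    Module.one_lt_rank_of_one_lt_finrank (by simp; omega)
  have : Nontrivial (EuclideanSpace ℝ (Fin m)) :=
    (rank_pos_iff_nontrivial (R := ℝ)).1 (zero_lt_one.trans hfin)
  have hneb : (nhdsWithin u {u}ᶜ).NeBot := Module.punctured_nhds_neBot ℝ _ u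
  have hlamc : ∀ p, ContinuousAt (fun v => lam v p) u := by
    intro p
    rw [ContinuousAt, tendsto_iff_norm_sub_tendsto_zero]
    have hc : Filter.Tendsto (fun v => C * ‖v - u‖) (nhds u) (nhds 0) := by
      have : Continuous (fun v => C * ‖v - u‖) := by fun_prop
      simpa using this.tendsto u
    refine squeeze_zero' (Filter.Eventually.of_forall fun v => norm_nonneg _) ?_ hc
    filter_upwards [S.opn.mem_nhds hu] with v hv using S.lip hv hu p
  have hjk' : j ≠ k := by intro h; rw [h] at hjk; omega
  have hsep : ∀ᶠ v in nhds u, ∀ p q, lam u p ≠ lam u q → lam v p - lam v q ≠ lam v j - lam v k := by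
    rw [Filter.eventually_all]; intro p
    rw [Filter.eventually_all]; intro q
    by_cases h : lam u p = lam u q
    · exact Filter.Eventually.of_forall fun v h' => absurd h h'
    · have hval : (lam u p - lam u q) - (lam u j - lam u k) ≠ (0:ℝ) := by
        rw [heq, sub_self, sub_zero]; exact sub_ne_zero.2 h
      have := (((hlamc p).sub (hlamc q)).sub ((hlamc j).sub (hlamc k))).eventually_ne hval
      filter_upwards [this] with v hv _ using sub_ne_zero.1 hv
  obtain ⟨v, ⟨hv, hnear⟩, hs⟩ := (((S.iso hu).and ((S.near hu).filter_mono
    nhdsWithin_le_nhds)).and (hsep.filter_mono nhdsWithin_le_nhds)).exists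
  obtain ⟨g, hg, V, dv, du⟩ := hnear
  obtain ⟨w, hw⟩ := S.coupling hm hjk hcon hsim du
  have hgu := Kset_unitary S.fam_herm g hg
  have hsm := hv.strictMono
  have hjltk : j < k := by rw [Fin.lt_def]; omega
  have hel := extract_elem (L := Lsp (famH U H0 Hc)) (fun X hX Y hY => Lsp_bracket S.fam_herm hX hY)
    dv (Lsp_conj hg (mem_Lsp ⟨v, hv.1, rfl⟩)) (S.linHam_mem w) hw (by
      intro p q hpq
      have hlt := hsm hjltk
      by_cases h : lam u p = lam u q
      · by_cases hpq' : p = q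
        · subst hpq'; intro h'; rw [sub_self] at h'; linarith
        have hp : p = j ∨ p = k := by
          by_contra h'; push Not at h'
          exact hpq' (hsim p h'.1 h'.2 q h.symm).symm
        have hq : q = j ∨ q = k := by
          by_contra h'; push Not at h'
          exact hpq' (hsim q h'.1 h'.2 p h)
        rcases hp with rfl | rfl <;> rcases hq with rfl | rfl
        · exact absurd rfl hpq'
        · exact absurd rfl hpq
        · intro h'; linarith
        · exact absurd rfl hpq'
      · exact hs p q h)
  refine ⟨v, hv, star g * V, dv.conj hgu, ?_⟩
  have h2 := Lsp_conj (Kset_star S.fam_herm hg) hel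
  convert h2 using 1
  rw [star_mul]; simp only [Matrix.mul_assoc]

theorem Setup.elem_all {n m : ℕ} (hm : 2 ≤ m) {U : Set (EuclideanSpace ℝ (Fin m))}
    {H0 : Matrix (Fin n) (Fin n) ℂ} {Hc : Fin m → Matrix (Fin n) (Fin n) ℂ}
    {lam : EuclideanSpace ℝ (Fin m) → Fin n → ℝ} {C : ℝ} (S : Setup U H0 Hc lam C)
    {j k : Fin n} (hjk : (j : ℕ) + 1 = (k : ℕ)) {v : EuclideanSpace ℝ (Fin m)}
    (hv : GoodPt U lam v) :
    HasElem (Lsp (famH U H0 Hc)) j k (controlHam H0 Hc v) (lam v) := by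
  have hfin : 1 < Module.rank ℝ (EuclideanSpace ℝ (Fin m)) :=
    Module.one_lt_rank_of_one_lt_finrank (by simp; omega)
  obtain ⟨u, hu, hel⟩ := S.elem_exists hm hjk
  exact const_of_isolated hfin S.conn.isPreconnected (fun u h => h.1) (fun u h => S.iso h)
    (P := fun v => HasElem (Lsp (famH U H0 Hc)) j k (controlHam H0 Hc v) (lam v))
    (fun u hu => S.elem_loc j k hu) u v hu hv hel

/-- A bracket-closed, star-closed space with consecutive elementary matrices and a
matrix of nonzero trace is everything. -/
theorem span_top_of_elem {n : ℕ} {L : Submodule ℂ (Matrix (Fin n) (Fin n) ℂ)}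
    (hL : ∀ X ∈ L, ∀ Y ∈ L, X * Y - Y * X ∈ L) (hLs : ∀ X ∈ L, star X ∈ L)
    (hel : ∀ j k : Fin n, (j : ℕ) + 1 = (k : ℕ) → Matrix.single j k 1 ∈ L)
    {T : Matrix (Fin n) (Fin n) ℂ} (hT : T ∈ L) (htr : T.trace ≠ 0) (hn : 2 ≤ n) : L = ⊤ := by
  have hup : ∀ d : ℕ, ∀ j k : Fin n, (j : ℕ) + (d + 1) = (k : ℕ) → Matrix.single j k 1 ∈ L := by
    intro d
    induction d with
    | zero => intro j k h; exact hel j k (by omega)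
    | succ d ih =>
      intro j k h
      have hl : (j : ℕ) + 1 < n := by have := k.2; omega
      set l : Fin n := ⟨(j : ℕ) + 1, hl⟩ with hldef
      have h1 := hel j l rfl
      have h2 := ih l k (by simp [hldef]; omega)
      have h3 := hL _ h1 _ h2
      have hkj : k ≠ j := by intro h'; rw [h'] at h; omega
      rw [Matrix.single_mul_single_same, Matrix.single_mul_single_of_ne _ _ _ _ hkj] at h3
      simpa using h3
  have hoff : ∀ j k : Fin n, j ≠ k → Matrix.single j k (1:ℂ) ∈ L := by
    intro j k hjk
    rcases lt_or_gt_of_ne hjk with h | h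
    · rw [Fin.lt_def] at h
      exact hup ((k : ℕ) - j - 1) j k (by omega)
    · rw [Fin.lt_def] at h
      have := hLs _ (hup ((j : ℕ) - k - 1) k j (by omega))
      rw [Matrix.star_eq_conjTranspose, Matrix.conjTranspose_single, star_one] at this
      exact this
  have hdiff : ∀ j k : Fin n, Matrix.single j j (1:ℂ) - Matrix.single k k 1 ∈ L := by
    intro j k
    by_cases hjk : j = k
    · rw [hjk, sub_self]; exact zero_mem _
    · have := hL _ (hoff j k hjk) _ (hoff k j (Ne.symm hjk))
      rw [Matrix.single_mul_single_same, Matrix.single_mul_single_same] at this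
      simpa using this
  have i0 : Fin n := ⟨0, by omega⟩
  -- write `T` as trace times an elementary matrix modulo `L`
  have hdec : ∀ M : Matrix (Fin n) (Fin n) ℂ, M - M.trace • Matrix.single i0 i0 1 ∈ L := by
    intro M
    have : M - M.trace • Matrix.single i0 i0 1 =
        ∑ p, ∑ q, (M p q) • (Matrix.single p q 1 - if p = q then Matrix.single i0 i0 1 else 0) := by
      simp only [smul_sub, Finset.sum_sub_distrib]
      congr 1
      · nth_rewrite 1 [Matrix.matrix_eq_sum_single M]
        simp
      · simp [Matrix.trace, Finset.sum_smul]
    rw [this]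
    refine Submodule.sum_mem _ fun p _ => Submodule.sum_mem _ fun q _ => Submodule.smul_mem _ _ ?_
    split_ifs with h
    · subst h; exact hdiff _ _
    · rw [sub_zero]; exact hoff _ _ h
  have hi0 : Matrix.single i0 i0 (1:ℂ) ∈ L := by
    have h1 := sub_mem hT (hdec T)
    rw [sub_sub_cancel] at h1
    have h2 := Submodule.smul_mem L (T.trace)⁻¹ h1
    rwa [smul_smul, inv_mul_cancel₀ htr, one_smul] at h2
  rw [eq_top_iff]
  intro M _
  have := add_mem (hdec M) (Submodule.smul_mem L M.trace hi0)
  rwa [sub_add_cancel] at this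

theorem Setup.Lsp_top {n m : ℕ} (hn : 2 ≤ n) (hm : 2 ≤ m) {U : Set (EuclideanSpace ℝ (Fin m))}
    {H0 : Matrix (Fin n) (Fin n) ℂ} {Hc : Fin m → Matrix (Fin n) (Fin n) ℂ}
    {lam : EuclideanSpace ℝ (Fin m) → Fin n → ℝ} {C : ℝ} (S : Setup U H0 Hc lam C)
    (htr : ∃ u ∈ U, (controlHam H0 Hc u).trace ≠ 0) : Lsp (famH U H0 Hc) = ⊤ := by
  set L := Lsp (famH U H0 Hc) with hLdef
  obtain ⟨u0, hu0, htr0⟩ := htr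
  obtain ⟨v, hv, -⟩ := S.elem_exists hm (j := ⟨0, by omega⟩) (k := ⟨1, by omega⟩) rfl
  obtain ⟨V, dV⟩ := S.diag hv.1
  let e : Matrix (Fin n) (Fin n) ℂ →ₗ[ℂ] Matrix (Fin n) (Fin n) ℂ :=
    { toFun := fun X => V * X * star V
      map_add' := by intro x y; rw [Matrix.mul_add, Matrix.add_mul]
      map_smul' := by intro c x; rw [Matrix.mul_smul, Matrix.smul_mul]; rfl }
  have he : ∀ X, e X = V * X * star V := fun X => rfl
  have hmul : ∀ X Y, e (X * Y) = e X * e Y := by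
    intro X Y
    rw [he, he, he]
    calc V * (X * Y) * star V = V * X * (star V * V) * Y * star V := by
          rw [uni_star_mul dV.1, Matrix.mul_one]; simp only [Matrix.mul_assoc]
      _ = _ := by simp only [Matrix.mul_assoc]
  have htop : L.comap e = ⊤ := by
    refine span_top_of_elem (T := star V * controlHam H0 Hc u0 * V) ?_ ?_ ?_ ?_ ?_ hn
    · intro X hX Y hY
      rw [Submodule.mem_comap] at *
      rw [map_sub, hmul, hmul]
      exact Lsp_bracket S.fam_herm hX hY
    · intro X hX
      rw [Submodule.mem_comap] at *
      have := Lsp_star S.fam_herm hX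
      rw [he] at this ⊢
      rw [star_mul, star_mul, star_star] at this
      simpa only [Matrix.mul_assoc] using this
    · intro j k hjk
      obtain ⟨W, dW, hW⟩ := S.elem_all hm hjk hv
      exact elem_unique hv.strictMono.injective dW dV hW
    · rw [Submodule.mem_comap, he, conj_star_conj dV.1]
      exact mem_Lsp ⟨u0, hu0, rfl⟩
    · rw [trace_conj dV.1]; exact htr0
  rw [eq_top_iff]
  intro X _
  have : star V * X * V ∈ L.comap e := by rw [htop]; trivial
  rw [Submodule.mem_comap, he, conj_star_conj dV.1] at this
  exact this

theorem strict_step {𝔸 : Type*} [NormedRing 𝔸] [NormedAlgebra ℝ 𝔸] {d : ℕ}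
    {f : (Fin d → ℝ) → 𝔸} {f' : (Fin d → ℝ) →L[ℝ] 𝔸} (hf : HasStrictFDerivAt f f' 0) (k : 𝔸)
    {q : ℝ → 𝔸} {q' : 𝔸} (hq : HasStrictDerivAt q q' 1) :
    ∃ h' : (Fin (d + 1) → ℝ) →L[ℝ] 𝔸,
      HasStrictFDerivAt (fun x : Fin (d + 1) → ℝ =>
        f (fun i => x i.castSucc) * (k * q (1 + x (Fin.last d)))) h' 0 ∧
      ∀ x, h' x = f' (fun i => x i.castSucc) * (k * q 1) + f 0 * (k * (x (Fin.last d) • q')) := by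
  let π : (Fin (d + 1) → ℝ) →L[ℝ] (Fin d → ℝ) :=
    ContinuousLinearMap.pi fun i => ContinuousLinearMap.proj i.castSucc
  let l : (Fin (d + 1) → ℝ) →L[ℝ] ℝ := ContinuousLinearMap.proj (Fin.last d)
  have hf0 : HasStrictFDerivAt f f' (π 0) := by rw [map_zero]; exact hf
  have h1 : HasStrictFDerivAt (fun x => f (π x)) (f'.comp π) 0 :=
    HasStrictFDerivAt.comp 0 hf0 π.hasStrictFDerivAt
  have hl : HasStrictFDerivAt (fun x => 1 + l x) l 0 := l.hasStrictFDerivAt.const_add 1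
  have hq0 : HasStrictFDerivAt q (ContinuousLinearMap.toSpanSingleton ℝ q') (1 + l 0) := by
    rw [map_zero, add_zero]; exact hq.hasStrictFDerivAt
  have h2 : HasStrictFDerivAt (fun x => q (1 + l x))
      ((ContinuousLinearMap.toSpanSingleton ℝ q').comp l) 0 :=
    HasStrictFDerivAt.comp 0 hq0 hl
  have h3 := h1.mul' (HasStrictFDerivAt.const_mul h2 k)
  refine ⟨_, h3, fun x => ?_⟩
  simp [π, l, ContinuousLinearMap.toSpanSingleton]
  rw [add_comm]
  rfl

theorem strict_final {𝔸 : Type*} [NormedRing 𝔸] [NormedAlgebra ℝ 𝔸] [CompleteSpace 𝔸]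
    {d : ℕ}
    {f : (Fin d → ℝ) → 𝔸} {f' : (Fin d → ℝ) →L[ℝ] 𝔸} (hf : HasStrictFDerivAt f f' 0)
    (s : 𝔸 →L[ℝ] 𝔸) (hs : ∀ Y, ∃ x Q, f' x + s Q * f 0 = Y) :
    Filter.map (fun p : (Fin d → ℝ) × 𝔸 => (1 + s p.2) * f p.1) (nhds (0, 0)) = nhds (f 0) := by
  have h1 : HasStrictFDerivAt (fun p : (Fin d → ℝ) × 𝔸 => f p.1)
      (f'.comp (ContinuousLinearMap.fst ℝ _ _)) (0, 0) :=
    HasStrictFDerivAt.comp (0, 0) hf hasStrictFDerivAt_fst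
  have h2 : HasStrictFDerivAt (fun p : (Fin d → ℝ) × 𝔸 => 1 + s p.2)
      (s.comp (ContinuousLinearMap.snd ℝ _ _)) (0, 0) :=
    (s.comp (ContinuousLinearMap.snd ℝ (Fin d → ℝ) 𝔸)).hasStrictFDerivAt.const_add 1
  have h3 := h2.mul' h1
  have h4 := h3.map_nhds_eq_of_surj (by
    rw [LinearMap.range_eq_top]
    intro Y
    obtain ⟨x, Q, h⟩ := hs Y
    refine ⟨(x, Q), ?_⟩
    rw [← h]
    simp)
  simpa [Pi.mul_def] using h4

theorem herm_real_span {n : ℕ} {F : Set (Matrix (Fin n) (Fin n) ℂ)}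
    (hF : ∀ G ∈ F, G.IsHermitian) (hL : Lsp F = ⊤) {X : Matrix (Fin n) (Fin n) ℂ}
    (hX : X.IsHermitian) : X ∈ Submodule.span ℝ (cgens F) := by
  have hspanH : ∀ Y ∈ Submodule.span ℝ (cgens F), star Y = Y := by
    intro Y hY
    induction hY using Submodule.span_induction with
    | mem x h => exact cgens_herm hF x h
    | zero => simp
    | add x y _ _ hx hy => rw [star_add, hx, hy]
    | smul a x _ hx => rw [star_smul, hx]; simp
  have hdec : ∀ Y ∈ Submodule.span ℂ (cgens F), ∃ r ∈ Submodule.span ℝ (cgens F),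
      ∃ s ∈ Submodule.span ℝ (cgens F), Y = r + Complex.I • s := by
    intro Y hY
    induction hY using Submodule.span_induction with
    | mem x h => exact ⟨x, Submodule.subset_span h, 0, zero_mem _, by simp⟩
    | zero => exact ⟨0, zero_mem _, 0, zero_mem _, by simp⟩
    | add x y _ _ hx hy =>
      obtain ⟨r, hr, s, hs, rfl⟩ := hx
      obtain ⟨r', hr', s', hs', rfl⟩ := hy
      exact ⟨r + r', add_mem hr hr', s + s', add_mem hs hs', by rw [smul_add]; abel⟩
    | smul a x _ hx =>
      obtain ⟨r, hr, s, hs, rfl⟩ := hx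
      refine ⟨a.re • r - a.im • s, sub_mem (Submodule.smul_mem _ _ hr) (Submodule.smul_mem _ _ hs),
        a.im • r + a.re • s, add_mem (Submodule.smul_mem _ _ hr) (Submodule.smul_mem _ _ hs), ?_⟩
      ext i j
      apply Complex.ext <;> simp <;> ring
  obtain ⟨r, hr, s, hs, h⟩ := hdec X (by
    have : X ∈ Lsp F := by rw [hL]; trivial
    exact this)
  have h2 : star X = r - Complex.I • s := by
    rw [h, star_add, star_smul, hspanH r hr, hspanH s hs]; simp [sub_eq_add_neg]
  have h3 : X = r := by
    have hX' : star X = X := hX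
    have : (2:ℂ) • X = (2:ℂ) • r := by
      rw [two_smul]; nth_rewrite 1 [← hX']
      rw [h2, h, two_smul]; abel
    exact smul_right_injective _ (two_ne_zero) this
  rw [h3]; exact hr

section
open scoped Matrix.Norms.L2Operator

/-- A subspace of directions realised by a parametrised family in the semigroup. -/
def DirSp {n : ℕ} (F : Set (Matrix (Fin n) (Fin n) ℂ))
    (W : Submodule ℝ (Matrix (Fin n) (Fin n) ℂ)) : Prop :=
  ∃ (d : ℕ) (f : (Fin d → ℝ) → Matrix (Fin n) (Fin n) ℂ)
    (f' : (Fin d → ℝ) →L[ℝ] Matrix (Fin n) (Fin n) ℂ),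
    HasStrictFDerivAt f f' 0 ∧ (∀ᶠ x in nhds 0, f x ∈ semi F) ∧
    ∀ X ∈ W, ∃ x, f' x = (-Complex.I) • (X * f 0)

theorem DirSp.bot {n : ℕ} (F : Set (Matrix (Fin n) (Fin n) ℂ)) : DirSp F ⊥ := by
  refine ⟨0, fun _ => 1, 0, hasStrictFDerivAt_const _ _,
    Filter.Eventually.of_forall fun _ => one_mem _, fun X hX => ⟨0, ?_⟩⟩
  rw [Submodule.mem_bot] at hX
  simp [hX]

theorem DirSp.step {n : ℕ} {F : Set (Matrix (Fin n) (Fin n) ℂ)} (hF : ∀ G ∈ F, G.IsHermitian)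
    (hL : Lsp F = ⊤) {W : Submodule ℝ (Matrix (Fin n) (Fin n) ℂ)} (hW : DirSp F W)
    {X : Matrix (Fin n) (Fin n) ℂ} (hX : X.IsHermitian) (hXW : X ∉ W) :
    ∃ W', W < W' ∧ DirSp F W' := by
  obtain ⟨d, f, f', hf, hfs, hdir⟩ := hW
  have hf0 : f 0 ∈ semi F := hfs.self_of_nhds
  have hf0u := semi_unitary hF hf0
  have hex : ∃ k ∈ semi F, ∃ G ∈ F, (f 0 * k) * G * star (f 0 * k) ∉ W := by
    by_contra hcon
    push Not at hcon
    apply hXW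
    have hall : ∀ Y ∈ Submodule.span ℝ (cgens F), f 0 * Y * star (f 0) ∈ W := by
      intro Y hY
      induction hY using Submodule.span_induction with
      | mem x h =>
        obtain ⟨k, hk, G, hG, rfl⟩ := h
        have := hcon k hk G hG
        rw [star_mul] at this
        simpa only [Matrix.mul_assoc] using this
      | zero => simp
      | add x y _ _ hx hy => rw [Matrix.mul_add, Matrix.add_mul]; exact add_mem hx hy
      | smul a x _ hx => rw [Matrix.mul_smul, Matrix.smul_mul]; exact W.smul_mem _ hx
    have h1 : (star (f 0) * X * f 0).IsHermitian := Matrix.isHermitian_conjTranspose_mul_mul _ hX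
    have h2 := hall _ (herm_real_span hF hL h1)
    rwa [conj_star_conj hf0u] at h2
  obtain ⟨k, hk, G, hG, hGW⟩ := hex
  set Y := (f 0 * k) * G * star (f 0 * k) with hY
  refine ⟨W ⊔ Submodule.span ℝ {Y}, ?_, d + 1, ?_⟩
  · refine lt_of_le_of_ne le_sup_left fun h => hGW ?_
    rw [h]
    exact Submodule.mem_sup_right (Submodule.mem_span_singleton_self Y)
  obtain ⟨h', hh, hval⟩ := strict_step hf k (qflow_hasStrictDerivAt G 1)
  refine ⟨_, h', hh, ?_, ?_⟩
  · have hc : Filter.Tendsto (fun x : Fin (d + 1) → ℝ => (fun i : Fin d => x i.castSucc))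
        (nhds 0) (nhds 0) := by
      have : Continuous (fun x : Fin (d + 1) → ℝ => (fun i : Fin d => x i.castSucc)) := by fun_prop
      exact this.tendsto 0
    have hpos : ∀ᶠ x : Fin (d + 1) → ℝ in nhds 0, 0 < 1 + x (Fin.last d) := by
      have : Continuous (fun x : Fin (d + 1) → ℝ => 1 + x (Fin.last d)) := by fun_prop
      exact continuousAt_const.eventually_lt this.continuousAt (by simp)
    filter_upwards [hc.eventually hfs, hpos] with x hx hx'
    exact mul_mem hx (mul_mem hk (Submonoid.subset_closure ⟨G, hG, _, hx'.le, rfl⟩))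
  · intro Z hZ
    obtain ⟨A, hA, B, hB, rfl⟩ := Submodule.mem_sup.1 hZ
    obtain ⟨b, rfl⟩ := Submodule.mem_span_singleton.1 hB
    obtain ⟨x, hx⟩ := hdir A hA
    refine ⟨Fin.snoc x b, ?_⟩
    rw [hval]
    have e1 : (fun i : Fin d => (Fin.snoc x b : Fin (d + 1) → ℝ) i.castSucc) = x := by
      funext i; simp
    have e2 : (Fin.snoc x b : Fin (d + 1) → ℝ) (Fin.last d) = b := by simp
    have e3 : (fun i : Fin d => (0 : Fin (d + 1) → ℝ) i.castSucc) = 0 := rfl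
    rw [e1, e2, hx, e3, Pi.zero_apply, add_zero, Matrix.add_mul, smul_add]
    have hfk : star (f 0 * k) * (f 0 * k) = 1 := uni_star_mul (semi_unitary hF (mul_mem hf0 hk))
    have e4 : Y * (f 0 * (k * qflow G 1)) = f 0 * k * G * qflow G 1 := by
      rw [hY]
      calc (f 0 * k) * G * star (f 0 * k) * (f 0 * (k * qflow G 1))
            = (f 0 * k) * G * (star (f 0 * k) * (f 0 * k)) * qflow G 1 := by
              simp only [Matrix.mul_assoc]
        _ = _ := by rw [hfk, Matrix.mul_one]
    congr 1
    · rw [Matrix.smul_mul, Matrix.mul_assoc]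
    · rw [Matrix.smul_mul b, e4]
      simp only [Matrix.mul_smul, Matrix.smul_mul, Matrix.mul_assoc]
      rw [smul_comm]

theorem DirSp.full {n : ℕ} {F : Set (Matrix (Fin n) (Fin n) ℂ)} (hF : ∀ G ∈ F, G.IsHermitian)
    (hL : Lsp F = ⊤) : ∃ W, DirSp F W ∧ ∀ X : Matrix (Fin n) (Fin n) ℂ, X.IsHermitian → X ∈ W := by
  obtain ⟨W, hW, hmax⟩ := WellFounded.has_min
    (wellFounded_gt (α := Submodule ℝ (Matrix (Fin n) (Fin n) ℂ))) {W | DirSp F W}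
    ⟨⊥, DirSp.bot F⟩
  refine ⟨W, hW, fun X hX => ?_⟩
  by_contra h
  obtain ⟨W', hlt, hW'⟩ := DirSp.step hF hL hW hX h
  exact hmax W' hW' hlt

theorem semi_interior {n : ℕ} {F : Set (Matrix (Fin n) (Fin n) ℂ)} (hF : ∀ G ∈ F, G.IsHermitian)
    (hL : Lsp F = ⊤) : ∃ o ∈ semi F, ∀ᶠ g in nhds o,
      g ∈ Matrix.unitaryGroup (Fin n) ℂ → g ∈ semi F := by
  obtain ⟨W, ⟨d, f, f', hf, hfs, hdir⟩, hfull⟩ := DirSp.full hF hL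
  have hf0 : f 0 ∈ semi F := hfs.self_of_nhds
  have hf0u := semi_unitary hF hf0
  refine ⟨f 0, hf0, ?_⟩
  let s0 : Matrix (Fin n) (Fin n) ℂ →ₗ[ℝ] Matrix (Fin n) (Fin n) ℂ :=
    { toFun := fun Q => Q + star Q
      map_add' := by intro x y; rw [star_add]; abel
      map_smul' := by intro t x; rw [star_smul]; simp }
  let s := LinearMap.toContinuousLinearMap s0
  have hsv : ∀ Q, s Q = Q + star Q := fun Q => rfl
  have hmap := strict_final hf s (by
    intro Y
    set Z := Y * star (f 0) with hZ
    have hX : (((1/2:ℂ) * Complex.I) • (Z - star Z)).IsHermitian := by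
      change star _ = _
      rw [star_smul, star_sub, star_star]
      have : star ((1/2:ℂ) * Complex.I) = -((1/2:ℂ) * Complex.I) := by
        apply Complex.ext <;> simp
      rw [this, neg_smul, ← smul_neg, neg_sub]
    obtain ⟨x, hx⟩ := hdir _ (hfull _ hX)
    refine ⟨x, (1/4:ℂ) • (Z + star Z), ?_⟩
    rw [hx, hsv, ← Matrix.smul_mul, ← Matrix.add_mul]
    have : (-Complex.I) • ((1/2:ℂ) * Complex.I) • (Z - star Z) +
        ((1/4:ℂ) • (Z + star Z) + star ((1/4:ℂ) • (Z + star Z))) = Z := by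
      rw [star_smul, star_add, star_star, smul_smul]
      have e1 : -Complex.I * ((1/2:ℂ) * Complex.I) = 1/2 := by
        linear_combination (-1/2) * Complex.I_mul_I
      have e2 : star (1/4:ℂ) = 1/4 := by apply Complex.ext <;> simp
      rw [e1, e2]
      module
    rw [this, hZ, Matrix.mul_assoc, uni_star_mul hf0u, Matrix.mul_one])
  rw [← hmap, Filter.eventually_map]
  have h1 : ∀ᶠ p : (Fin d → ℝ) × Matrix (Fin n) (Fin n) ℂ in nhds (0, 0), f p.1 ∈ semi F :=
    (continuous_fst.tendsto ((0 : Fin d → ℝ), (0 : Matrix (Fin n) (Fin n) ℂ))).eventually hfs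
  have h2 : ∀ᶠ p : (Fin d → ℝ) × Matrix (Fin n) (Fin n) ℂ in nhds (0, 0), ‖s p.2‖ < 1 := by
    have : Continuous fun p : (Fin d → ℝ) × Matrix (Fin n) (Fin n) ℂ => ‖s p.2‖ :=
      (s.continuous.comp continuous_snd).norm
    exact this.continuousAt.eventually_lt continuousAt_const (by simp)
  filter_upwards [h1, h2] with p hp1 hp2 hg
  set P := s p.2 with hP
  have hPs : star P = P := by rw [hP, hsv, star_add, star_star, add_comm]
  have hfu := semi_unitary hF hp1
  have hu : 1 + P ∈ Matrix.unitaryGroup (Fin n) ℂ := by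
    have := mul_mem hg (uni_star_mem hfu)
    rwa [Matrix.mul_assoc, uni_mul_star hfu, Matrix.mul_one] at this
  have hsq := uni_mul_star hu
  rw [star_add, star_one, hPs] at hsq
  have hPP : (2:ℝ) • P = -(P * P) := by
    have : (1 + P) * (1 + P) = 1 + ((2:ℝ) • P + P * P) := by
      rw [two_smul]; noncomm_ring
    rw [this] at hsq
    rw [eq_neg_iff_add_eq_zero]
    exact add_eq_left.1 hsq
  have hn : 2 * ‖P‖ ≤ ‖P‖ * ‖P‖ := by
    calc 2 * ‖P‖ = ‖(2:ℝ) • P‖ := by rw [norm_smul]; simp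
      _ = ‖P * P‖ := by rw [hPP, norm_neg]
      _ ≤ _ := norm_mul_le _ _
  have hP0 : P = 0 := by
    rw [← norm_eq_zero]
    nlinarith [norm_nonneg P]
  rw [hP0, add_zero, Matrix.one_mul]
  exact hp1
end

theorem qflow_diagonal {n : ℕ} (θ : Fin n → ℝ) :
    qflow (Matrix.diagonal (fun k => ((θ k : ℝ) : ℂ))) 1 =
      Matrix.diagonal (fun k => Complex.exp (-Complex.I * (θ k : ℂ))) := by
  unfold qflow
  rw [one_smul, ← Matrix.diagonal_smul, Matrix.exp_diagonal]
  congr 1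
  funext k
  rw [Pi.coe_exp]
  simp [Complex.exp_eq_exp_ℂ]

theorem unitary_exists_log {n : ℕ} {g : Matrix (Fin n) (Fin n) ℂ}
    (hg : g ∈ Matrix.unitaryGroup (Fin n) ℂ) : ∃ A : Matrix (Fin n) (Fin n) ℂ,
      A.IsHermitian ∧ g = qflow A 1 := by
  have h1 := uni_mul_star hg
  have h2 := uni_star_mul hg
  have hRh : (g + star g).IsHermitian := by
    change star _ = _
    rw [star_add, star_star, add_comm]
  have hSh : (Complex.I • (g - star g)).IsHermitian := by
    change star _ = _
    rw [star_smul, star_sub, star_star]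
    simp only [Complex.star_def, Complex.conj_I, neg_smul, ← smul_neg, neg_sub]
  have hcomm : (g + star g) * (Complex.I • (g - star g)) =
      (Complex.I • (g - star g)) * (g + star g) := by
    rw [Matrix.mul_smul, Matrix.smul_mul]
    congr 1
    simp only [Matrix.add_mul, Matrix.mul_sub, Matrix.sub_mul, Matrix.mul_add, h1, h2]
    abel
  obtain ⟨V, a, b, dA, dB, -⟩ := joint_diag hRh hSh hcomm
  have hV := dA.1
  set D : Matrix (Fin n) (Fin n) ℂ := Matrix.diagonal (fun k =>
    (1/2:ℂ) * (a k : ℂ) - (1/2:ℂ) * Complex.I * (b k : ℂ)) with hD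
  have hgD : star V * g * V = D := by
    have e : g = (1/2:ℂ) • (g + star g) - ((1/2:ℂ) * Complex.I) • (Complex.I • (g - star g)) := by
      rw [smul_smul]
      have : (1/2:ℂ) * Complex.I * Complex.I = -(1/2) := by
        linear_combination (1/2:ℂ) * Complex.I_mul_I
      rw [this]; module
    rw [e, Matrix.mul_sub, Matrix.sub_mul, Matrix.mul_smul, Matrix.smul_mul, Matrix.mul_smul,
      Matrix.smul_mul, dA.2, dB.2, hD]
    ext i j
    by_cases hij : i = j
    · subst hij; simp
    · simp [hij]
  have hDu : D ∈ Matrix.unitaryGroup (Fin n) ℂ := by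
    rw [← hgD]; exact mul_mem (mul_mem (uni_star_mem hV) hg) hV
  have hnorm : ∀ k, ‖D k k‖ = 1 := by
    intro k
    have h := congrFun (congrFun (uni_mul_star hDu) k) k
    rw [hD, Matrix.star_eq_conjTranspose, Matrix.diagonal_conjTranspose,
      Matrix.diagonal_mul_diagonal, Matrix.diagonal_apply_eq, Matrix.one_apply_eq] at h
    rw [hD, Matrix.diagonal_apply_eq]
    rw [Pi.star_apply, Complex.star_def, Complex.mul_conj, Complex.normSq_eq_norm_sq] at h
    have h' : ‖(1/2:ℂ) * (a k : ℂ) - (1/2:ℂ) * Complex.I * (b k : ℂ)‖ ^ 2 = 1 := by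
      exact_mod_cast h
    exact (pow_eq_one_iff_of_nonneg (norm_nonneg _) two_ne_zero).1 h'
  set θ : Fin n → ℝ := fun k => - Complex.arg (D k k) with hθ
  set T : Matrix (Fin n) (Fin n) ℂ := Matrix.diagonal (fun k => ((θ k : ℝ) : ℂ)) with hT
  have hTh : T.IsHermitian := by
    rw [hT, Matrix.isHermitian_diagonal_iff]; intro i; simp [IsSelfAdjoint]
  have hq : qflow T 1 = D := by
    rw [hT, qflow_diagonal]
    ext i j
    by_cases hij : i = j
    · subst hij
      rw [Matrix.diagonal_apply_eq]
      have := Complex.norm_mul_exp_arg_mul_I (D i i)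
      rw [hnorm, Complex.ofReal_one, one_mul] at this
      rw [← this, hθ]
      congr 1
      push_cast; ring
    · rw [Matrix.diagonal_apply_ne _ hij, hD, Matrix.diagonal_apply_ne _ hij]
  refine ⟨V * T * star V, Matrix.isHermitian_mul_mul_conjTranspose V hTh, ?_⟩
  rw [qflow_conj hV, hq, ← hgD, conj_star_conj hV]

theorem qflow_pow {n : ℕ} (G : Matrix (Fin n) (Fin n) ℂ) (t : ℝ) (N : ℕ) :
    qflow G (N * t) = qflow G t ^ N := by
  induction N with
  | zero => simp [qflow_zero]
  | succ N ih => rw [Nat.cast_succ, add_mul, one_mul, qflow_add, ih, pow_succ]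

theorem semi_all {n : ℕ} {F : Set (Matrix (Fin n) (Fin n) ℂ)} (hF : ∀ G ∈ F, G.IsHermitian)
    (hL : Lsp F = ⊤) {g : Matrix (Fin n) (Fin n) ℂ} (hg : g ∈ Matrix.unitaryGroup (Fin n) ℂ) :
    g ∈ semi F := by
  obtain ⟨o, ho, hev⟩ := semi_interior hF hL
  have hou := semi_unitary hF ho
  have hev1 : ∀ᶠ h in nhds (1 : Matrix (Fin n) (Fin n) ℂ),
      h ∈ Matrix.unitaryGroup (Fin n) ℂ → h ∈ Kset F := by
    have hc : Filter.Tendsto (fun h : Matrix (Fin n) (Fin n) ℂ => h * o) (nhds 1) (nhds o) := by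
      have : Continuous (fun h : Matrix (Fin n) (Fin n) ℂ => h * o) :=
        continuous_id.matrix_mul continuous_const
      simpa using this.tendsto 1
    filter_upwards [hc.eventually hev] with h hh hu
    have h1 := Kset_mul (semi_subset_Kset (hh (mul_mem hu hou)))
      (Kset_star hF (semi_subset_Kset ho))
    rwa [Matrix.mul_assoc, uni_mul_star hou, Matrix.mul_one] at h1
  have hK : ∀ h ∈ Matrix.unitaryGroup (Fin n) ℂ, h ∈ Kset F := by
    intro h hh
    obtain ⟨A, hA, rfl⟩ := unitary_exists_log hh
    have ht : Filter.Tendsto (fun N : ℕ => qflow A (1 / ((N : ℝ) + 1))) Filter.atTop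
        (nhds 1) := by
      have h0 := (qflow_continuous A).tendsto 0
      rw [qflow_zero] at h0
      exact h0.comp tendsto_one_div_add_atTop_nhds_zero_nat
    obtain ⟨N, hN⟩ := (ht.eventually hev1).exists
    have h1 := hN (qflow_mem hA _)
    have h2 : ∀ k : ℕ, qflow A (1 / ((N : ℝ) + 1)) ^ k ∈ Kset F := by
      intro k
      induction k with
      | zero => rw [pow_zero]; exact semi_subset_Kset (one_mem _)
      | succ k ih => rw [pow_succ]; exact Kset_mul ih h1
    have h3 := h2 (N + 1)
    rw [← qflow_pow] at h3
    have : ((N + 1 : ℕ) : ℝ) * (1 / ((N : ℝ) + 1)) = 1 := by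
      push_cast; field_simp
    rwa [this] at h3
  -- now exactness
  have hgo : g * star o ∈ Kset F := hK _ (mul_mem hg (uni_star_mem hou))
  have hc : Filter.Tendsto (fun h : Matrix (Fin n) (Fin n) ℂ => star h * g) (nhds (g * star o))
      (nhds o) := by
    have : Continuous (fun h : Matrix (Fin n) (Fin n) ℂ => star h * g) :=
      continuous_id.matrix_conjTranspose.matrix_mul continuous_const
    have h1 := this.tendsto (g * star o)
    rwa [star_mul, star_star, Matrix.mul_assoc, uni_star_mul hg, Matrix.mul_one] at h1
  obtain ⟨h, h1, h2⟩ := mem_closure_iff_nhds.1 hgo _ (hc.eventually hev)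
  have hhu := semi_unitary hF h2
  have h3 : star h * g ∈ semi F := h1 (mul_mem (uni_star_mem hhu) hg)
  have h4 := mul_mem h2 h3
  rwa [← Matrix.mul_assoc, uni_mul_star hhu, Matrix.one_mul] at h4

theorem semi_reach {n m : ℕ} {U : Set (EuclideanSpace ℝ (Fin m))} (hU : U.Nonempty)
    {H0 : Matrix (Fin n) (Fin n) ℂ} {Hc : Fin m → Matrix (Fin n) (Fin n) ℂ}
    (hF : ∀ G ∈ famH U H0 Hc, G.IsHermitian)
    {g0 : Matrix (Fin n) (Fin n) ℂ} (hg0 : g0 ∈ Matrix.unitaryGroup (Fin n) ℂ)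
    {k : Matrix (Fin n) (Fin n) ℂ} (hk : k ∈ semi (famH U H0 Hc)) :
    k * g0 ∈ liftedReachable U (controlHam H0 Hc) g0 := by
  unfold semi at hk
  induction hk using Submonoid.closure_induction_left with
  | one => rw [Matrix.one_mul]; exact reach_self U hU _ hg0
  | mul_left x hx y hy ih =>
    obtain ⟨G, hG, t, ht, rfl⟩ := hx
    have hGh := hF G hG
    obtain ⟨v, hv, rfl⟩ := hG
    rw [Matrix.mul_assoc]
    exact reach_step U (controlHam H0 Hc) ih hv hGh ht

/-- from Theorem 2.8 of the paper. If the spectrum of the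
control-affine Hamiltonian `H(·)` is conically connected and `H(u)` has nonzero trace
for some `u ∈ U`, then the lifted system `i·ġ = H(u)·g` is exactly controllable in the
unitary group `U(n)`. -/
theorem conically_connected_exact_controllability_unitary {n m : ℕ} (hn : 2 ≤ n)
    (hm : 2 ≤ m)
    (U : Set (EuclideanSpace ℝ (Fin m))) (hUopen : IsOpen U) (hUconn : IsConnected U)
    (H0 : Matrix (Fin n) (Fin n) ℂ) (Hc : Fin m → Matrix (Fin n) (Fin n) ℂ)
    (hH0 : H0.IsHermitian) (hHc : ∀ i, (Hc i).IsHermitian)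
    (lam : EuclideanSpace ℝ (Fin m) → Fin n → ℝ)
    (hlam : IsOrderedSpectrum H0 Hc U lam)
    (hcc : ConicallyConnected U lam)
    (htrace : ∃ u ∈ U, (controlHam H0 Hc u).trace ≠ 0) :
    ∀ g0 ∈ Matrix.unitaryGroup (Fin n) ℂ,
      liftedReachable U (controlHam H0 Hc) g0 =
        (Matrix.unitaryGroup (Fin n) ℂ : Set (Matrix (Fin n) (Fin n) ℂ)) := by
  obtain ⟨C, hC, hb⟩ := linHam_bound Hc
  have S : Setup U H0 Hc lam C := ⟨hUopen, hUconn, hH0, hHc, hlam, hcc, hC, hb⟩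
  have hL := S.Lsp_top hn hm htrace
  intro g0 hg0
  apply Set.Subset.antisymm
  · rintro g1 ⟨T, hT, u, g, -, hg, -, rfl⟩
    exact hg.1 T ⟨hT, le_rfl⟩
  · intro g hg
    have hk : g * star g0 ∈ semi (famH U H0 Hc) :=
      semi_all S.fam_herm hL (mul_mem hg (uni_star_mem hg0))
    have h := semi_reach hUconn.nonempty S.fam_herm hg0 hk
    rwa [Matrix.mul_assoc, uni_star_mul hg0, Matrix.mul_one] at h
end

section
/- Let n ≥ 1, let G be a connected Lie group, and let ι : G → U(n) be an injective continuous group homomorphism such that for every z in the unit sphere S^{2n−1} ⊂ ℂ^n the orbit {ι(g)·z : g ∈ G} is dense in S^{2n−1}. Then for every z ∈ S^{2n−1} the orbit {ι(g)·z : g ∈ G} equals S^{2n−1}. -/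
open scoped Manifold

namespace DenseOrbits
open Filter Topology NormedSpace
open scoped Pointwise

section Abstract
variable {A : Type*} [NormedRing A] [NormedAlgebra ℝ A] [CompleteSpace A]

lemma exp_cont : Continuous (NormedSpace.exp : A → A) := by
  let _ : NormedAlgebra ℚ A := NormedAlgebra.restrictScalars ℚ ℝ A
  exact NormedSpace.exp_continuous

lemma exp_natCast_smul (N : ℕ) (X : A) : exp ((N : ℝ) • X) = exp X ^ N := by
  let _ : NormedAlgebra ℚ A := NormedAlgebra.restrictScalars ℚ ℝ A
  rw [Nat.cast_smul_eq_nsmul, NormedSpace.exp_nsmul]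

lemma exp_neg_mul (X : A) : exp (-X) * exp X = 1 := by
  let _ : NormedAlgebra ℚ A := NormedAlgebra.restrictScalars ℚ ℝ A
  rw [← NormedSpace.exp_add_of_commute (Commute.neg_left (Commute.refl X))]; simp

lemma exp_conj_of (u v X : A) (h : u * v = 1) (h' : v * u = 1) :
    exp (u * X * v) = u * exp X * v := by
  let _ : NormedAlgebra ℚ A := NormedAlgebra.restrictScalars ℚ ℝ A
  exact NormedSpace.exp_units_conj ⟨u, v, h, h'⟩ X

/-- first order behaviour of `exp` at zero -/
lemma exp_little {α : Type*} {F : Filter α} (m : α → ℝ) (Y : α → A) (Z : A)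
    (hY : Tendsto Y F (𝓝 0)) (hZ : Tendsto (fun a => m a • Y a) F (𝓝 Z)) :
    Tendsto (fun a => m a • (exp (Y a) - 1)) F (𝓝 Z) := by
  have h1 : HasFDerivAt (exp : A → A) (1 : A →L[ℝ] A) 0 := hasFDerivAt_exp_zero
  have h2 := h1.isLittleO
  simp only [exp_zero, sub_zero, one_apply_eq_self] at h2
  have h3 := h2.comp_tendsto hY
  have h4 : (fun a => m a • (exp (Y a) - 1 - Y a)) =o[F] fun a => m a • Y a :=
    (Asymptotics.isBigO_refl m F).smul_isLittleO h3
  have h5 : Tendsto (fun a => m a • (exp (Y a) - 1 - Y a)) F (𝓝 0) :=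
    (Asymptotics.isLittleO_one_iff ℝ).1 (h4.trans_isBigO (hZ.isBigO_one ℝ))
  have h6 := h5.add hZ
  simp only [zero_add] at h6
  refine h6.congr fun a => ?_
  rw [← smul_add]; congr 1; abel

lemma pow_sub_pow_le (a b : A) (C : ℝ) (ha : ‖a‖ ≤ 1) (N : ℕ)
    (hb : ∀ j ≤ N, ‖b ^ j‖ ≤ C) (j : ℕ) (hj : j ≤ N) :
    ‖a ^ j - b ^ j‖ ≤ j * (C * ‖a - b‖) := by
  induction j with
  | zero => simp
  | succ j ih =>
    have e : a ^ (j+1) - b ^ (j+1) = a * (a ^ j - b ^ j) + (a - b) * b ^ j := by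
      rw [pow_succ', pow_succ']; noncomm_ring
    have i1 := ih (by omega)
    have i2 := hb j (by omega)
    rw [e]
    calc _ ≤ ‖a * (a ^ j - b ^ j)‖ + ‖(a - b) * b ^ j‖ := norm_add_le _ _
      _ ≤ ‖a‖ * ‖a ^ j - b ^ j‖ + ‖a - b‖ * ‖b ^ j‖ := by gcongr <;> exact norm_mul_le _ _
      _ ≤ 1 * (j * (C * ‖a - b‖)) + ‖a - b‖ * C := by gcongr
      _ = _ := by push_cast; ring

variable {G : Type*} [Group G] [TopologicalSpace G] [IsTopologicalGroup G]

/-- Directions of one-parameter subgroups lifting to `G`. -/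
def LA (ι : G →* A) : Set A :=
  {X | ∀ V ∈ 𝓝 (1 : G), ∀ᶠ t in 𝓝[>] (0 : ℝ), exp (t • X) ∈ ι '' V}

lemma exit_lemma [LocallyCompactSpace G] (ι : G →* A) (hc : Continuous ι)
    (hi : Function.Injective ι) (U : Set G) (hU : U ∈ 𝓝 (1 : G)) :
    ∃ V ∈ 𝓝 (1 : G), V ⊆ U ∧ IsCompact V ∧ ∃ δ > 0, ∀ g ∈ V, ∀ N : ℕ,
      (∀ j ≤ N, ‖ι g ^ j - 1‖ < δ) → ∀ j ≤ N, g ^ j ∈ V := by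
  obtain ⟨V, hV, hVU, hVc⟩ := local_compact_nhds hU
  refine ⟨V, hV, hVU, hVc, ?_⟩
  have hC : IsCompact ((V * V) \ interior V) := (hVc.mul hVc).diff isOpen_interior
  have hC' : IsCompact (ι '' ((V * V) \ interior V)) := hC.image hc
  have h1 : (1 : A) ∉ ι '' ((V * V) \ interior V) := by
    rintro ⟨g, ⟨_, hg⟩, h⟩
    have : g = 1 := hi (by rw [h, map_one])
    exact hg (this ▸ mem_interior_iff_mem_nhds.2 hV)
  obtain ⟨δ, hδ, hb⟩ := Metric.mem_nhds_iff.1 (hC'.isClosed.isOpen_compl.mem_nhds h1)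
  refine ⟨δ, hδ, fun g hg N hN j hj => ?_⟩
  induction j with
  | zero => simpa using mem_of_mem_nhds hV
  | succ j ih =>
    by_contra hn
    have h2 : g ^ (j+1) ∈ (V * V) \ interior V :=
      ⟨by rw [pow_succ]; exact Set.mul_mem_mul (ih (by omega)) hg,
        fun h => hn (interior_subset h)⟩
    refine hb (a := ι (g ^ (j+1))) ?_ ⟨_, h2, rfl⟩
    rw [Metric.mem_ball, dist_eq_norm, map_pow]
    exact hN _ hj

lemma exp_small [LocallyCompactSpace G] (ι : G →* A) (hc : Continuous ι)
    (hi : Function.Injective ι) (U : Set G) (hU : U ∈ 𝓝 (1 : G)) :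
    ∀ᶠ X in 𝓝 (0 : A), X ∈ LA ι → exp X ∈ ι '' U := by
  obtain ⟨V, hV, hVU, hVc, δ, hδ, h⟩ := exit_lemma ι hc hi U hU
  have h0 : Tendsto (exp : A → A) (𝓝 0) (𝓝 1) := by
    simpa using (exp_cont (A := A)).tendsto 0
  obtain ⟨r, hr, hr'⟩ := Metric.eventually_nhds_iff_ball.1 (h0.eventually (Metric.ball_mem_nhds 1 hδ))
  filter_upwards [Metric.ball_mem_nhds (0 : A) hr] with X hX hL
  have ht : Tendsto (fun N : ℕ => 1 / ((N : ℝ) + 1)) atTop (𝓝[>] 0) :=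
    tendsto_nhdsWithin_iff.2 ⟨tendsto_one_div_add_atTop_nhds_zero_nat,
      Eventually.of_forall fun N => by simp only [Set.mem_Ioi]; positivity⟩
  obtain ⟨N, g, hg, hgX⟩ := (ht.eventually (hL V hV)).exists
  have key : ∀ j : ℕ, ι g ^ j = exp (((j : ℝ) * (1 / ((N : ℝ) + 1))) • X) := by
    intro j
    rw [hgX, ← exp_natCast_smul, smul_smul]
  have h3 := h g hg (N + 1) (by
    intro j hj
    rw [key, ← dist_eq_norm]
    apply hr'
    rw [mem_ball_zero_iff] at hX ⊢
    rw [norm_smul]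
    have : ‖(j : ℝ) * (1 / ((N : ℝ) + 1))‖ ≤ 1 := by
      rw [Real.norm_of_nonneg (by positivity), mul_one_div, div_le_one (by positivity)]
      exact_mod_cast hj
    nlinarith [norm_nonneg X]) (N+1) le_rfl
  refine ⟨_, hVU h3, ?_⟩
  rw [map_pow, key]
  have : ((N + 1 : ℕ) : ℝ) * (1 / ((N : ℝ) + 1)) = 1 := by push_cast; field_simp
  rw [this, one_smul]

lemma LA_smul (ι : G →* A) (X : A) (hX : X ∈ LA ι) (c : ℝ) : c • X ∈ LA ι := by
  have pos : ∀ c : ℝ, 0 < c → ∀ X ∈ LA ι, c • X ∈ LA ι := by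
    intro c hc X hX V hV
    have ht : Tendsto (fun t : ℝ => t * c) (𝓝[>] 0) (𝓝[>] 0) := by
      refine tendsto_nhdsWithin_iff.2 ⟨?_, ?_⟩
      · have : Tendsto (fun t : ℝ => t * c) (𝓝 0) (𝓝 (0 * c)) :=
          (continuous_id.mul continuous_const).tendsto 0
        rw [zero_mul] at this
        exact this.mono_left nhdsWithin_le_nhds
      · filter_upwards [self_mem_nhdsWithin] with t ht
        exact mul_pos ht hc
    filter_upwards [ht.eventually (hX V hV)] with t ht
    rwa [smul_smul]
  have neg : ∀ X ∈ LA ι, -X ∈ LA ι := by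
    intro X hX V hV
    have : V⁻¹ ∈ 𝓝 (1 : G) := inv_mem_nhds_one G hV
    filter_upwards [hX _ this] with t ht
    obtain ⟨g, hg, h⟩ := ht
    refine ⟨g⁻¹, hg, ?_⟩
    have e1 := exp_neg_mul (t • X)
    have e2 : ι g * ι g⁻¹ = 1 := by rw [← map_mul]; simp
    rw [smul_neg]
    rw [← h] at e1
    calc ι g⁻¹ = (exp (-(t • X)) * ι g) * ι g⁻¹ := by rw [e1, one_mul]
      _ = _ := by rw [mul_assoc, e2, mul_one]
  rcases lt_trichotomy c 0 with h | h | h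
  · have := neg _ (pos (-c) (by linarith) X hX)
    simpa using this
  · subst h
    intro V hV
    refine Eventually.of_forall fun t => ⟨1, mem_of_mem_nhds hV, by simp⟩
  · exact pos c h X hX

lemma limit_lemma [LocallyCompactSpace G] (ι : G →* A) (hc : Continuous ι)
    (hi : Function.Injective ι) (hn : ∀ g, ‖ι g‖ ≤ 1)
    {α : Type*} {F : Filter α} [NeBot F] (g : α → G) (m : α → ℝ) (Y : A)
    (hg : Tendsto g F (𝓝 1)) (hm : Tendsto m F atTop)
    (hY : Tendsto (fun a => m a • (ι (g a) - 1)) F (𝓝 Y)) : Y ∈ LA ι := by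
  intro U hU
  obtain ⟨V, hV, hVU, hVc, δ, hδ, h⟩ := exit_lemma ι hc hi U hU
  have h0 : Tendsto (fun t : ℝ => exp (t • Y)) (𝓝 0) (𝓝 1) := by
    have : Continuous (fun t : ℝ => exp (t • Y)) := exp_cont.comp (by fun_prop)
    simpa using this.tendsto 0
  obtain ⟨ε, hε, hb⟩ := Metric.eventually_nhds_iff_ball.1
    (h0.eventually (Metric.ball_mem_nhds 1 (half_pos hδ)))
  set C : ℝ := ‖(1 : A)‖ + δ / 2 with hC
  have hb1 : ∀ t : ℝ, 0 ≤ t → t < ε → ‖exp (t • Y) - 1‖ < δ / 2 := by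
    intro t h1 h2
    rw [← dist_eq_norm]
    exact hb t (by rw [mem_ball_zero_iff, Real.norm_of_nonneg h1]; exact h2)
  have hb2 : ∀ t : ℝ, 0 ≤ t → t < ε → ‖exp (t • Y)‖ ≤ C := by
    intro t h1 h2
    have := hb1 t h1 h2
    have := norm_add_le (exp (t • Y) - 1) 1
    rw [sub_add_cancel] at this
    linarith
  have hm0 : Tendsto (fun a => (m a)⁻¹) F (𝓝 0) := tendsto_inv_atTop_zero.comp hm
  have hd : Tendsto (fun a => m a • (ι (g a) - exp ((m a)⁻¹ • Y))) F (𝓝 0) := by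
    have h1 : Tendsto (fun a => m a • (exp ((m a)⁻¹ • Y) - 1)) F (𝓝 Y) := by
      apply exp_little
      · simpa using hm0.smul_const Y
      · apply tendsto_const_nhds.congr'
        filter_upwards [hm.eventually_gt_atTop 0] with a ha
        rw [smul_smul, mul_inv_cancel₀ ha.ne', one_smul]
    have h2 := hY.sub h1
    rw [sub_self] at h2
    refine h2.congr fun a => ?_
    rw [← smul_sub]; congr 1; abel
  filter_upwards [Ioo_mem_nhdsGT hε] with t ht
  have ht0 : 0 < t := ht.1
  -- the uniform estimate
  have est : ∀ᶠ a in F, ∀ j ≤ ⌊t * m a⌋₊,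
      0 ≤ (j : ℝ) * (m a)⁻¹ ∧ (j : ℝ) * (m a)⁻¹ < ε ∧
      ‖ι (g a) ^ j - exp (((j : ℝ) * (m a)⁻¹) • Y)‖ ≤
        t * C * ‖m a • (ι (g a) - exp ((m a)⁻¹ • Y))‖ := by
    filter_upwards [hm.eventually_gt_atTop 0] with a ha
    have hj0 : ∀ j ≤ ⌊t * m a⌋₊, (j : ℝ) ≤ t * m a := fun j hj =>
      (Nat.le_floor_iff (by positivity)).1 hj
    have hj1 : ∀ j ≤ ⌊t * m a⌋₊, (j : ℝ) * (m a)⁻¹ < ε := fun j hj => by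
      have := hj0 j hj
      rw [← div_eq_mul_inv, div_lt_iff₀ ha]
      nlinarith [ht.2]
    intro j hj
    refine ⟨by positivity, hj1 j hj, ?_⟩
    have hp : ∀ j : ℕ, exp (((j : ℝ) * (m a)⁻¹) • Y) = exp ((m a)⁻¹ • Y) ^ j := fun j => by
      rw [← exp_natCast_smul, smul_smul]
    rw [hp]
    refine (pow_sub_pow_le _ _ C (hn _) ⌊t * m a⌋₊ (fun i hi' => ?_) j hj).trans ?_
    · rw [← hp]; exact hb2 _ (by positivity) (hj1 i hi')
    · rw [norm_smul, Real.norm_of_nonneg ha.le]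
      have := hj0 j hj
      have hC0 : 0 ≤ C := by positivity
      calc _ ≤ (t * m a) * (C * ‖ι (g a) - exp ((m a)⁻¹ • Y)‖) := by gcongr
        _ = _ := by ring
  have hsm : Tendsto (fun a => t * C * ‖m a • (ι (g a) - exp ((m a)⁻¹ • Y))‖) F (𝓝 0) := by
    simpa using hd.norm.const_mul (t * C)
  have hin : ∀ᶠ a in F, ι (g a) ^ ⌊t * m a⌋₊ ∈ ι '' V := by
    filter_upwards [est, hsm.eventually_lt_const (half_pos hδ), hg.eventually hV] with a h1 h2 h3
    refine ⟨g a ^ ⌊t * m a⌋₊, h (g a) h3 _ (fun j hj => ?_) _ le_rfl, map_pow _ _ _⟩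
    obtain ⟨i1, i2, i3⟩ := h1 j hj
    have i4 := hb1 _ i1 i2
    have := norm_add_le (ι (g a) ^ j - exp (((j : ℝ) * (m a)⁻¹) • Y))
      (exp (((j : ℝ) * (m a)⁻¹) • Y) - 1)
    rw [sub_add_sub_cancel] at this
    linarith
  have hfl : Tendsto (fun a => (⌊t * m a⌋₊ : ℝ) * (m a)⁻¹) F (𝓝 t) := by
    have := (tendsto_nat_floor_mul_div_atTop (R := ℝ) ht0.le).comp hm
    simpa [Function.comp_def, div_eq_mul_inv] using this
  have hlim : Tendsto (fun a => ι (g a) ^ ⌊t * m a⌋₊) F (𝓝 (exp (t • Y))) := by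
    have h1 : Tendsto (fun a => exp (((⌊t * m a⌋₊ : ℝ) * (m a)⁻¹) • Y)) F (𝓝 (exp (t • Y))) :=
      (exp_cont.tendsto _).comp (hfl.smul_const Y)
    have h2 : Tendsto (fun a => ι (g a) ^ ⌊t * m a⌋₊ -
        exp (((⌊t * m a⌋₊ : ℝ) * (m a)⁻¹) • Y)) F (𝓝 0) := by
      refine squeeze_zero_norm' ?_ hsm
      filter_upwards [est] with a ha
      exact (ha _ le_rfl).2.2
    simpa using h2.add h1
  have := (hVc.image hc).isClosed.mem_of_tendsto hlim hin
  exact Set.image_mono hVU this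

lemma exp_gen (Z : A) : Tendsto (fun t : ℝ => t⁻¹ • (exp (t • Z) - 1)) (𝓝[>] 0) (𝓝 Z) := by
  have hid : Tendsto (fun t : ℝ => t) (𝓝[>] 0) (𝓝 0) := tendsto_id.mono_left nhdsWithin_le_nhds
  apply exp_little
  · simpa using hid.smul_const Z
  · apply tendsto_const_nhds.congr'
    filter_upwards [self_mem_nhdsWithin] with t ht
    rw [smul_smul, inv_mul_cancel₀ (ne_of_gt ht), one_smul]

lemma bracket_mem (X Y : A) (L : Set A) (hL : IsClosed L)
    (h : ∀ᶠ t in 𝓝[>] (0 : ℝ), t⁻¹ • (exp (t • X) * Y * exp (t • (-X)) - Y) ∈ L) :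
    X * Y - Y * X ∈ L := by
  have hid : Tendsto (fun t : ℝ => t) (𝓝[>] 0) (𝓝 0) := tendsto_id.mono_left nhdsWithin_le_nhds
  have h1 : Tendsto (fun t : ℝ => exp (t • (-X))) (𝓝[>] 0) (𝓝 1) := by
    have := (exp_cont (A := A)).tendsto 0
    rw [exp_zero] at this
    exact this.comp (by simpa using hid.smul_const (-X))
  have h2 := (((exp_gen X).mul_const Y).mul h1).add ((exp_gen (-X)).const_mul Y)
  rw [mul_one, mul_neg, ← sub_eq_add_neg] at h2
  refine hL.mem_of_tendsto h2 ?_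
  filter_upwards [h] with t ht
  convert ht using 1
  rw [smul_mul_assoc, smul_mul_assoc, mul_smul_comm, ← smul_add]
  congr 1
  noncomm_ring

lemma LA_lift (ι : G →* A) (hi : Function.Injective ι) (X : A) (hX : X ∈ LA ι) :
    ∃ γ : ℝ → G, Tendsto γ (𝓝[>] 0) (𝓝 1) ∧ ∀ᶠ t in 𝓝[>] (0 : ℝ), ι (γ t) = exp (t • X) := by
  refine ⟨fun t => Function.invFun ι (exp (t • X)), ?_, ?_⟩
  · intro V hV
    rw [Filter.mem_map]
    filter_upwards [hX V hV] with t ht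
    obtain ⟨g, hg, h⟩ := ht
    simp only [Set.mem_preimage]
    rw [← h, Function.leftInverse_invFun hi]
    exact hg
  · filter_upwards [hX _ univ_mem] with t ht
    obtain ⟨g, hg, h⟩ := ht
    rw [← h, Function.leftInverse_invFun hi]

lemma LA_add [LocallyCompactSpace G] (ι : G →* A) (hc : Continuous ι)
    (hi : Function.Injective ι) (hn : ∀ g, ‖ι g‖ ≤ 1) (X Y : A) (hX : X ∈ LA ι) (hY : Y ∈ LA ι) :
    X + Y ∈ LA ι := by
  obtain ⟨γ, hγ, hγX⟩ := LA_lift ι hi X hX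
  obtain ⟨η, hη, hηY⟩ := LA_lift ι hi Y hY
  have hid : Tendsto (fun t : ℝ => t) (𝓝[>] 0) (𝓝 0) := tendsto_id.mono_left nhdsWithin_le_nhds
  refine limit_lemma ι hc hi hn (F := 𝓝[>] (0 : ℝ)) (fun t => γ t * η t) (fun t => t⁻¹) _
    (by simpa using hγ.mul hη) tendsto_inv_nhdsGT_zero ?_
  have h1 : Tendsto (fun t : ℝ => exp (t • Y)) (𝓝[>] 0) (𝓝 1) := by
    have := (exp_cont (A := A)).tendsto 0
    rw [exp_zero] at this
    exact this.comp (by simpa using hid.smul_const Y)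
  have h2 := ((exp_gen X).mul h1).add (exp_gen Y)
  rw [mul_one] at h2
  refine h2.congr' ?_
  filter_upwards [hγX, hηY] with t h3 h4
  rw [map_mul, h3, h4, smul_mul_assoc, ← smul_add]
  congr 1
  noncomm_ring

/-- The Lie algebra as a real subspace. -/
def Lsub [LocallyCompactSpace G] (ι : G →* A) (hc : Continuous ι)
    (hi : Function.Injective ι) (hn : ∀ g, ‖ι g‖ ≤ 1) : Submodule ℝ A where
  carrier := LA ι
  add_mem' := fun {X Y} hX hY => LA_add ι hc hi hn X Y hX hY
  zero_mem' := fun V hV => Eventually.of_forall fun t => ⟨1, mem_of_mem_nhds hV, by simp⟩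
  smul_mem' := fun c X hX => LA_smul ι X hX c

lemma LA_conj (ι : G →* A) (g : G) (X : A) (hX : X ∈ LA ι) : ι g * X * ι g⁻¹ ∈ LA ι := by
  intro V hV
  have hV' : (fun x => g * x * g⁻¹) ⁻¹' V ∈ 𝓝 (1 : G) := by
    have : Continuous (fun x => g * x * g⁻¹) := by fun_prop
    exact this.continuousAt.preimage_mem_nhds (by simpa using hV)
  filter_upwards [hX _ hV'] with t ht
  obtain ⟨x, hx, h⟩ := ht
  refine ⟨g * x * g⁻¹, hx, ?_⟩
  have : t • (ι g * X * ι g⁻¹) = ι g * (t • X) * ι g⁻¹ := by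
    rw [mul_smul_comm, smul_mul_assoc]
  rw [this, exp_conj_of _ _ _ (by rw [← map_mul]; simp) (by rw [← map_mul]; simp), map_mul,
    map_mul, h]

lemma exp_mem_range [LocallyCompactSpace G] (ι : G →* A) (X : A) (hX : X ∈ LA ι) :
    ∃ g, ι g = exp X := by
  have ht : Tendsto (fun N : ℕ => 1 / ((N : ℝ) + 1)) atTop (𝓝[>] 0) :=
    tendsto_nhdsWithin_iff.2 ⟨tendsto_one_div_add_atTop_nhds_zero_nat,
      Eventually.of_forall fun N => by simp only [Set.mem_Ioi]; positivity⟩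
  obtain ⟨N, g, hg, hgX⟩ := (ht.eventually (hX _ univ_mem)).exists
  refine ⟨g ^ (N+1), ?_⟩
  rw [map_pow, hgX, ← exp_natCast_smul, smul_smul]
  have : ((N + 1 : ℕ) : ℝ) * (1 / ((N : ℝ) + 1)) = 1 := by push_cast; field_simp
  rw [this, one_smul]

lemma local_exp [LocallyCompactSpace G] [FiniteDimensional ℝ A] (ι : G →* A) (hc : Continuous ι)
    (hi : Function.Injective ι) (hn : ∀ g, ‖ι g‖ ≤ 1) :
    ∀ᶠ g in 𝓝 (1 : G), ∃ X ∈ LA ι, ι g = exp X := by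
  set L := Lsub ι hc hi hn with hL
  have memL : ∀ X, X ∈ L ↔ X ∈ LA ι := fun X => Iff.rfl
  obtain ⟨p, hp⟩ := L.subtype.exists_leftInverse_of_injective (by simp)
  have hp' : ∀ x ∈ L, ((p x : L) : A) = x := fun x hx => by
    have := LinearMap.congr_fun hp ⟨x, hx⟩
    simpa using congrArg Subtype.val this
  set P : A →L[ℝ] A := LinearMap.toContinuousLinearMap (L.subtype ∘ₗ p) with hP
  have hPm : ∀ x, P x ∈ L := fun x => (p x).2
  have hPid : ∀ x ∈ L, P x = x := fun x hx => hp' x hx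
  set Q : A →L[ℝ] A := ContinuousLinearMap.id ℝ A - P with hQ
  have hQm : ∀ x, P (Q x) = 0 := fun x => by
    simp [hQ, hPid _ (hPm x)]
  set Φ : A → A := fun x => exp (P x) * exp (Q x) with hΦ
  have hE : ∀ T : A →L[ℝ] A, HasStrictFDerivAt (fun x => exp (T x)) T 0 := by
    intro T
    have h1 : HasStrictFDerivAt (exp : A → A) (1 : A →L[ℝ] A) (T 0) := by
      rw [map_zero]; exact hasStrictFDerivAt_exp_zero
    have := h1.comp (0 : A) T.hasStrictFDerivAt
    exact this
  have hD : HasStrictFDerivAt Φ ((ContinuousLinearEquiv.refl ℝ A : A ≃L[ℝ] A) : A →L[ℝ] A) 0 := by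
    refine ((hE P).mul' (hE Q)).congr_fderiv ?_
    ext x
    simp [hQ]
  have hΦ0 : Φ 0 = 1 := by simp [hΦ]
  set Ψ := hD.localInverse with hΨ
  have hΨt : Tendsto Ψ (𝓝 1) (𝓝 0) := by
    have := hD.localInverse_tendsto
    rwa [hΦ0] at this
  have hΨr : ∀ᶠ y in 𝓝 (1 : A), Φ (Ψ y) = y := by
    have := hD.eventually_right_inverse
    rwa [hΦ0] at this
  have hι : Tendsto ι (𝓝 1) (𝓝 1) := by simpa using hc.tendsto 1
  -- the element of G over exp (P ..)
  choose! e he using exp_mem_range ι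
  have het : ∀ {α : Type _} {F : Filter α} (X : α → A), (∀ a, X a ∈ L) → Tendsto X F (𝓝 0) →
      Tendsto (fun a => e (X a)) F (𝓝 1) := by
    intro α F X hX hX0 V hV
    rw [Filter.mem_map]
    filter_upwards [hX0.eventually (exp_small ι hc hi V hV)] with a ha
    obtain ⟨g, hg, h⟩ := ha (hX a)
    have : g = e (X a) := hi (by rw [h, he _ (hX a)])
    simpa [← this] using hg
  by_contra hcon
  rw [Filter.not_eventually] at hcon
  set F : Filter G := 𝓝 1 ⊓ 𝓟 {g | ¬ ∃ X ∈ LA ι, ι g = exp X} with hF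
  have hFne : NeBot F := Filter.frequently_iff_neBot.1 hcon
  have hF1 : F ≤ 𝓝 1 := inf_le_left
  have hF2 : ∀ᶠ g in F, ¬ ∃ X ∈ LA ι, ι g = exp X := mem_inf_of_right (mem_principal_self _)
  set X : G → A := fun g => P (Ψ (ι g)) with hX
  set Y : G → A := fun g => Q (Ψ (ι g)) with hY
  have hΨι : Tendsto (fun g => Ψ (ι g)) F (𝓝 0) := (hΨt.comp hι).mono_left hF1
  have hX0 : Tendsto X F (𝓝 0) := by
    have h := (P.continuous.tendsto 0).comp hΨι
    rw [map_zero] at h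
    exact h
  have hY0 : Tendsto Y F (𝓝 0) := by
    have h := (Q.continuous.tendsto 0).comp hΨι
    rw [map_zero] at h
    exact h
  have hprod : ∀ᶠ g in F, exp (X g) * exp (Y g) = ι g := (hι.mono_left hF1).eventually hΨr
  have hYne : ∀ᶠ g in F, Y g ≠ 0 := by
    filter_upwards [hprod, hF2] with g h1 h2 h3
    exact h2 ⟨X g, hPm _, by rw [← h1, h3]; simp⟩
  set g' : G → G := fun g => (e (X g))⁻¹ * g with hg'
  have hg't : Tendsto g' F (𝓝 1) := by
    simpa using (het X (fun a => hPm _) hX0).inv.mul (tendsto_id.mono_left hF1)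
  have hg'Y : ∀ᶠ g in F, ι (g' g) = exp (Y g) := by
    filter_upwards [hprod] with g h1
    have h2 : ι (e (X g)) = exp (X g) := he _ (hPm _)
    have h3 : ι (e (X g))⁻¹ * ι (e (X g)) = 1 := by rw [← map_mul]; simp
    rw [hg', map_mul, ← h1, ← h2, ← mul_assoc, h3, one_mul]
  -- subsequence
  have hprop : ProperSpace A := FiniteDimensional.proper ℝ A
  have hcomp : IsCompact (Metric.sphere (0 : A) 1) := isCompact_sphere 0 1
  set u : G → A := fun g => ‖Y g‖⁻¹ • Y g with hu
  have hus : ∀ᶠ g in F, u g ∈ Metric.sphere (0 : A) 1 := by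
    filter_upwards [hYne] with g hg
    rw [mem_sphere_zero_iff_norm, hu, norm_smul, norm_inv, norm_norm,
      inv_mul_cancel₀ (norm_ne_zero_iff.2 hg)]
  let W : Ultrafilter G := Ultrafilter.of F
  have hW : (W : Filter G) ≤ F := Ultrafilter.of_le F
  obtain ⟨Z, hZs, hZ⟩ := hcomp.ultrafilter_le_nhds (W.map u) (by
    rw [le_principal_iff]; exact hW hus)
  have hZ' : Tendsto u W (𝓝 Z) := hZ
  have hZL : Z ∈ LA ι := by
    refine limit_lemma ι hc hi hn (F := (W : Filter G)) g' (fun g => ‖Y g‖⁻¹) Z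
      (hg't.mono_left hW) ?_ ?_
    · apply tendsto_inv_nhdsGT_zero.comp
      refine tendsto_nhdsWithin_iff.2 ⟨?_, ?_⟩
      · simpa using (hY0.mono_left hW).norm
      · filter_upwards [hW hYne] with g hg
        exact norm_pos_iff.2 hg
    · refine (exp_little (fun g => ‖Y g‖⁻¹) Y Z (hY0.mono_left hW) hZ').congr' ?_
      filter_upwards [hW hg'Y] with g hg
      rw [hg]
  have hPZ : P Z = 0 := by
    have h1 : Tendsto (fun g => P (u g)) W (𝓝 (P Z)) := (P.continuous.tendsto Z).comp hZ'
    have h2 : (fun g => P (u g)) = fun _ => 0 := by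
      funext g
      simp only [hu, map_smul, hY, hQm, smul_zero]
    rw [h2] at h1
    exact tendsto_nhds_unique h1 tendsto_const_nhds
  rw [hPid Z hZL] at hPZ
  rw [hPZ] at hZs
  simp at hZs

lemma generate [LocallyCompactSpace G] [ConnectedSpace G] [FiniteDimensional ℝ A] (ι : G →* A)
    (hc : Continuous ι) (hi : Function.Injective ι) (hn : ∀ g, ‖ι g‖ ≤ 1)
    (S : Subgroup G) (hS : ∀ X ∈ LA ι, ∀ g, ι g = exp X → g ∈ S) (g : G) : g ∈ S := by
  have h1 : (S : Set G) ∈ 𝓝 (1 : G) := by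
    filter_upwards [local_exp ι hc hi hn] with g hg
    obtain ⟨X, hX, h⟩ := hg
    exact hS X hX g h
  have h2 := S.isOpen_of_mem_nhds h1
  have h3 : (S : Set G) = Set.univ :=
    IsClopen.eq_univ ⟨S.isClosed_of_isOpen h2, h2⟩ ⟨1, S.one_mem⟩
  have : g ∈ (S : Set G) := h3 ▸ Set.mem_univ g
  exact this

end Abstract

section Mat
open scoped Matrix.Norms.L2Operator
open Matrix

variable {n : ℕ}

local notation "Mn" => Matrix (Fin n) (Fin n) ℂ

lemma det_exp_skew (X : Matrix (Fin n) (Fin n) ℂ) (hX : star X = -X) :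
    (exp X).det = Complex.exp X.trace := by
  have hH : ((-Complex.I) • X).IsHermitian := by
    rw [Matrix.IsHermitian, Matrix.conjTranspose_smul, ← Matrix.star_eq_conjTranspose, hX]
    simp
  have hs := hH.spectral_theorem
  rw [Unitary.conjStarAlgAut_apply] at hs
  set U := hH.eigenvectorUnitary
  set d := Matrix.diagonal (RCLike.ofReal ∘ hH.eigenvalues : Fin n → ℂ) with hd
  have hXe : X = (U : Mn) * (Complex.I • d) * star (U : Mn) := by
    rw [Matrix.mul_smul, Matrix.smul_mul, ← hs, smul_smul]; simp
  have hI : Complex.I • d = Matrix.diagonal (fun i => Complex.I * (hH.eigenvalues i : ℂ)) := by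
    rw [hd, ← Matrix.diagonal_smul]; rfl
  have h1 : (U : Mn) * star (U : Mn) = 1 := Unitary.mul_star_self_of_mem U.2
  have h2 : star (U : Mn) * (U : Mn) = 1 := Unitary.star_mul_self_of_mem U.2
  rw [hXe, exp_conj_of _ _ _ h1 h2, Matrix.det_mul_right_comm, h1, one_mul,
    Matrix.trace_mul_comm, ← mul_assoc, h2, one_mul, hI, Matrix.exp_diagonal,
    Matrix.det_diagonal, Matrix.trace_diagonal, Complex.exp_sum]
  refine Finset.prod_congr rfl fun i _ => ?_
  rw [Pi.coe_exp, Complex.exp_eq_exp_ℂ]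

lemma norm_unitary_le (U : ↥(Matrix.unitaryGroup (Fin n) ℂ)) : ‖(U : Mn)‖ ≤ 1 := by
  have h : star (U : Mn) * (U : Mn) = 1 := Unitary.star_mul_self_of_mem U.2
  have h1 := CStarRing.norm_star_mul_self (x := (U : Mn))
  rw [h] at h1
  have h2 : ‖(1 : Mn)‖ ≤ 1 := by
    have := CStarRing.norm_star_mul_self (x := (1 : Mn))
    rw [star_one, one_mul] at this
    nlinarith [norm_nonneg (1 : Mn)]
  nlinarith [norm_nonneg (U : Mn)]

lemma compact_unitary : CompactSpace ↥(Matrix.unitaryGroup (Fin n) ℂ) := by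
  have hprop : ProperSpace Mn := FiniteDimensional.proper ℂ _
  refine isCompact_iff_compactSpace.1 (Metric.isCompact_of_isClosed_isBounded ?_ ?_)
  · have : ((Matrix.unitaryGroup (Fin n) ℂ : Submonoid Mn) : Set Mn) =
        {U : Mn | star U * U = 1} := by
      ext U; exact Matrix.mem_unitaryGroup_iff'
    rw [this]
    exact isClosed_eq (by fun_prop) continuous_const
  · refine (Metric.isBounded_closedBall (x := (0 : Mn)) (r := 1)).subset fun U hU => ?_
    rw [mem_closedBall_zero_iff]
    exact norm_unitary_le ⟨U, hU⟩

variable {G : Type*} [Group G] [TopologicalSpace G] [IsTopologicalGroup G]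

/-- the matrix valued homomorphism -/
def mat (ι : G →* ↥(Matrix.unitaryGroup (Fin n) ℂ)) : G →* Matrix (Fin n) (Fin n) ℂ :=
  (Submonoid.subtype _).comp ι

lemma mat_apply (ι : G →* ↥(Matrix.unitaryGroup (Fin n) ℂ)) (g : G) : mat ι g = (ι g : Mn) := rfl

lemma LA_skew (ι : G →* ↥(Matrix.unitaryGroup (Fin n) ℂ)) (X : Matrix (Fin n) (Fin n) ℂ)
    (hX : X ∈ LA (mat ι)) : star X = -X := by
  refine tendsto_nhds_unique (exp_gen (star X)) ((exp_gen (-X)).congr' ?_)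
  filter_upwards [hX _ univ_mem] with t ht
  obtain ⟨g, -, hg⟩ := ht
  congr 2
  have h1 : star (exp (t • X)) * exp (t • X) = 1 := by
    rw [← hg]; exact Unitary.star_mul_self_of_mem (ι g).2
  have h2 : star (exp (t • X)) = exp (t • star X) := by
    rw [NormedSpace.star_exp, star_smul]; simp
  have h3 := exp_neg_mul (t • (-X))
  rw [← smul_neg, neg_neg] at h3
  rw [h2] at h1
  calc exp (t • (-X)) = (exp (t • star X) * exp (t • X)) * exp (t • (-X)) := by rw [h1, one_mul]
    _ = _ := by rw [mul_assoc, h3, mul_one]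

open scoped ComplexOrder

/-- The form `Re tr (X Y)`. -/
noncomputable def trForm (n : ℕ) : LinearMap.BilinForm ℝ (Matrix (Fin n) (Fin n) ℂ) :=
  (LinearMap.mul ℝ (Matrix (Fin n) (Fin n) ℂ)).compr₂
    (Complex.reLm ∘ₗ Matrix.traceLinearMap (Fin n) ℝ ℂ)

lemma trForm_apply (X Y : Matrix (Fin n) (Fin n) ℂ) : trForm n X Y = ((X * Y).trace).re := rfl

lemma trForm_skew (X : Matrix (Fin n) (Fin n) ℂ) (hX : star X = -X) (h : trForm n X X = 0) :
    X = 0 := by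
  rw [← Matrix.trace_conjTranspose_mul_self_eq_zero_iff, ← Matrix.star_eq_conjTranspose]
  have him : (star X * X).trace.im = 0 := by
    have h1 : star ((star X * X).trace) = (star X * X).trace := by
      rw [← Matrix.trace_conjTranspose, ← Matrix.star_eq_conjTranspose, star_mul, star_star]
    exact Complex.conj_eq_iff_im.1 h1
  have hre : (star X * X).trace.re = 0 := by
    rw [hX, neg_mul, Matrix.trace_neg, Complex.neg_re, ← trForm_apply, h, neg_zero]
  exact Complex.ext hre him

/-- An element commuting with a group having dense orbits is scalar. -/
lemma scalar_of_commute (hn : 1 ≤ n) (ι : G →* ↥(Matrix.unitaryGroup (Fin n) ℂ))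
    (hdense : ∀ z ∈ Metric.sphere (0 : EuclideanSpace ℂ (Fin n)) 1,
      Metric.sphere (0 : EuclideanSpace ℂ (Fin n)) 1 ⊆
        closure {w : EuclideanSpace ℂ (Fin n) |
          ∃ g : G, Matrix.toEuclideanLin ((ι g : Matrix (Fin n) (Fin n) ℂ)) z = w})
    (Z : Matrix (Fin n) (Fin n) ℂ) (hZ : ∀ g, Commute Z (mat ι g)) :
    ∃ c : ℂ, Z = c • 1 := by
  have : Nonempty (Fin n) := ⟨⟨0, hn⟩⟩
  obtain ⟨c, hc⟩ := Module.End.exists_eigenvalue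
    (Matrix.toEuclideanLin Z : Module.End ℂ (EuclideanSpace ℂ (Fin n)))
  obtain ⟨v, hv⟩ := hc.exists_hasEigenvector
  have hv0 : v ≠ 0 := hv.2
  have hve : Matrix.toEuclideanLin Z v = c • v := hv.apply_eq_smul
  set z : EuclideanSpace ℂ (Fin n) := (((‖v‖⁻¹ : ℝ) : ℂ)) • v with hz
  have hz1 : z ∈ Metric.sphere (0 : EuclideanSpace ℂ (Fin n)) 1 := by
    rw [mem_sphere_zero_iff_norm, hz, norm_smul, Complex.norm_real, norm_inv, norm_norm,
      inv_mul_cancel₀ (norm_ne_zero_iff.2 hv0)]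
  have hze : Matrix.toEuclideanLin Z z = c • z := by
    rw [hz, map_smul, hve, smul_comm]
  have hmul : ∀ (A B : Mn) (w : EuclideanSpace ℂ (Fin n)), Matrix.toEuclideanLin (A * B) w =
      Matrix.toEuclideanLin A (Matrix.toEuclideanLin B w) := by
    intro A B w
    simp [Matrix.toLpLin_apply, Matrix.mulVec_mulVec]
  have hcl : IsClosed {w : EuclideanSpace ℂ (Fin n) | Matrix.toEuclideanLin Z w = c • w} :=
    isClosed_eq (LinearMap.continuous_of_finiteDimensional _) (by fun_prop)
  have hsph : ∀ w ∈ Metric.sphere (0 : EuclideanSpace ℂ (Fin n)) 1,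
      Matrix.toEuclideanLin Z w = c • w := by
    intro w hw
    refine closure_minimal ?_ hcl (hdense z hz1 hw)
    rintro _ ⟨g, rfl⟩
    have := hZ g
    rw [mat_apply] at this
    rw [Set.mem_ofPred_eq, ← hmul, this.eq, hmul, hze, map_smul]
  have hall : ∀ w, Matrix.toEuclideanLin Z w = c • w := by
    intro w
    by_cases hw : w = 0
    · simp [hw]
    · have h1 := hsph ((((‖w‖⁻¹ : ℝ) : ℂ)) • w) (by
        rw [mem_sphere_zero_iff_norm, norm_smul, Complex.norm_real, norm_inv, norm_norm,
          inv_mul_cancel₀ (norm_ne_zero_iff.2 hw)])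
      rw [map_smul, smul_comm] at h1
      refine smul_right_injective _ ?_ h1
      simpa using hw
  refine ⟨c, (Matrix.toEuclideanLin (𝕜 := ℂ) (m := Fin n) (n := Fin n)).injective ?_⟩
  refine LinearMap.ext fun w => ?_
  rw [hall, map_smul]
  simp [Matrix.toLpLin_apply]

lemma trace_aux (X Z Y : Matrix (Fin n) (Fin n) ℂ) (hY : Y = Z * X - X * Z) :
    (Y * Y).trace = ((X * Y - Y * X) * Z).trace := by
  have h1 : Y * Y = Z * (X * Y) - X * Z * Y := by
    nth_rewrite 1 [hY]
    rw [sub_mul, mul_assoc]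
  rw [h1, sub_mul, Matrix.trace_sub, Matrix.trace_sub, Matrix.trace_mul_comm Z,
    mul_assoc Y, Matrix.trace_mul_comm (X * Z)]

set_option maxHeartbeats 600000 in
lemma range_closed (hn : 1 ≤ n) [LocallyCompactSpace G] [ConnectedSpace G]
    (ι : G →* ↥(Matrix.unitaryGroup (Fin n) ℂ)) (hcont : Continuous ι)
    (hinj : Function.Injective ι)
    (hdense : ∀ z ∈ Metric.sphere (0 : EuclideanSpace ℂ (Fin n)) 1,
      Metric.sphere (0 : EuclideanSpace ℂ (Fin n)) 1 ⊆
        closure {w : EuclideanSpace ℂ (Fin n) |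
          ∃ g : G, Matrix.toEuclideanLin ((ι g : Matrix (Fin n) (Fin n) ℂ)) z = w}) :
    IsClosed (Set.range ι) := by
  have hcs : CompactSpace ↥(Matrix.unitaryGroup (Fin n) ℂ) := compact_unitary
  have hcm : Continuous (mat ι) := continuous_subtype_val.comp hcont
  have him : Function.Injective (mat ι) := Subtype.val_injective.comp hinj
  have hnm : ∀ g, ‖mat ι g‖ ≤ 1 := fun g => norm_unitary_le (ι g)
  obtain ⟨K, hKset⟩ : ∃ K : Subgroup ↥(Matrix.unitaryGroup (Fin n) ℂ),
      (K : Set ↥(Matrix.unitaryGroup (Fin n) ℂ)) = closure (Set.range ι) :=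
    ⟨ι.range.topologicalClosure, by rw [Subgroup.topologicalClosure_coe, MonoidHom.coe_range]⟩
  have hKc : IsClosed (K : Set ↥(Matrix.unitaryGroup (Fin n) ℂ)) := by
    rw [hKset]; exact isClosed_closure
  have hιK : ∀ g, ι g ∈ K := fun g => by
    rw [← SetLike.mem_coe, hKset]; exact subset_closure ⟨g, rfl⟩
  have hKcomp : CompactSpace K := isCompact_iff_compactSpace.1 hKc.isCompact
  have hcK : Continuous (mat K.subtype) := by
    have h1 : Continuous (fun x : K => K.subtype x) := continuous_subtype_val
    exact continuous_subtype_val.comp h1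
  have hiK : Function.Injective (mat K.subtype) := fun a b hab =>
    Subtype.ext (Subtype.ext hab)
  have hnK : ∀ g, ‖mat K.subtype g‖ ≤ 1 := fun g => norm_unitary_le (K.subtype g)
  obtain ⟨h, memh⟩ : ∃ h : Submodule ℝ Mn, ∀ X, X ∈ h ↔ X ∈ LA (mat ι) :=
    ⟨Lsub (mat ι) hcm him hnm, fun X => Iff.rfl⟩
  obtain ⟨k, memk⟩ : ∃ k : Submodule ℝ Mn, ∀ X, X ∈ k ↔ X ∈ LA (mat K.subtype) :=
    ⟨Lsub (mat K.subtype) hcK hiK hnK, fun X => Iff.rfl⟩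
  have hhc : IsClosed (h : Set Mn) := h.closed_of_finiteDimensional
  -- closed properties pass to `K`
  have pass : ∀ S : Set Mn, IsClosed S → (∀ g, (ι g : Mn) ∈ S) → ∀ x : K, mat K.subtype x ∈ S := by
    intro S hS hg x
    have h1 : IsClosed {u : ↥(Matrix.unitaryGroup (Fin n) ℂ) | (u : Mn) ∈ S} :=
      hS.preimage continuous_subtype_val
    have h2 : closure (Set.range ι) ⊆ {u : ↥(Matrix.unitaryGroup (Fin n) ℂ) | (u : Mn) ∈ S} :=
      closure_minimal (by rintro _ ⟨g, rfl⟩; exact hg g) h1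
    exact h2 (hKset ▸ x.2)
  -- h ⊆ k
  have hhk : h ≤ k := by
    intro X hX
    rw [memk]
    intro V hV
    have hV' : (fun g => (⟨ι g, hιK g⟩ : K)) ⁻¹' V ∈ 𝓝 (1 : G) := by
      have : Continuous (fun g => (⟨ι g, hιK g⟩ : K)) := hcont.subtype_mk _
      refine this.continuousAt.preimage_mem_nhds ?_
      have e : (⟨ι 1, hιK 1⟩ : K) = 1 := Subtype.ext (by simp)
      rw [e]; exact hV
    filter_upwards [(memh X).1 hX _ hV'] with t ht
    obtain ⟨g, hg, hgX⟩ := ht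
    exact ⟨_, hg, hgX⟩
  -- Ad K preserves h
  have hAd : ∀ x : K, ∀ Y ∈ h, mat K.subtype x * Y * star (mat K.subtype x) ∈ h := by
    intro x Y hY
    refine pass {u : Mn | u * Y * star u ∈ h} (hhc.preimage (by fun_prop)) (fun g => ?_) x
    have h1 := LA_conj (mat ι) g Y ((memh Y).1 hY)
    have h2 : mat ι g⁻¹ = star (ι g : Mn) := by
      rw [mat_apply, map_inv]; rfl
    rw [h2] at h1
    exact (memh _).2 h1
  have hbr : ∀ X ∈ k, ∀ Y ∈ h, X * Y - Y * X ∈ h := by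
    intro X hX Y hY
    refine bracket_mem X Y h hhc ?_
    filter_upwards [(memk X).1 hX _ univ_mem] with t ht
    obtain ⟨x, -, hx⟩ := ht
    have h1 := hAd x Y hY
    have h2 : star (mat K.subtype x) = exp (t • (-X)) := by
      rw [hx, NormedSpace.star_exp, star_smul, LA_skew K.subtype X ((memk X).1 hX)]; simp
    rw [h2, hx] at h1
    exact h.smul_mem _ (h.sub_mem h1 hY)
  have hskew : ∀ X ∈ h, star X = -X := fun X hX => LA_skew ι X ((memh X).1 hX)
  have hsym : (trForm n).IsSymm := ⟨fun X Y => by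
    simp only [trForm_apply, RingHom.id_apply]
    rw [Matrix.trace_mul_comm]⟩
  have hcompl : IsCompl h ((trForm n).orthogonal h) := by
    apply LinearMap.BilinForm.isCompl_orthogonal_of_restrict_nondegenerate hsym.isRefl
    have hl : ((trForm n).restrict h).SeparatingLeft := by
      intro X hX
      exact Subtype.ext (trForm_skew (X : Mn) (hskew _ X.2) (hX X))
    have hr : ((trForm n).restrict h).SeparatingRight := by
      intro X hX
      exact Subtype.ext (trForm_skew (X : Mn) (hskew _ X.2) (hX X))
    exact ⟨hl, hr⟩
  have hkh : k ≤ h := by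
    intro W hW
    have hWtop : W ∈ h ⊔ (trForm n).orthogonal h := by rw [hcompl.sup_eq_top]; trivial
    obtain ⟨W1, hW1, Z, hZ, rfl⟩ := Submodule.mem_sup.1 hWtop
    have hZk : Z ∈ k := by
      have := k.sub_mem hW (hhk hW1)
      simpa using this
    have hZo : ∀ X ∈ h, ((X * Z).trace).re = 0 := fun X hX => hZ X hX
    suffices hZ0 : Z = 0 by rw [hZ0, add_zero]; exact hW1
    by_contra hZne
    -- Z commutes with h
    have hcomm : ∀ X ∈ h, Z * X - X * Z = 0 := by
      intro X hX
      have hY := hbr Z hZk X hX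
      refine trForm_skew _ (hskew _ hY) ?_
      have h1 := hZo _ (hbr X (hhk hX) _ hY)
      rw [trForm_apply, ← h1]
      congr 1
      exact trace_aux X Z _ rfl
    have hcommG : ∀ g, Commute Z (mat ι g) := by
      let S : Subgroup G :=
        { carrier := {g | Commute Z (mat ι g)}
          mul_mem' := fun {a b} ha hb => by
            simp only [Set.mem_ofPred_eq, map_mul] at *
            exact ha.mul_right hb
          one_mem' := by simp
          inv_mem' := fun {a} ha => by
            simp only [Set.mem_ofPred_eq] at *
            have e1 : mat ι a * mat ι a⁻¹ = 1 := by rw [← map_mul]; simp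
            have e2 : mat ι a⁻¹ * mat ι a = 1 := by rw [← map_mul]; simp
            have e3 : Commute Z ((⟨mat ι a, mat ι a⁻¹, e1, e2⟩ : Mnˣ) : Mn) := ha
            exact e3.units_inv_right }
      exact generate (mat ι) hcm him hnm S fun X hX g hg => by
        change Commute Z (mat ι g)
        rw [hg]
        exact (show Commute Z X from sub_eq_zero.1 (hcomm X ((memh X).2 hX))).exp_right
    obtain ⟨c, hc⟩ := scalar_of_commute hn ι hdense Z hcommG
    have hc0 : c ≠ 0 := fun h0 => hZne (by rw [hc, h0, zero_smul])
    have hZs : star Z = -Z := LA_skew K.subtype Z ((memk Z).1 hZk)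
    have hre : ∀ X : Mn, star X = -X → X.trace.re = 0 := by
      intro X hX
      have h1 : star X.trace = (star X).trace := by
        rw [Matrix.star_eq_conjTranspose, Matrix.trace_conjTranspose]
      rw [hX, Matrix.trace_neg] at h1
      have := congrArg Complex.re h1
      simp at this
      linarith
    have htrZ : Z.trace = n * c := by
      rw [hc, Matrix.trace_smul, Matrix.trace_one]; simp [mul_comm]
    have hn0 : (n : ℝ) ≠ 0 := by positivity
    have hcre : c.re = 0 := by
      have := hre Z hZs
      rw [htrZ] at this
      simp at this
      rcases this with h | h
      · omega
      · exact h
    have hcim : c.im ≠ 0 := fun h0 => hc0 (Complex.ext hcre h0)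
    have htr0 : ∀ X ∈ h, X.trace = 0 := by
      intro X hX
      have h1 := hZo X hX
      have h2 := hre X (hskew X hX)
      rw [hc, Matrix.mul_smul, mul_one, Matrix.trace_smul, smul_eq_mul, Complex.mul_re, hcre, h2]
        at h1
      refine Complex.ext h2 ?_
      have : c.im * X.trace.im = 0 := by linarith
      exact (mul_eq_zero.1 this).resolve_left hcim
    have hdetG : ∀ g, (ι g : Mn).det = 1 := by
      let S : Subgroup G := ((Matrix.detMonoidHom).comp (mat ι)).ker
      intro g
      refine generate (mat ι) hcm him hnm S (fun X hX g hg => ?_) g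
      change (mat ι g).det = 1
      have hX := (memh X).2 hX
      rw [hg, det_exp_skew X (hskew X hX), htr0 X hX, Complex.exp_zero]
    have hdetK : ∀ x : K, (mat K.subtype x).det = 1 :=
      pass {u : Mn | u.det = 1} (isClosed_eq (Continuous.matrix_det continuous_id) continuous_const)
        hdetG
    have hexp : ∀ᶠ t in 𝓝[>] (0 : ℝ), exp (t • Z.trace) = 1 := by
      filter_upwards [(memk Z).1 hZk _ univ_mem] with t ht
      obtain ⟨x, -, hx⟩ := ht
      have h1 := hdetK x
      rw [hx, det_exp_skew _ (by rw [star_smul, hZs]; simp), Matrix.trace_smul,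
        Complex.exp_eq_exp_ℂ] at h1
      exact h1
    have hlim := exp_gen Z.trace
    have hz : Z.trace = 0 := by
      refine tendsto_nhds_unique hlim (tendsto_const_nhds.congr' ?_)
      filter_upwards [hexp] with t ht
      rw [ht, sub_self, smul_zero]
    rw [htrZ] at hz
    have := (mul_eq_zero.1 hz).resolve_right hc0
    exact hn0 (by exact_mod_cast this)
  -- hence the range is open in K
  have hloc := local_exp (mat K.subtype) hcK hiK hnK
  set R : Subgroup K := ι.range.subgroupOf K with hR
  have hRn : (R : Set K) ∈ 𝓝 (1 : K) := by
    filter_upwards [hloc] with x hx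
    obtain ⟨X, hX, hxX⟩ := hx
    obtain ⟨g, hg⟩ := exp_mem_range (mat ι) X ((memh X).1 (hkh ((memk X).2 hX)))
    change (x : ↥(Matrix.unitaryGroup (Fin n) ℂ)) ∈ ι.range
    exact ⟨g, Subtype.ext (by rw [← mat_apply, hg, ← hxX]; rfl)⟩
  have hRc : IsClosed (R : Set K) := R.isClosed_of_isOpen (R.isOpen_of_mem_nhds hRn)
  have himg : IsClosed (Subtype.val '' (R : Set K)) :=
    hKc.isClosedEmbedding_subtypeVal.isClosedMap _ hRc
  have heq : Subtype.val '' (R : Set K) = Set.range ι := by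
    ext u
    constructor
    · rintro ⟨x, hx, rfl⟩
      exact hx
    · rintro ⟨g, rfl⟩
      exact ⟨⟨ι g, hιK g⟩, ⟨g, rfl⟩, rfl⟩
  rwa [heq] at himg

lemma orbit_full [LocallyCompactSpace G]
    (ι : G →* ↥(Matrix.unitaryGroup (Fin n) ℂ)) (hr : IsClosed (Set.range ι))
    (z : EuclideanSpace ℂ (Fin n)) (hz : z ∈ Metric.sphere (0 : EuclideanSpace ℂ (Fin n)) 1)
    (hdense : Metric.sphere (0 : EuclideanSpace ℂ (Fin n)) 1 ⊆
        closure {w : EuclideanSpace ℂ (Fin n) |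
          ∃ g : G, Matrix.toEuclideanLin ((ι g : Matrix (Fin n) (Fin n) ℂ)) z = w}) :
      {w : EuclideanSpace ℂ (Fin n) |
          ∃ g : G, Matrix.toEuclideanLin ((ι g : Matrix (Fin n) (Fin n) ℂ)) z = w} =
        Metric.sphere (0 : EuclideanSpace ℂ (Fin n)) 1 := by
  have hcs : CompactSpace ↥(Matrix.unitaryGroup (Fin n) ℂ) := compact_unitary
  set O := {w : EuclideanSpace ℂ (Fin n) |
          ∃ g : G, Matrix.toEuclideanLin ((ι g : Matrix (Fin n) (Fin n) ℂ)) z = w} with hO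
  have hOc : IsClosed O := by
    have e : O = (fun u : ↥(Matrix.unitaryGroup (Fin n) ℂ) =>
        Matrix.toEuclideanLin (u : Mn) z) '' Set.range ι := by
      ext w; simp [hO]
    rw [e]
    refine (hr.isCompact.image ?_).isClosed
    have : Continuous fun A : Mn => Matrix.toEuclideanLin A z :=
      LinearMap.continuous_of_finiteDimensional
        ((LinearMap.applyₗ z).comp (Matrix.toEuclideanLin (𝕜 := ℂ) (m := Fin n) (n := Fin n)).toLinearMap)
    exact this.comp continuous_subtype_val
  refine Set.Subset.antisymm ?_ (by rwa [hOc.closure_eq] at hdense)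
  rintro _ ⟨g, rfl⟩
  rw [mem_sphere_zero_iff_norm] at hz ⊢
  have key : ∀ (u : ↥(Matrix.unitaryGroup (Fin n) ℂ)) (w : EuclideanSpace ℂ (Fin n)),
      ‖Matrix.toEuclideanLin (u : Mn) w‖ ≤ ‖w‖ := by
    intro u w
    have h1 := Matrix.l2_opNorm_mulVec (u : Mn) w
    have h2 := norm_unitary_le u
    calc _ ≤ ‖(u : Mn)‖ * ‖w‖ := h1
      _ ≤ 1 * ‖w‖ := by gcongr
      _ = _ := one_mul _
  refine le_antisymm ((key _ _).trans hz.le) ?_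
  have h3 := key (ι g)⁻¹ (Matrix.toEuclideanLin (ι g : Mn) z)
  have h4 : Matrix.toEuclideanLin (((ι g)⁻¹ : ↥(Matrix.unitaryGroup (Fin n) ℂ)) : Mn)
      (Matrix.toEuclideanLin (ι g : Mn) z) = z := by
    have e : (((ι g)⁻¹ : ↥(Matrix.unitaryGroup (Fin n) ℂ)) : Mn) * (ι g : Mn) = 1 :=
      Unitary.star_mul_self_of_mem (ι g).2
    simp [Matrix.toLpLin_apply, Matrix.mulVec_mulVec, e]
  rw [h4, hz] at h3
  exact h3

end Mat
end DenseOrbits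

/-- from the proof of Theorem 4.1 of the paper. If a connected Lie
group acts on the unit sphere of `ℂ^n` through a faithful continuous unitary
representation with dense orbits, then all its orbits are the whole sphere. -/
theorem dense_orbits_of_connected_lie_group_are_full {n : ℕ} (hn : 1 ≤ n)
    {E : Type*} [NormedAddCommGroup E] [NormedSpace ℝ E] [FiniteDimensional ℝ E]
    {G : Type*} [TopologicalSpace G] [ChartedSpace E G] [Group G]
    [IsTopologicalGroup G] [LieGroup (𝓘(ℝ, E)) (⊤ : ℕ∞) G] [ConnectedSpace G]
    (ι : G →* ↥(Matrix.unitaryGroup (Fin n) ℂ))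
    (hcont : Continuous ι)
    (hinj : Function.Injective ι)
    (hdense : ∀ z ∈ Metric.sphere (0 : EuclideanSpace ℂ (Fin n)) 1,
      Metric.sphere (0 : EuclideanSpace ℂ (Fin n)) 1 ⊆
        closure {w : EuclideanSpace ℂ (Fin n) |
          ∃ g : G, Matrix.toEuclideanLin ((ι g : Matrix (Fin n) (Fin n) ℂ)) z = w}) :
    ∀ z ∈ Metric.sphere (0 : EuclideanSpace ℂ (Fin n)) 1,
      {w : EuclideanSpace ℂ (Fin n) |
          ∃ g : G, Matrix.toEuclideanLin ((ι g : Matrix (Fin n) (Fin n) ℂ)) z = w} =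
        Metric.sphere (0 : EuclideanSpace ℂ (Fin n)) 1 := by

  have hlc : LocallyCompactSpace G := ChartedSpace.locallyCompactSpace E G
  intro z hz
  exact DenseOrbits.orbit_full ι (DenseOrbits.range_closed hn ι hcont hinj hdense) z hz
    (hdense z hz)
end
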